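/- Suppose that for every initial probability measure μ̄ on ℝ^d there is at most one curve (μ_t) ∈ KFP(b,a) with μ_0 = μ̄, where uniqueness in the lifted sense holds: for every M̄ ∈ P(P(ℝ^d)) there is at most one solution (M_t) of ∂_t M_t = K*_{b_t,a_t}M_t with M_0 = M̄ and the weighted integrability. Then for every M̄ ∈ P(P(ℝ^d)) there is at most one Λ ∈ P(C([0,T],P(ℝ^d))) concentrated on KFP(b,a), satisfying the integrability condition, with (e_0)_#Λ = M̄. Conversely, uniqueness at the level of Λ implies uniqueness at the level of M via the disintegration of Λ with respect to e_0 and the observation that M_t^i := δ_{μ_t^i} solve the random-measure equation for any μ^i ∈ KFP(b,a). -/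

import Mathlib

open MeasureTheory Set
open scoped ENNReal RealInnerProductSpace

noncomputable section

abbrev Ed (d : ℕ) := EuclideanSpace ℝ (Fin d)

/-- `P(ℝ^d)` with the narrow topology. -/
abbrev Pm (d : ℕ) := ProbabilityMeasure (Ed d)

instance (d : ℕ) : MeasurableSpace (Pm d) := borel _

/-- `C([0,T],P(ℝ^d))` with the compact-open topology. -/
abbrev CurveSp (T : ℝ) (d : ℕ) := C(Set.Icc (0:ℝ) T, Pm d)

instance (T : ℝ) (d : ℕ) : MeasurableSpace (CurveSp T d) := borel _

/-- `ξ ∈ C_c^1((0,T))`. -/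
def IsTestXi (T : ℝ) (ξ : ℝ → ℝ) : Prop :=
  ContDiff ℝ 1 ξ ∧ HasCompactSupport ξ ∧ Function.support ξ ⊆ Set.Ioo 0 T

/-- `φ ∈ C_c^2(ℝ^d)`. -/
def IsTestPhi {d : ℕ} (φ : Ed d → ℝ) : Prop :=
  ContDiff ℝ 2 φ ∧ HasCompactSupport φ

/-- `L^μ_{b_t,a_t}φ(x)`. -/
def Lop {d : ℕ} (b : ℝ → Ed d → Pm d → Ed d)
    (a : ℝ → Ed d → Pm d → (Ed d →L[ℝ] Ed d))
    (μ : Pm d) (t : ℝ) (φ : Ed d → ℝ) (x : Ed d) : ℝ :=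
  ⟪b t x μ, gradient φ x⟫ +
    (1/2) * LinearMap.trace ℝ (Ed d) ((a t x μ ∘L fderiv ℝ (gradient φ) x).toLinearMap)

/-- `L_Φ(μ) = (∫φ_1 dμ, …, ∫φ_k dμ)`. -/
def LPhi {d k : ℕ} (Φ : Fin k → Ed d → ℝ) (μ : Pm d) : Fin k → ℝ :=
  fun i => ∫ x, Φ i x ∂(μ : Measure (Ed d))

/-- The operator `K_{b_t,a_t}` on the cylinder function `F = Ψ ∘ L_Φ`. -/
def Kba {d k : ℕ} (b : ℝ → Ed d → Pm d → Ed d)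
    (a : ℝ → Ed d → Pm d → (Ed d →L[ℝ] Ed d)) (t : ℝ)
    (Ψ : (Fin k → ℝ) → ℝ) (Φ : Fin k → Ed d → ℝ)
    (x : Ed d) (μ : Pm d) : ℝ :=
  ∑ i, fderiv ℝ Ψ (LPhi Φ μ) (Pi.single i 1) * Lop b a μ t (Φ i) x

/-- The weighted integrand `|b|/(1+|x|) + |a|/(1+|x|²)`. -/
def wInt {d : ℕ} (b : ℝ → Ed d → Pm d → Ed d)
    (a : ℝ → Ed d → Pm d → (Ed d →L[ℝ] Ed d)) (t : ℝ) (x : Ed d) (μ : Pm d) : ℝ :=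
  ‖b t x μ‖ / (1 + ‖x‖) + ‖a t x μ‖ / (1 + ‖x‖ ^ 2)

/-- `c ∈ KFP(b,a)` for a continuous curve `c : [0,T] → P(ℝ^d)`: weighted integrability
and the distributional Kolmogorov–Fokker–Planck equation. -/
def KFPmem {T : ℝ} {d : ℕ} (hT : 0 ≤ T) (b : ℝ → Ed d → Pm d → Ed d)
    (a : ℝ → Ed d → Pm d → (Ed d →L[ℝ] Ed d)) (c : CurveSp T d) : Prop :=
  (∫⁻ t in Set.Icc (0:ℝ) T, ∫⁻ x,
      ENNReal.ofReal (wInt b a t x (c (Set.projIcc 0 T hT t)))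
      ∂(c (Set.projIcc 0 T hT t) : Measure (Ed d)) ∂volume) < ∞ ∧
  ∀ ξ φ, IsTestXi T ξ → IsTestPhi (d := d) φ →
    ∫ t in (0:ℝ)..T, deriv ξ t *
        ∫ x, φ x ∂(c (Set.projIcc 0 T hT t) : Measure (Ed d)) =
      - ∫ t in (0:ℝ)..T, ξ t *
          ∫ x, Lop b a (c (Set.projIcc 0 T hT t)) t φ x
            ∂(c (Set.projIcc 0 T hT t) : Measure (Ed d))


/-- A solution `(M_t)` of the random-measure equation `∂_t M_t = K^*_{b_t,a_t} M_t`: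
a narrowly continuous curve of probability measures on `P(ℝ^d)` with the weighted
integrability, satisfying the cylinder-function weak formulation. -/
def RMsol {T : ℝ} {d : ℕ} (hT : 0 ≤ T) (b : ℝ → Ed d → Pm d → Ed d)
    (a : ℝ → Ed d → Pm d → (Ed d →L[ℝ] Ed d)) (M : ℝ → Measure (Pm d)) : Prop :=
  (∀ t, IsProbabilityMeasure (M t)) ∧
  (∀ F : BoundedContinuousFunction (Pm d) ℝ,
    ContinuousOn (fun t => ∫ μ, F μ ∂(M t)) (Set.Icc 0 T)) ∧
  (∫⁻ t in Set.Icc (0:ℝ) T, ∫⁻ μ, ∫⁻ x,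
      ENNReal.ofReal (wInt b a t x μ) ∂(μ : Measure (Ed d)) ∂(M t) ∂volume) < ∞ ∧
  (∀ (k : ℕ) (Ψ : (Fin k → ℝ) → ℝ) (Φ : Fin k → Ed d → ℝ),
    ContDiff ℝ 1 Ψ → HasCompactSupport Ψ → (∀ i, IsTestPhi (Φ i)) →
    ∀ ξ, IsTestXi T ξ →
    ∫ t in (0:ℝ)..T, deriv ξ t *
        ∫ μ, Ψ (fun i => ∫ x, Φ i x ∂(μ : Measure (Ed d))) ∂(M t) =
      - ∫ t in (0:ℝ)..T, ξ t *
          ∫ μ, (∫ x, (∑ i, fderiv ℝ Ψ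
              (fun j => ∫ y, Φ j y ∂(μ : Measure (Ed d))) (Pi.single i 1) *
                Lop b a μ t (Φ i) x) ∂(μ : Measure (Ed d))) ∂(M t))

/-- A lifting `Λ`: a probability measure on `C([0,T],P(ℝ^d))` concentrated on
`KFP(b,a)`, with the weighted integrability. -/
def LamSol {T : ℝ} {d : ℕ} (hT : 0 ≤ T) (b : ℝ → Ed d → Pm d → Ed d)
    (a : ℝ → Ed d → Pm d → (Ed d →L[ℝ] Ed d)) (Λ : Measure (CurveSp T d)) : Prop :=
  IsProbabilityMeasure Λ ∧ (∀ᵐ c ∂Λ, KFPmem hT b a c) ∧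
  (∫⁻ c, ∫⁻ t in Set.Icc (0:ℝ) T, ∫⁻ x,
      ENNReal.ofReal (wInt b a t x (c (Set.projIcc 0 T hT t)))
      ∂(c (Set.projIcc 0 T hT t) : Measure (Ed d)) ∂volume ∂Λ) < ∞

section CompactlySupportedFunctionals

open scoped NNReal CompactlySupported

/-- A positive normalized functional on `C(Ω)`, for compact `Ω`, is a probability measure. -/
theorem exists_probability_of_positive {Ω : Type*} [TopologicalSpace Ω] [CompactSpace Ω] [T2Space Ω]
    [MeasurableSpace Ω] [BorelSpace Ω] (g : C(Ω, ℝ) →ₗ[ℝ] ℝ)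
    (hpos : ∀ h : C(Ω, ℝ), 0 ≤ h → 0 ≤ g h) (hone : g 1 = 1) :
    ∃ μ : Measure Ω, IsProbabilityMeasure μ ∧ ∀ h : C(Ω, ℝ), ∫ ω, h ω ∂μ = g h := by
  let Λ' : C_c(Ω, ℝ) →ₚ[ℝ] ℝ :=
  { toFun := fun h => g h.toContinuousMap
    map_add' := fun h h' => g.map_add h.toContinuousMap h'.toContinuousMap
    map_smul' := fun c h => g.map_smul c h.toContinuousMap
    monotone' := fun h h' hh => by
      have := hpos (h'.toContinuousMap - h.toContinuousMap) (fun x => sub_nonneg.2 (hh x))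
      rw [map_sub] at this
      linarith }
  let μ := RealRMK.rieszMeasure Λ'
  have hint : ∀ h : C(Ω, ℝ), ∫ ω, h ω ∂μ = g h := fun h =>
    RealRMK.integral_rieszMeasure Λ' ⟨h, HasCompactSupport.of_compactSpace _⟩
  have hle : μ univ ≤ ENNReal.ofReal 1 := by
    let o : C_c(Ω, ℝ) := ⟨1, HasCompactSupport.of_compactSpace 1⟩
    have : μ univ ≤ ENNReal.ofReal (Λ' o) := RealRMK.rieszMeasure_le_of_eq_one Λ'
      (fun x ↦ zero_le_one (α := ℝ)) isCompact_univ (fun x _ ↦ rfl)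
    have h1 : Λ' o = 1 := hone
    rwa [h1] at this
  have hfin : IsFiniteMeasure μ := ⟨hle.trans_lt (by simp)⟩
  refine ⟨μ, ⟨?_⟩, hint⟩
  have := hint 1
  simp only [ContinuousMap.one_apply, integral_const, smul_eq_mul, mul_one, hone] at this
  rwa [measureReal_def, ENNReal.toReal_eq_one_iff] at this

/-- Duality: a family of marginals and a linear cost constraint can be realized by a probability
measure on a compact space as soon as the dual inequality holds. -/
theorem exists_probability_of_dual {Ω B : Type*} [TopologicalSpace Ω] [CompactSpace Ω] [T2Space Ω]
    [MeasurableSpace Ω] [BorelSpace Ω] [TopologicalSpace B] [CompactSpace B]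
    [MeasurableSpace B] [BorelSpace B] (N : ℕ) (e : ℕ → C(Ω, B)) (m : ℕ → Measure B)
    [∀ i, IsProbabilityMeasure (m i)] (G : C(Ω, ℝ)) (c : ℝ)
    (H : ∀ (F : ℕ → C(B, ℝ)) (lam : ℝ), 0 ≤ lam →
      (∀ ω, lam * (c - G ω) ≤ ∑ i ∈ Finset.range (N + 1), F i (e i ω)) →
      0 ≤ ∑ i ∈ Finset.range (N + 1), ∫ x, F i x ∂(m i)) :
    ∃ μ : Measure Ω, IsProbabilityMeasure μ ∧
      (∀ i ∈ Finset.range (N + 1), ∀ F : C(B, ℝ), ∫ ω, F (e i ω) ∂μ = ∫ x, F x ∂(m i)) ∧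
      ∫ ω, G ω ∂μ ≤ c := by
  have hI : ∀ (F : C(B, ℝ)) i, Integrable F (m i) := fun F i =>
    F.continuous.integrable_of_hasCompactSupport (HasCompactSupport.of_compactSpace _)
  let S : (C(Ω, ℝ) × (ℕ → C(B, ℝ))) →ₗ[ℝ] ℝ :=
  { toFun := fun p => ∑ i ∈ Finset.range (N + 1), ∫ x, p.2 i x ∂(m i)
    map_add' := fun p q => by
      rw [← Finset.sum_add_distrib]
      exact Finset.sum_congr rfl fun i _ => integral_add (hI _ _) (hI _ _)
    map_smul' := fun r p => by
      simp only [Prod.smul_snd, Pi.smul_apply, ContinuousMap.smul_apply, RingHom.id_apply,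
        smul_eq_mul, Finset.mul_sum, integral_const_mul] }
  let D : (C(Ω, ℝ) × (ℕ → C(B, ℝ))) →ₗ[ℝ] C(Ω, ℝ) := LinearMap.fst ℝ _ _
  let f : (C(Ω, ℝ) × (ℕ → C(B, ℝ))) →ₗ.[ℝ] ℝ := ⟨LinearMap.ker D, S.domRestrict _⟩
  let s : PointedCone ℝ (C(Ω, ℝ) × (ℕ → C(B, ℝ))) :=
  { carrier := {p | ∃ lam : ℝ, 0 ≤ lam ∧
      ∀ ω, lam * (c - G ω) ≤ p.1 ω + ∑ i ∈ Finset.range (N + 1), p.2 i (e i ω)}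
    add_mem' := by
      rintro p q ⟨l, hl, h⟩ ⟨l', hl', h'⟩
      refine ⟨l + l', add_nonneg hl hl', fun ω => ?_⟩
      have := h ω
      have := h' ω
      simp only [Prod.fst_add, Prod.snd_add, Pi.add_apply, ContinuousMap.add_apply,
        Finset.sum_add_distrib]
      linarith
    zero_mem' := ⟨0, le_rfl, fun ω => by simp⟩
    smul_mem' := by
      rintro ⟨r, hr⟩ p ⟨l, hl, h⟩
      refine ⟨r * l, mul_nonneg hr hl, fun ω => ?_⟩
      have := mul_le_mul_of_nonneg_left (h ω) hr
      change _ ≤ r * p.1 ω + ∑ i ∈ Finset.range (N + 1), r * p.2 i (e i ω)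
      rw [← Finset.mul_sum]
      linarith }
  obtain ⟨g, hg, hgs⟩ := riesz_extension s f (by
      rintro ⟨⟨h, F⟩, hx⟩ ⟨l, hl, hh⟩
      have h0 : h = 0 := hx
      subst h0
      refine H F l hl fun ω => ?_
      simpa using hh ω) (by
      rintro ⟨h, F⟩
      refine ⟨⟨(0, fun i => -F i + Pi.single (M := fun _ => C(B, ℝ)) 0
        (ContinuousMap.const B ‖h‖) i), rfl⟩, 0, le_rfl, fun ω => ?_⟩
      have hs : ∑ i ∈ Finset.range (N + 1),
          ((Pi.single (M := fun _ => C(B, ℝ)) 0 (ContinuousMap.const B ‖h‖) i)) (e i ω) = ‖h‖ := by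
        rw [Finset.sum_eq_single 0]
        · simp
        · intro i _ hi
          simp [hi]
        · simp
      simp only [zero_mul, Prod.mk_add_mk, zero_add, Pi.add_apply, neg_add_eq_sub, sub_add_cancel]
      have h2 : ∀ i, (-F i + Pi.single (M := fun _ => C(B, ℝ)) 0 (ContinuousMap.const B ‖h‖) i
          + F i) = Pi.single (M := fun _ => C(B, ℝ)) 0 (ContinuousMap.const B ‖h‖) i :=
        fun i => by abel
      have h3 := neg_le_of_abs_le (h.norm_coe_le_norm ω)
      have : 0 ≤ h ω + ∑ i ∈ Finset.range (N + 1), (-F i + Pi.single (M := fun _ => C(B, ℝ)) 0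
          (ContinuousMap.const B ‖h‖) i + F i) (e i ω) := by
        simp only [h2, hs]; linarith
      simpa using this)
  have hg' : ∀ F, g (0, F) = ∑ i ∈ Finset.range (N + 1), ∫ x, F i x ∂(m i) :=
    fun F => hg ⟨(0, F), rfl⟩
  have hpos : ∀ h : C(Ω, ℝ), 0 ≤ h → 0 ≤ (g ∘ₗ LinearMap.inl ℝ _ _) h := fun h hh =>
    hgs (h, 0) ⟨0, le_rfl, fun ω => by simpa using hh ω⟩
  have hmarg : ∀ i ∈ Finset.range (N + 1), ∀ F : C(B, ℝ),
      (g ∘ₗ LinearMap.inl ℝ _ _) (F.comp (e i)) = ∫ x, F x ∂(m i) := by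
    intro i hi F
    let P : ℕ → C(B, ℝ) := Pi.single i F
    have hP : ∀ ω, ∑ j ∈ Finset.range (N + 1), P j (e j ω) = F (e i ω) := by
      intro ω
      rw [Finset.sum_eq_single i]
      · simp [P]
      · intro j _ hj; simp [P, hj]
      · exact fun h => absurd hi h
    have hQ : g (0, P) = ∫ x, F x ∂(m i) := by
      rw [hg', Finset.sum_eq_single i]
      · simp [P]
      · intro j _ hj; simp [P, hj]
      · exact fun h => absurd hi h
    have h1 := hgs (F.comp (e i), -P) ⟨0, le_rfl, fun ω => by simp [hP]⟩
    have h2 := hgs (-F.comp (e i), P) ⟨0, le_rfl, fun ω => by simp [hP]⟩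
    have e1 : ((F.comp (e i), -P) : (C(Ω, ℝ) × (ℕ → C(B, ℝ)))) = (F.comp (e i), 0) - (0, P) := by simp
    have e2 : ((-F.comp (e i), P) : (C(Ω, ℝ) × (ℕ → C(B, ℝ)))) = (0, P) - (F.comp (e i), 0) := by simp
    rw [e1, map_sub] at h1
    rw [e2, map_sub] at h2
    change g (F.comp (e i), 0) = _
    linarith
  have hone : (g ∘ₗ LinearMap.inl ℝ _ _) 1 = 1 := by
    have := hmarg 0 (by simp) 1
    have h1 : (1 : C(B, ℝ)).comp (e 0) = 1 := rfl
    rw [h1] at this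
    simpa using this
  obtain ⟨μ, hμ, hint⟩ := exists_probability_of_positive _ hpos hone
  refine ⟨μ, hμ, fun i hi F => ?_, ?_⟩
  · rw [← hmarg i hi F, ← hint]; rfl
  · have h := hgs (c • 1 - G, 0) ⟨1, zero_le_one, fun ω => by simp⟩
    have h2 : (g ∘ₗ LinearMap.inl ℝ _ _) (c • 1 - G) = c - (g ∘ₗ LinearMap.inl ℝ _ _) G := by
      rw [map_sub, map_smul, hone]; simp
    rw [hint]
    have h3 : 0 ≤ (g ∘ₗ LinearMap.inl ℝ _ _) (c • 1 - G) := h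
    linarith

theorem integrable_continuousMap_of_compactSpace {B : Type*} [TopologicalSpace B] [CompactSpace B]
    [MeasurableSpace B] [BorelSpace B] (m : Measure B) [IsFiniteMeasure m] (F : C(B, ℝ)) :
    Integrable F m :=
  F.continuous.integrable_of_hasCompactSupport (HasCompactSupport.of_compactSpace _)

/-- Dynamic programming: one-step dual inequalities imply the dual inequality for chains. -/
theorem chain_dual_of_step_dual {B : Type*} [TopologicalSpace B] [CompactSpace B] [Nonempty B]
    [MeasurableSpace B] [BorelSpace B] (N : ℕ) (m : ℕ → Measure B)
    [∀ i, IsProbabilityMeasure (m i)] (cost : ℕ → C(B × B, ℝ)) (κ : ℕ → ℝ)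
    (hstep : ∀ i < N, ∀ f g : C(B, ℝ), (∀ x y, g y ≤ f x + cost i (x, y)) →
      ∫ x, g x ∂(m (i + 1)) ≤ ∫ x, f x ∂(m i) + κ i)
    (F : ℕ → C(B, ℝ)) (lam : ℝ) (hlam : 0 ≤ lam)
    (hF : ∀ x : ℕ → B, lam * (∑ i ∈ Finset.range N, κ i -
        ∑ i ∈ Finset.range N, cost i (x i, x (i + 1))) ≤
      ∑ i ∈ Finset.range (N + 1), F i (x i)) :
    0 ≤ ∑ i ∈ Finset.range (N + 1), ∫ x, F i x ∂(m i) := by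
  have hI := fun (F : C(B, ℝ)) i => integrable_continuousMap_of_compactSpace (m i) F
  have key : ∀ n ≤ N, ∃ u : C(B, ℝ),
      (∀ y, ∃ x : ℕ → B, x n = y ∧ ∑ i ∈ Finset.range (n + 1), F i (x i) +
        lam * ∑ i ∈ Finset.range n, cost i (x i, x (i + 1)) ≤ u y) ∧
      ∫ y, u y ∂(m n) ≤ ∑ i ∈ Finset.range (n + 1), ∫ x, F i x ∂(m i) +
        lam * ∑ i ∈ Finset.range n, κ i := by
    intro n
    induction n with
    | zero =>
      intro _
      exact ⟨F 0, fun y => ⟨fun _ => y, rfl, by simp⟩, by simp⟩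
    | succ n ih =>
      intro hn
      obtain ⟨u, hu, hui⟩ := ih (by omega)
      let W : B → B → ℝ := fun y x => u x + lam * cost n (x, y)
      have hW : Continuous ↿W := by
        change Continuous fun p : B × B => u p.2 + lam * cost n (p.2, p.1)
        fun_prop
      let w : C(B, ℝ) := ⟨fun y => sInf (W y '' univ), isCompact_univ.continuous_sInf hW⟩
      have hwle : ∀ x y, w y ≤ u x + lam * cost n (x, y) := by
        intro x y
        refine csInf_le ?_ ⟨x, mem_univ _, rfl⟩
        exact (isCompact_univ.image (hW.comp (Continuous.prodMk_right y))).bddBelow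
      have hwatt : ∀ y, ∃ x, w y = u x + lam * cost n (x, y) := by
        intro y
        obtain ⟨x, -, hx⟩ := isCompact_univ.exists_sInf_image_eq univ_nonempty
          ((hW.comp (Continuous.prodMk_right y)).continuousOn)
        exact ⟨x, hx⟩
      have hwint : ∫ y, w y ∂(m (n + 1)) ≤ ∫ y, u y ∂(m n) + lam * κ n := by
        rcases hlam.eq_or_lt with h0 | h0
        · subst h0
          simp only [zero_mul, add_zero] at hwle hwatt ⊢
          obtain ⟨y0⟩ := ‹Nonempty B›
          have hc : ∀ y, w y = w y0 := fun y => by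
            obtain ⟨x, hx⟩ := hwatt y0
            obtain ⟨x', hx'⟩ := hwatt y
            exact le_antisymm (hx ▸ hwle x y) (hx' ▸ hwle x' y0)
          have h1 : ∫ y, w y ∂(m (n + 1)) = w y0 := by simp [hc]
          have h2 : ∫ _, w y0 ∂(m n) ≤ ∫ y, u y ∂(m n) :=
            integral_mono (integrable_const _) (hI _ _) fun x => hwle x y0
          simpa [h1] using h2
        · have := hstep n (by omega) (lam⁻¹ • u) (lam⁻¹ • w) (fun x y => by
            have := mul_le_mul_of_nonneg_left (hwle x y) (inv_nonneg.2 hlam)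
            rw [mul_add, inv_mul_cancel_left₀ h0.ne'] at this
            exact this)
          simp only [ContinuousMap.smul_apply, smul_eq_mul, integral_const_mul] at this
          have := mul_le_mul_of_nonneg_left this hlam
          rwa [mul_add, mul_inv_cancel_left₀ h0.ne', mul_inv_cancel_left₀ h0.ne'] at this
      refine ⟨w + F (n + 1), fun y => ?_, ?_⟩
      · obtain ⟨z, hz⟩ := hwatt y
        obtain ⟨x, hx, hxu⟩ := hu z
        refine ⟨Function.update x (n + 1) y, by simp, ?_⟩
        have hup : ∀ i ≤ n, Function.update x (n + 1) y i = x i := fun i hi =>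
          Function.update_of_ne (by omega) _ _
        have e1 : ∑ i ∈ Finset.range (n + 1), F i (Function.update x (n + 1) y i) =
            ∑ i ∈ Finset.range (n + 1), F i (x i) :=
          Finset.sum_congr rfl fun i hi => by rw [hup i (by simp at hi; omega)]
        have e2 : ∑ i ∈ Finset.range n, cost i (Function.update x (n + 1) y i,
            Function.update x (n + 1) y (i + 1)) =
            ∑ i ∈ Finset.range n, cost i (x i, x (i + 1)) :=
          Finset.sum_congr rfl fun i hi => by
            simp at hi
            rw [hup i (by omega), hup (i + 1) (by omega)]
        rw [Finset.sum_range_succ (n := n + 1), Finset.sum_range_succ (n := n) (f := fun i => cost i _),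
          e1, e2, hup n le_rfl, hx,
          Function.update_self, ContinuousMap.add_apply, hz, mul_add]
        linarith
      · simp only [ContinuousMap.add_apply]
        rw [integral_add (hI w _) (hI _ _), Finset.sum_range_succ (n := n + 1),
          Finset.sum_range_succ (n := n) (f := κ)]
        linarith
  obtain ⟨u, hu, hui⟩ := key N le_rfl
  have h1 : ∀ y, lam * ∑ i ∈ Finset.range N, κ i ≤ u y := fun y => by
    obtain ⟨x, -, hx⟩ := hu y
    have := hF x
    rw [mul_sub] at this
    linarith
  have h2 : ∫ _, lam * ∑ i ∈ Finset.range N, κ i ∂(m N) ≤ ∫ y, u y ∂(m N) :=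
    integral_mono (integrable_const _) (hI _ _) h1
  simp only [integral_const, probReal_univ, smul_eq_mul, one_mul] at h2
  linarith

/-- Existence of a chain with given marginals and controlled total cost. -/
theorem exists_chain_of_step_dual {ι B : Type*} [Countable ι] [TopologicalSpace B] [CompactSpace B]
    [T2Space B] [SecondCountableTopology B] [Nonempty B]
    [MeasurableSpace B] [BorelSpace B] (N : ℕ) (m : ℕ → Measure B)
    [∀ i, IsProbabilityMeasure (m i)] (cost : ℕ → C(B × B, ℝ)) (κ : ℕ → ℝ)
    (hstep : ∀ i < N, ∀ f g : C(B, ℝ), (∀ x y, g y ≤ f x + cost i (x, y)) →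
      ∫ x, g x ∂(m (i + 1)) ≤ ∫ x, f x ∂(m i) + κ i)
    (q : ℕ → ι) (hq : Function.Injective q) :
    ∃ μ : Measure (ι → B), IsProbabilityMeasure μ ∧
      (∀ i ≤ N, ∀ F : C(B, ℝ), ∫ ω, F (ω (q i)) ∂μ = ∫ x, F x ∂(m i)) ∧
      ∫ ω, ∑ i ∈ Finset.range N, cost i (ω (q i), ω (q (i + 1))) ∂μ ≤
        ∑ i ∈ Finset.range N, κ i := by
  let G : C(ι → B, ℝ) :=
    ⟨fun ω => ∑ i ∈ Finset.range N, cost i (ω (q i), ω (q (i + 1))), by fun_prop⟩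
  obtain ⟨μ, hμ, hm, hG⟩ := exists_probability_of_dual N
    (fun i => (⟨fun ω => ω (q i), by fun_prop⟩ : C(ι → B, B))) m G (∑ i ∈ Finset.range N, κ i)
    (fun F lam hlam h => chain_dual_of_step_dual N m cost κ hstep F lam hlam fun x => by
      obtain ⟨y0⟩ := ‹Nonempty B›
      have hx : ∀ i, Function.extend q x (fun _ => y0) (q i) = x i := fun i =>
        hq.extend_apply _ _ _
      have := h (Function.extend q x (fun _ => y0))
      simpa [G, hx] using this)
  exact ⟨μ, hμ, fun i hi F => hm i (by simp; omega) F, hG⟩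

end CompactlySupportedFunctionals

section Superposition

open Filter Topology ProbabilityTheory

/-- Diagonal derivative: a function of two time variables which is absolutely continuous in each
of them, with densities `p` and `q`, is on the diagonal the integral of `p + q`. -/
theorem diagonal_sub_eq_integral {h p q : ℝ → ℝ → ℝ} {s t C : ℝ} (hst : s ≤ t) {g : ℝ → ℝ}
    (hp : ∀ r ∈ Icc s t, ∀ u ∈ Icc s t, ∀ v ∈ Icc s t, u ≤ v →
      h r v - h r u = ∫ x in u..v, p r x)
    (hq : ∀ r ∈ Icc s t, ∀ u ∈ Icc s t, ∀ v ∈ Icc s t, u ≤ v →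
      h v r - h u r = ∫ x in u..v, q x r)
    (pm : Measurable (Function.uncurry p)) (qm : Measurable (Function.uncurry q))
    (pb : ∀ᵐ x, x ∈ Icc s t → ∀ r ∈ Icc s t, |p r x| ≤ g x) (gi : IntervalIntegrable g volume s t)
    (pc : ∀ᵐ x, x ∈ Icc s t → ContinuousOn (fun r => p r x) (Icc s t))
    (qb : ∀ x ∈ Icc s t, ∀ r ∈ Icc s t, |q x r| ≤ C)
    (qc : ∀ x ∈ Icc s t, ContinuousOn (fun r => q x r) (Icc s t)) :
    h t t - h s s = ∫ x in s..t, (p x x + q x x) := by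
  rcases hst.eq_or_lt with rfl | hlt
  · simp
  have hts : 0 < t - s := sub_pos.2 hlt
  let lo : ℕ → ℝ → ℝ := fun n x => s + (t - s) * (⌊n * ((x - s) / (t - s))⌋₊ / n)
  let up : ℕ → ℝ → ℝ := fun n x => min t (lo n x + (t - s) / n)
  have lom : ∀ n, Measurable (lo n) := fun n => by
    have : Measurable fun x : ℝ => (⌊n * ((x - s) / (t - s))⌋₊ : ℝ) :=
      (measurable_from_nat (f := fun k : ℕ => (k : ℝ))).comp
        (Nat.measurable_floor.comp (by fun_prop))
    fun_prop
  have upm : ∀ n, Measurable (up n) := fun n => measurable_const.min ((lom n).add_const _)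
  have lo_le : ∀ n, 0 < n → ∀ x ∈ Icc s t, lo n x ∈ Icc s x := by
    intro n hn x hx
    have hn' : (0 : ℝ) < n := by exact_mod_cast hn
    refine ⟨by simp only [lo]; have : 0 ≤ (⌊n * ((x - s) / (t - s))⌋₊ : ℝ) / n := by positivity
               nlinarith, ?_⟩
    have h1 := Nat.floor_le (a := n * ((x - s) / (t - s)))
      (mul_nonneg hn'.le (div_nonneg (by linarith [hx.1]) hts.le))
    have h2 : (⌊n * ((x - s) / (t - s))⌋₊ : ℝ) / n ≤ (x - s) / (t - s) := by
      rw [div_le_iff₀ hn']; linarith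
    have h3 := mul_le_mul_of_nonneg_left h2 hts.le
    rw [mul_div_cancel₀ _ hts.ne'] at h3
    simp only [lo]; linarith
  have le_up : ∀ n, 0 < n → ∀ x ∈ Icc s t, x ≤ lo n x + (t - s) / n := by
    intro n hn x hx
    have hn' : (0 : ℝ) < n := by exact_mod_cast hn
    have h1 := Nat.lt_floor_add_one (n * ((x - s) / (t - s)))
    have h2 : (x - s) / (t - s) ≤ ((⌊n * ((x - s) / (t - s))⌋₊ : ℝ) + 1) / n := by
      rw [le_div_iff₀ hn']; linarith
    have h3 := mul_le_mul_of_nonneg_left h2 hts.le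
    rw [mul_div_cancel₀ _ hts.ne', add_div, mul_add, mul_one_div] at h3
    simp only [lo]; linarith
  have up_mem : ∀ n, 0 < n → ∀ x ∈ Icc s t, up n x ∈ Icc x t := fun n hn x hx =>
    ⟨le_min hx.2 (le_up n hn x hx), min_le_left _ _⟩
  have hdiv : Tendsto (fun n : ℕ => (t - s) / (n : ℝ)) atTop (𝓝 0) :=
    tendsto_const_div_atTop_nhds_zero_nat (t - s)
  have lo_lim : ∀ x ∈ Icc s t, Tendsto (fun n => lo n x) atTop (𝓝[Icc s t] x) := by
    intro x hx
    refine tendsto_nhdsWithin_iff.2 ⟨?_, ?_⟩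
    · refine tendsto_of_tendsto_of_tendsto_of_le_of_le' (g := fun n : ℕ => x - (t - s) / n)
        (h := fun _ => x) (by simpa using tendsto_const_nhds.sub hdiv) tendsto_const_nhds ?_ ?_
      · filter_upwards [eventually_gt_atTop 0] with n hn
        linarith [le_up n hn x hx]
      · filter_upwards [eventually_gt_atTop 0] with n hn
        exact (lo_le n hn x hx).2
    · filter_upwards [eventually_gt_atTop 0] with n hn
      exact ⟨(lo_le n hn x hx).1, (lo_le n hn x hx).2.trans hx.2⟩
  have up_lim : ∀ x ∈ Icc s t, Tendsto (fun n => up n x) atTop (𝓝[Icc s t] x) := by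
    intro x hx
    refine tendsto_nhdsWithin_iff.2 ⟨?_, ?_⟩
    · refine tendsto_of_tendsto_of_tendsto_of_le_of_le' (g := fun _ => x)
        (h := fun n : ℕ => x + (t - s) / n) tendsto_const_nhds
        (by simpa using tendsto_const_nhds.add hdiv) ?_ ?_
      · filter_upwards [eventually_gt_atTop 0] with n hn
        exact (up_mem n hn x hx).1
      · filter_upwards [eventually_gt_atTop 0] with n hn
        exact (min_le_right _ _).trans (by linarith [(lo_le n hn x hx).2])
    · filter_upwards [eventually_gt_atTop 0] with n hn
      exact ⟨hx.1.trans (up_mem n hn x hx).1, (up_mem n hn x hx).2⟩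
  let Φ : ℕ → ℝ → ℝ := fun n x => p (up n x) x + q x (lo n x)
  have Φm : ∀ n, Measurable (Φ n) := fun n =>
    (pm.comp ((upm n).prodMk measurable_id)).add (qm.comp (measurable_id.prodMk (lom n)))
  have Φb : ∀ n, 0 < n → ∀ᵐ x, x ∈ Icc s t → ‖Φ n x‖ ≤ g x + C := by
    intro n hn
    filter_upwards [pb] with x hx hxi
    have h1 := hx hxi (up n x) ⟨hxi.1.trans (up_mem n hn x hxi).1, (up_mem n hn x hxi).2⟩
    have h2 := qb x hxi (lo n x) ⟨(lo_le n hn x hxi).1, (lo_le n hn x hxi).2.trans hxi.2⟩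
    exact (abs_add_le _ _).trans (add_le_add h1 h2)
  have gCi : IntervalIntegrable (fun x => g x + C) volume s t := gi.add intervalIntegrable_const
  have Φi : ∀ n, 0 < n → IntervalIntegrable (Φ n) volume s t := by
    intro n hn
    refine gCi.mono_fun' (Φm n).aestronglyMeasurable ?_
    rw [uIoc_of_le hst, EventuallyLE, ae_restrict_iff' measurableSet_Ioc]
    filter_upwards [Φb n hn] with x hx hxi using hx (Ioc_subset_Icc_self hxi)
  have key : ∀ n, 0 < n → ∫ x in s..t, Φ n x = h t t - h s s := by
    intro n hn
    have hn' : (0 : ℝ) < n := by exact_mod_cast hn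
    let a : ℕ → ℝ := fun k => s + (t - s) * (k / n)
    have a0 : a 0 = s := by simp [a]
    have an : a n = t := by simp [a, hn'.ne']
    have amono : ∀ k, a k ≤ a (k + 1) := fun k => by
      simp only [a]; gcongr; simp
    have aI : ∀ k ≤ n, a k ∈ Icc s t := fun k hk => by
      rw [← a0, ← an]
      exact ⟨monotone_nat_of_le_succ amono (Nat.zero_le k), monotone_nat_of_le_succ amono hk⟩
    have hsum := intervalIntegral.sum_integral_adjacent_intervals (f := Φ n) (μ := volume) (a := a)
      (n := n) (fun k hk => (Φi n hn).mono_set (by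
        rw [uIcc_of_le hst, uIcc_of_le (amono k)]
        exact Icc_subset_Icc (aI k hk.le).1 (aI (k + 1) hk).2))
    rw [a0, an] at hsum
    rw [← hsum]
    have hpiece : ∀ k ∈ Finset.range n, ∫ x in a k..a (k + 1), Φ n x =
        h (a (k + 1)) (a (k + 1)) - h (a k) (a k) := by
      intro k hk
      have hk' : k < n := Finset.mem_range.1 hk
      have e1 : ∫ x in a k..a (k + 1), Φ n x =
          ∫ x in a k..a (k + 1), (p (a (k + 1)) x + q x (a k)) := by
        refine intervalIntegral.integral_congr_Ioo_of_le (amono k) fun x hx => ?_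
        have hfl : ⌊n * ((x - s) / (t - s))⌋₊ = k := by
          have hx1 := hx.1
          have hx2 := hx.2
          simp only [a] at hx1 hx2
          rw [Nat.floor_eq_iff (mul_nonneg hn'.le (div_nonneg
            (by linarith [(aI k hk'.le).1, hx.1]) hts.le))]
          constructor
          · have : (t - s) * (k / n) ≤ x - s := by linarith
            have : (k : ℝ) / n ≤ (x - s) / (t - s) := by rw [le_div_iff₀ hts]; linarith
            rw [div_le_iff₀ hn'] at this; linarith
          · have : x - s < (t - s) * ((k + 1 : ℕ) / n) := by linarith
            have : (x - s) / (t - s) < ((k + 1 : ℕ) : ℝ) / n := by rw [div_lt_iff₀ hts]; linarith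
            rw [lt_div_iff₀ hn'] at this; push_cast at this; linarith
        have hlo : lo n x = a k := by simp only [lo, hfl, a]
        have hup : up n x = a (k + 1) := by
          have : a k + (t - s) / n = a (k + 1) := by simp only [a]; push_cast; ring
          simp only [up, hlo, this]
          exact min_eq_right (aI (k + 1) hk').2
        simp only [Φ, hlo, hup]
      have ss : uIcc (a k) (a (k + 1)) ⊆ uIcc s t := by
        rw [uIcc_of_le hst, uIcc_of_le (amono k)]
        exact Icc_subset_Icc (aI k hk'.le).1 (aI (k + 1) hk').2
      have i1 : IntervalIntegrable (fun x => p (a (k + 1)) x) volume (a k) (a (k + 1)) := by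
        refine (gi.mono_set ss).mono_fun'
          (pm.comp (measurable_const.prodMk measurable_id)).aestronglyMeasurable ?_
        rw [uIoc_of_le (amono k), EventuallyLE, ae_restrict_iff' measurableSet_Ioc]
        filter_upwards [pb] with x hx hxi
        exact hx ⟨(aI k hk'.le).1.trans hxi.1.le, hxi.2.trans (aI _ hk').2⟩ _ (aI _ hk')
      have i2 : IntervalIntegrable (fun x => q x (a k)) volume (a k) (a (k + 1)) := by
        refine (intervalIntegrable_const (c := C)).mono_fun'
          (qm.comp (measurable_id.prodMk measurable_const)).aestronglyMeasurable ?_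
        rw [uIoc_of_le (amono k), EventuallyLE, ae_restrict_iff' measurableSet_Ioc]
        filter_upwards with x hxi
        exact qb _ ⟨(aI k hk'.le).1.trans hxi.1.le, hxi.2.trans (aI _ hk').2⟩ _ (aI _ hk'.le)
      rw [e1, intervalIntegral.integral_add i1 i2,
        ← hp _ (aI _ hk') _ (aI _ hk'.le) _ (aI _ hk') (amono k),
        ← hq _ (aI _ hk'.le) _ (aI _ hk'.le) _ (aI _ hk') (amono k)]
      ring
    rw [Finset.sum_congr rfl hpiece, Finset.sum_range_sub (fun k => h (a k) (a k)), a0, an]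
  have lim : Tendsto (fun n => ∫ x in s..t, Φ n x) atTop (𝓝 (∫ x in s..t, (p x x + q x x))) := by
    refine intervalIntegral.tendsto_integral_filter_of_dominated_convergence (fun x => g x + C)
      (Eventually.of_forall fun n => (Φm n).aestronglyMeasurable) ?_ gCi ?_
    · filter_upwards [eventually_gt_atTop 0] with n hn
      filter_upwards [Φb n hn] with x hx hxi
      rw [uIoc_of_le hst] at hxi
      exact hx (Ioc_subset_Icc_self hxi)
    · filter_upwards [pc] with x hx hxi
      rw [uIoc_of_le hst] at hxi
      have hxi' := Ioc_subset_Icc_self hxi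
      exact ((hx hxi' x hxi').tendsto.comp (up_lim x hxi')).add
        ((qc x hxi' x hxi').tendsto.comp (lo_lim x hxi'))
  refine tendsto_nhds_unique (tendsto_const_nhds.congr' ?_) lim
  filter_upwards [eventually_gt_atTop 0] with n hn using (key n hn).symm

/-- The Hilbert cube. -/
abbrev HCube := ℕ → Icc (-1 : ℝ) 1

/-- The first `K` coordinates of a point of the Hilbert cube. -/
def firstCoords (K : ℕ) (x : HCube) : Fin K → ℝ := fun i => x i

theorem continuous_firstCoords (K : ℕ) : Continuous (firstCoords K) := by
  unfold firstCoords; fun_prop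

/-- A weakly continuous curve of probability measures on the Hilbert cube which solves, in the
sense of cylinder functions, the continuity equation with velocity field `V`. -/
structure WeakFlow (ν : Kernel ℝ HCube) (V : ℕ → ℝ × HCube → ℝ) : Prop where
  cont : ∀ F : C(HCube, ℝ), Continuous fun t => ∫ x, F x ∂(ν t)
  meas : ∀ k, Measurable (V k)
  integrable : ∀ k, Integrable (V k) (volume ⊗ₘ ν)
  weak : ∀ (K : ℕ) (Ψ : (Fin K → ℝ) → ℝ), ContDiff ℝ 1 Ψ → ∀ s t, s ≤ t →
    ∫ x, Ψ (firstCoords K x) ∂(ν t) - ∫ x, Ψ (firstCoords K x) ∂(ν s) =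
      ∫ r in s..t, ∫ x, ∑ m : Fin K,
        fderiv ℝ Ψ (firstCoords K x) (Pi.single m 1) * V m (r, x) ∂(ν r)

theorem integrable_of_continuous {B : Type*} [TopologicalSpace B] [CompactSpace B]
    [MeasurableSpace B] [BorelSpace B] (m : Measure B) [IsFiniteMeasure m] {F : B → ℝ}
    (hF : Continuous F) : Integrable F m :=
  integrable_continuousMap_of_compactSpace m ⟨F, hF⟩

namespace WeakFlow

variable {ν : Kernel ℝ HCube} [IsMarkovKernel ν] {V : ℕ → ℝ × HCube → ℝ}

theorem ae_integrable (hf : WeakFlow ν V) : ∀ᵐ r, ∀ k, Integrable (fun x => V k (r, x)) (ν r) := by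
  rw [ae_all_iff]
  intro k
  exact ((Measure.integrable_compProd_iff (hf.meas k).aestronglyMeasurable).1 (hf.integrable k)).1

theorem integrable_integral_abs (hf : WeakFlow ν V) (k : ℕ) :
    Integrable fun r => ∫ x, |V k (r, x)| ∂(ν r) :=
  ((Measure.integrable_compProd_iff (hf.meas k).aestronglyMeasurable).1 (hf.integrable k)).2

theorem continuous_integral (hf : WeakFlow ν V) {F : HCube → ℝ} (hF : Continuous F) :
    Continuous fun t => ∫ x, F x ∂(ν t) := hf.cont ⟨F, hF⟩

end WeakFlow

theorem exists_bound_on_Icc {B : Type*} [TopologicalSpace B] [CompactSpace B] {G : ℝ × B → ℝ}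
    (hG : Continuous G) (s t : ℝ) : ∃ C, ∀ r ∈ Icc s t, ∀ x, |G (r, x)| ≤ C := by
  obtain ⟨C, hC⟩ := (isCompact_Icc (a := s) (b := t)).prod (isCompact_univ (X := B))
    |>.exists_bound_of_continuousOn hG.continuousOn
  exact ⟨C, fun r hr x => hC (r, x) ⟨hr, mem_univ _⟩⟩

namespace WeakFlow

variable {ν : Kernel ℝ HCube} [IsMarkovKernel ν] {V : ℕ → ℝ × HCube → ℝ}

/-- Evolution of a time-dependent cylinder function along a weak flow. -/
theorem weak_time (hf : WeakFlow ν V) {K : ℕ} {Θ : ℝ → (Fin K → ℝ) → ℝ}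
    (hΘ : ∀ r, ContDiff ℝ 1 (Θ r)) {D : Fin K → ℝ × (Fin K → ℝ) → ℝ} (hD : ∀ m, Continuous (D m))
    (hDΘ : ∀ m r z, fderiv ℝ (Θ r) z (Pi.single m 1) = D m (r, z))
    {R : ℝ × (Fin K → ℝ) → ℝ} (hR : Continuous R)
    (hRΘ : ∀ r z, HasDerivAt (fun u => Θ u z) (R (r, z)) r) {s t : ℝ} (hst : s ≤ t) :
    ∫ x, Θ t (firstCoords K x) ∂(ν t) - ∫ x, Θ s (firstCoords K x) ∂(ν s) =
      ∫ r in s..t, ∫ x, (∑ m : Fin K, D m (r, firstCoords K x) * V m (r, x) +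
        R (r, firstCoords K x)) ∂(ν r) := by
  have hcc := continuous_firstCoords K
  have hDx : ∀ m, Continuous fun y : ℝ × HCube => D m (y.1, firstCoords K y.2) := fun m => by
    have := hD m; fun_prop
  have hRx : Continuous fun y : ℝ × HCube => R (y.1, firstCoords K y.2) := by fun_prop
  choose CD hCD using fun m => exists_bound_on_Icc (hDx m) s t
  obtain ⟨CR, hCR⟩ := exists_bound_on_Icc hRx s t
  have hCD0 : ∀ m, 0 ≤ CD m := fun m =>
    (abs_nonneg _).trans (hCD m s ⟨le_rfl, hst⟩ (fun _ => ⟨0, by simp⟩))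
  let p : ℝ → ℝ → ℝ := fun r u => ∫ x, ∑ m : Fin K, D m (r, firstCoords K x) * V m (u, x) ∂(ν u)
  let q : ℝ → ℝ → ℝ := fun u r => ∫ x, R (u, firstCoords K x) ∂(ν r)
  have hVm := hf.meas
  have hdm : ∀ m, Measurable (D m) := fun m => (hD m).measurable
  have hcm := hcc.measurable
  have hRm := hR.measurable
  have pm : Measurable (Function.uncurry p) := by
    have h1 : StronglyMeasurable (fun y : (ℝ × ℝ) × HCube =>
        ∑ m : Fin K, D m (y.1.1, firstCoords K y.2) * V m (y.1.2, y.2)) := by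
      refine Measurable.stronglyMeasurable ?_
      fun_prop
    exact (h1.integral_kernel_prod_right' (κ := ν.comap Prod.snd measurable_snd)).measurable
  have qm : Measurable (Function.uncurry q) := by
    have h1 : StronglyMeasurable (fun y : (ℝ × ℝ) × HCube => R (y.1.1, firstCoords K y.2)) := by
      refine Measurable.stronglyMeasurable ?_
      fun_prop
    exact (h1.integral_kernel_prod_right' (κ := ν.comap Prod.snd measurable_snd)).measurable
  have hint : ∀ u, (∀ k, Integrable (fun x => V k (u, x)) (ν u)) → ∀ r ∈ Icc s t, ∀ m : Fin K,
      Integrable (fun x => D m (r, firstCoords K x) * V m (u, x)) (ν u) := by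
    intro u hu r hr m
    refine (hu m).bdd_mul (c := CD m) ?_ (ae_of_all _ fun x => hCD m r hr x)
    exact Measurable.aestronglyMeasurable (by fun_prop)
  have hpR : ∀ᵐ r, r ∈ Icc s t → p r r + q r r =
      ∫ x, (∑ m : Fin K, D m (r, firstCoords K x) * V m (r, x) +
        R (r, firstCoords K x)) ∂(ν r) := by
    filter_upwards [hf.ae_integrable] with r hr hrI
    rw [integral_add (integrable_finsetSum _ fun m _ => hint r hr r hrI m)
      (integrable_of_continuous _ (by fun_prop))]
  have := diagonal_sub_eq_integral (h := fun r r' => ∫ x, Θ r (firstCoords K x) ∂(ν r')) (p := p)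
    (q := q) hst (C := CR) (g := fun u => ∑ m : Fin K, CD m * ∫ x, |V m (u, x)| ∂(ν u))
    (fun r _ u _ v _ huv => by
      have := hf.weak K (Θ r) (hΘ r) u v huv
      simpa only [hDΘ] using this)
    (fun r _ u hu v hv huv => by
      have hRb : ∀ w ∈ Icc u v, ∀ x, |R (w, firstCoords K x)| ≤ CR := fun w hw x =>
        hCR w ⟨hu.1.trans hw.1, hw.2.trans hv.2⟩ x
      have e1 : ∀ x : HCube, Θ v (firstCoords K x) - Θ u (firstCoords K x) =
          ∫ w in u..v, R (w, firstCoords K x) := fun x =>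
        (intervalIntegral.integral_eq_sub_of_hasDerivAt (fun w _ => hRΘ w _)
          (Continuous.intervalIntegrable (by fun_prop) _ _)).symm
      have hc : ∀ w, Continuous fun x => Θ w (firstCoords K x) := fun w =>
        (hΘ w).continuous.comp hcc
      rw [← integral_sub (integrable_of_continuous _ (hc v)) (integrable_of_continuous _ (hc u))]
      simp only [e1, q]
      symm
      refine intervalIntegral_integral_swap ?_
      rw [uIoc_of_le huv]
      refine Integrable.mono' (g := fun _ => CR) (integrable_const _)
        (Measurable.aestronglyMeasurable (by
          simp only [Function.uncurry_def]; fun_prop)) ?_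
      have : ∀ᵐ w : ℝ × HCube ∂((volume.restrict (Ioc u v)).prod (ν r)), w.1 ∈ Ioc u v := by
        have h0 := ae_restrict_mem (μ := volume) (measurableSet_Ioc (a := u) (b := v))
        exact (Measure.quasiMeasurePreserving_fst (μ := volume.restrict (Ioc u v))
          (ν := ν r)).ae h0
      filter_upwards [this] with w hw
      exact hRb w.1 (Ioc_subset_Icc_self hw) w.2) pm qm
    (by
      filter_upwards [hf.ae_integrable] with u hu _ r hr
      refine abs_integral_le_integral_abs.trans ?_
      simp only [← integral_const_mul]
      rw [← integral_finsetSum (f := fun (m : Fin K) x => CD m * |V m (u, x)|) _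
        fun m _ => ((hu m).abs.const_mul _)]
      refine integral_mono (integrable_finsetSum _ fun m _ => hint u hu r hr m).abs
        (integrable_finsetSum _ fun m _ => ((hu m).abs.const_mul _)) fun x => ?_
      refine (Finset.abs_sum_le_sum_abs _ _).trans (Finset.sum_le_sum fun m _ => ?_)
      rw [abs_mul]
      exact mul_le_mul_of_nonneg_right (hCD m r hr x) (abs_nonneg _))
    (Integrable.intervalIntegrable
      (integrable_finsetSum _ fun m _ => (hf.integrable_integral_abs m).const_mul _))
    (by
      filter_upwards [hf.ae_integrable] with u hu _
      refine continuousOn_of_dominated (bound := fun x => ∑ m : Fin K, CD m * |V m (u, x)|)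
        (fun r hr => (integrable_finsetSum _ fun m _ => hint u hu r hr m).aestronglyMeasurable)
        (fun r hr => ae_of_all _ fun x => ?_)
        (integrable_finsetSum _ fun m _ => ((hu m).abs.const_mul _))
        (ae_of_all _ fun x => Continuous.continuousOn (by fun_prop))
      refine (Finset.abs_sum_le_sum_abs _ _).trans (Finset.sum_le_sum fun m _ => ?_)
      rw [abs_mul]
      exact mul_le_mul_of_nonneg_right (hCD m r hr x) (abs_nonneg _))
    (fun x hx r _ => by
      refine abs_integral_le_integral_abs.trans ?_
      have : ∫ y, |R (x, firstCoords K y)| ∂(ν r) ≤ ∫ _, CR ∂(ν r) :=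
        integral_mono (integrable_of_continuous _ (by fun_prop)) (integrable_const _)
          fun y => hCR x hx y
      simpa using this)
    (fun x _ => (hf.continuous_integral (by fun_prop)).continuousOn)
  rw [this]
  refine intervalIntegral.integral_congr_ae ?_
  filter_upwards [hpR] with r hr hrI
  rw [uIoc_of_le hst] at hrI
  exact hr (Ioc_subset_Icc_self hrI)

end WeakFlow

theorem intervalIntegral_le_of_nonneg_right {f g : ℝ → ℝ} {s t : ℝ} (hst : s ≤ t)
    (hg : IntervalIntegrable g volume s t) (hg0 : ∀ r ∈ Icc s t, 0 ≤ g r)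
    (hfg : ∀ᵐ r, r ∈ Icc s t → f r ≤ g r) : ∫ r in s..t, f r ≤ ∫ r in s..t, g r := by
  by_cases hf : IntervalIntegrable f volume s t
  · refine intervalIntegral.integral_mono_ae_restrict hst hf hg ?_
    exact (ae_restrict_iff' measurableSet_Icc).2 hfg
  · rw [intervalIntegral.integral_undef hf]
    exact intervalIntegral.integral_nonneg hst hg0

theorem integral_le_of_nonneg_right {B : Type*} [MeasurableSpace B] {μ : Measure B} {f g : B → ℝ}
    (hg : Integrable g μ) (hg0 : ∀ x, 0 ≤ g x) (hfg : ∀ x, f x ≤ g x) :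
    ∫ x, f x ∂μ ≤ ∫ x, g x ∂μ := by
  by_cases hf : Integrable f μ
  · exact integral_mono hf hg hfg
  · rw [integral_undef hf]
    exact integral_nonneg hg0

theorem integrable_restrict_compProd {B : Type*} [MeasurableSpace B] {ν : Kernel ℝ B}
    [IsMarkovKernel ν] {f : ℝ × B → ℝ} (hm : Measurable f) (S : Set ℝ)
    (hf : Integrable f (volume ⊗ₘ ν)) : Integrable f (volume.restrict S ⊗ₘ ν) := by
  rw [Measure.integrable_compProd_iff hm.aestronglyMeasurable] at hf ⊢
  exact ⟨ae_restrict_of_ae hf.1, hf.2.restrict⟩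

theorem integrable_integral_of_compProd {B : Type*} [MeasurableSpace B] {ν : Kernel ℝ B}
    [IsMarkovKernel ν] {f : ℝ × B → ℝ} {μ : Measure ℝ} [SFinite μ]
    (hm : Measurable f) (hf : Integrable f (μ ⊗ₘ ν)) : Integrable (fun r => ∫ x, f (r, x) ∂(ν r)) μ :=
  ((Measure.integrable_compProd_iff hf.aestronglyMeasurable).1 hf).2.mono'
    hm.stronglyMeasurable.integral_kernel_prod_right'.aestronglyMeasurable (ae_of_all _ fun _ => norm_integral_le_integral_norm _)

theorem integrable_compProd_of_continuous {B : Type*} [TopologicalSpace B] [CompactSpace B]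
    [SecondCountableTopology B]
    [MeasurableSpace B] [BorelSpace B] {ν : Kernel ℝ B}
    [IsMarkovKernel ν] {f : ℝ × B → ℝ} (hf : Continuous f) (s t : ℝ) :
    Integrable f (volume.restrict (Icc s t) ⊗ₘ ν) := by
  obtain ⟨C, hC⟩ := exists_bound_on_Icc hf s t
  have hfm : Measurable f := hf.measurable
  refine Integrable.mono' (g := fun _ => C) (integrable_const _) hfm.aestronglyMeasurable ?_
  rw [Measure.ae_compProd_iff (measurableSet_le (by fun_prop) measurable_const)]
  filter_upwards [ae_restrict_mem measurableSet_Icc] with r hr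
  exact ae_of_all _ fun x => hC r hr x

theorem abs_map_le_sum {K : ℕ} (A : (Fin K → ℝ) →L[ℝ] ℝ) {c : Fin K → ℝ}
    (hc : ∀ k, |A (Pi.single k 1)| ≤ c k) (v : Fin K → ℝ) : |A v| ≤ ∑ k, c k * |v k| := by
  have : A v = ∑ k, v k * A (Pi.single k 1) := by
    conv_lhs => rw [pi_eq_sum_univ' v]
    simp [map_sum, smul_eq_mul, Pi.single]
  rw [this]
  refine (Finset.abs_sum_le_sum_abs _ _).trans (Finset.sum_le_sum fun k _ => ?_)
  rw [abs_mul, mul_comm]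
  exact mul_le_mul_of_nonneg_right (hc k) (abs_nonneg _)

namespace WeakFlow

theorem smooth_step {ν : Kernel ℝ HCube} [IsMarkovKernel ν] {V : ℕ → ℝ × HCube → ℝ}
    (hf : WeakFlow ν V) {K : ℕ} {U : (Fin K → ℝ) → ℝ} (hU : ContDiff ℝ 1 U) {c : Fin K → ℝ}
    (hc : ∀ z k, |fderiv ℝ U z (Pi.single k 1)| ≤ c k)
    {W : (Fin K → ℝ) → (Fin K → ℝ)} (hW : ContDiff ℝ 1 W) {L : ℝ}
    (hL : ∀ (x : HCube) m, ∑ k, c k * |fderiv ℝ W (firstCoords K x) (Pi.single m 1) k| ≤ L)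
    (hL0 : 0 ≤ L) {s t : ℝ} (hst : s ≤ t) :
    ∫ x, U (firstCoords K x) ∂(ν t) -
      ∫ x, U (firstCoords K x + (t - s) • W (firstCoords K x)) ∂(ν s) ≤
      ∫ r in s..t, ∫ x, ∑ k : Fin K, (c k * |V k (r, x) - W (firstCoords K x) k| +
        (t - s) * L * |V k (r, x)|) ∂(ν r) := by
  have hcc := continuous_firstCoords K
  have hWc := hW.continuous
  have hW' : Continuous (fderiv ℝ W) := hW.continuous_fderiv one_ne_zero
  have hU' : Continuous (fderiv ℝ U) := hU.continuous_fderiv one_ne_zero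
  have hWd : ∀ z, HasFDerivAt W (fderiv ℝ W z) z := fun z =>
    (hW.differentiable one_ne_zero z).hasFDerivAt
  have hUd : ∀ z, HasFDerivAt U (fderiv ℝ U z) z := fun z =>
    (hU.differentiable one_ne_zero z).hasFDerivAt
  have hc0 : ∀ k, 0 ≤ c k := fun k => (abs_nonneg _).trans (hc 0 k)
  have key := hf.weak_time (K := K) (Θ := fun r z => U (z + (t - r) • W z))
    (fun r => by fun_prop)
    (D := fun m p => fderiv ℝ U (p.2 + (t - p.1) • W p.2)
      (Pi.single m 1 + (t - p.1) • fderiv ℝ W p.2 (Pi.single m 1)))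
    (fun m => by fun_prop)
    (fun m r z => by
      have h1 : HasFDerivAt (fun z => z + (t - r) • W z)
          (ContinuousLinearMap.id ℝ _ + (t - r) • fderiv ℝ W z) z :=
        (hasFDerivAt_id z).add ((hWd z).const_smul (t - r))
      have := ((hUd _).comp z h1).fderiv
      simp only [Function.comp_def] at this
      rw [this]
      simp)
    (R := fun p => - fderiv ℝ U (p.2 + (t - p.1) • W p.2) (W p.2))
    (by fun_prop)
    (fun r z => by
      have h1 : HasDerivAt (fun u : ℝ => z + (t - u) • W z) (-(W z)) r := by
        have h2 : HasDerivAt (fun u : ℝ => t - u) (-1) r := by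
          simpa using (hasDerivAt_id r).const_sub t
        simpa using (h2.smul_const (W z)).const_add z
      have := (hUd (z + (t - r) • W z)).comp_hasDerivAt r h1
      simpa [Function.comp_def] using this)
    hst
  simp only [sub_self, zero_smul, add_zero] at key
  rw [key]
  refine intervalIntegral_le_of_nonneg_right hst ?_ ?_ ?_
  · rw [intervalIntegrable_iff_integrableOn_Icc_of_le hst]
    refine integrable_integral_of_compProd
      (f := fun p : ℝ × HCube => ∑ k : Fin K, (c k * |V k p - W (firstCoords K p.2) k| +
        (t - s) * L * |V k p|)) ?_ ?_
    · have := hf.meas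
      have := hcc.measurable
      have := hWc.measurable
      fun_prop
    refine integrable_finsetSum _ fun k _ => ?_
    have h1 := integrable_restrict_compProd (hf.meas k) (Icc s t) (hf.integrable k)
    have h2 : Integrable (fun p : ℝ × HCube => W (firstCoords K p.2) k)
        (volume.restrict (Icc s t) ⊗ₘ ν) := integrable_compProd_of_continuous (by fun_prop) s t
    exact ((h1.sub h2).abs.const_mul _).add (h1.abs.const_mul _)
  · intro r _
    refine integral_nonneg fun x => Finset.sum_nonneg fun k _ => add_nonneg
      (mul_nonneg (hc0 k) (abs_nonneg _)) (mul_nonneg (mul_nonneg (sub_nonneg.2 hst) hL0)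
        (abs_nonneg _))
  · filter_upwards [hf.ae_integrable] with r hr hrI
    obtain ⟨hr1, hr2⟩ := hrI
    refine integral_le_of_nonneg_right (integrable_finsetSum _ fun k _ => ?_)
      (fun x => Finset.sum_nonneg fun k _ => ?_) fun x => ?_
    · have h2 : Integrable (fun x => W (firstCoords K x) k) (ν r) :=
        integrable_of_continuous _ (by fun_prop)
      exact (((hr k).sub h2).abs.const_mul _).add ((hr k).abs.const_mul _)
    · exact add_nonneg (mul_nonneg (hc0 k) (abs_nonneg _))
        (mul_nonneg (mul_nonneg (sub_nonneg.2 hst) hL0) (abs_nonneg _))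
    · set z := firstCoords K x
      set A := fderiv ℝ U (z + (t - r) • W z)
      have hA := hc (z + (t - r) • W z)
      have e : ∑ m : Fin K, A (Pi.single m 1 + (t - r) • fderiv ℝ W z (Pi.single m 1)) * V m (r, x)
          + -A (W z) = A (fun m : Fin K => V m (r, x) - W z m) +
          ∑ m : Fin K, (t - r) * A (fderiv ℝ W z (Pi.single m 1)) * V m (r, x) := by
        have e1 : A (fun m : Fin K => V m (r, x) - W z m) =
            ∑ m : Fin K, A (Pi.single m 1) * V m (r, x) - A (W z) := by
          have : (fun m : Fin K => V m (r, x) - W z m) = (fun m : Fin K => V m (r, x)) - W z := rfl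
          rw [this, map_sub]
          congr 1
          conv_lhs => rw [pi_eq_sum_univ' (fun m : Fin K => V m (r, x))]
          simp [map_sum, smul_eq_mul, Pi.single, mul_comm]
        rw [e1]
        simp only [map_add, map_smul, smul_eq_mul, add_mul, Finset.sum_add_distrib]
        ring
      rw [e, Finset.sum_add_distrib]
      refine add_le_add ((le_abs_self _).trans (abs_map_le_sum A hA _))
        (Finset.sum_le_sum fun m _ => ?_)
      refine (le_abs_self _).trans ?_
      rw [abs_mul, abs_mul, abs_of_nonneg (sub_nonneg.2 hr2)]
      refine mul_le_mul_of_nonneg_right ?_ (abs_nonneg _)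
      refine mul_le_mul (by linarith) ((abs_map_le_sum A hA _).trans (hL x m)) (abs_nonneg _)
        (sub_nonneg.2 hst)

end WeakFlow

theorem continuous_of_abs_sub_le_sum {K : ℕ} {ψ : (Fin K → ℝ) → ℝ} {c : Fin K → ℝ}
    (hψ : ∀ z z', |ψ z - ψ z'| ≤ ∑ k, c k * |z k - z' k|) : Continuous ψ := by
  rw [continuous_iff_continuousAt]
  intro z
  rw [ContinuousAt, tendsto_iff_dist_tendsto_zero]
  have h : Tendsto (fun z' : Fin K → ℝ => ∑ k, c k * |z' k - z k|) (𝓝 z) (𝓝 0) := by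
    have : Continuous fun z' : Fin K → ℝ => ∑ k, c k * |z' k - z k| := by fun_prop
    simpa using this.tendsto z
  exact squeeze_zero (fun _ => dist_nonneg) (fun z' => by rw [Real.dist_eq]; exact hψ z' z) h

theorem exists_contDiff_abs_sub_le {K : ℕ} {ψ : (Fin K → ℝ) → ℝ} {c : Fin K → ℝ}
    (hc : ∀ k, 0 ≤ c k) (hψ : ∀ z z', |ψ z - ψ z'| ≤ ∑ k, c k * |z k - z' k|) {ε : ℝ}
    (hε : 0 < ε) : ∃ U : (Fin K → ℝ) → ℝ, ContDiff ℝ 1 U ∧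
      (∀ z k, |fderiv ℝ U z (Pi.single k 1)| ≤ c k) ∧ ∀ z, |U z - ψ z| ≤ ε := by
  have hcont := continuous_of_abs_sub_le_sum hψ
  have hC0 : 0 ≤ ∑ k, c k := Finset.sum_nonneg fun k _ => hc k
  obtain ⟨δ, hδ, hδε⟩ : ∃ δ : ℝ, 0 < δ ∧ (∑ k, c k) * δ ≤ ε := by
    refine ⟨ε / (∑ k, c k + 1), by positivity, ?_⟩
    rw [mul_div_assoc', div_le_iff₀ (by positivity)]
    nlinarith
  let φ : ContDiffBump (0 : Fin K → ℝ) := ⟨δ / 2, δ, by positivity, by linarith⟩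
  let U : (Fin K → ℝ) → ℝ := convolution (φ.normed volume) ψ (ContinuousLinearMap.lsmul ℝ ℝ) volume
  have hUd : ∀ z, U z = ∫ t, φ.normed volume t * ψ (z - t) := fun z => by
    simp [U, convolution_def]
  have hUc : ContDiff ℝ 1 U := (φ.hasCompactSupport_normed).contDiff_convolution_left _
    (n := 1) φ.contDiff_normed hcont.locallyIntegrable
  have hint : ∀ z, Integrable fun t => φ.normed volume t * ψ (z - t) := fun z => by
    refine Continuous.integrable_of_hasCompactSupport ?_ ?_
    · exact φ.continuous_normed.mul (by fun_prop)
    · exact (φ.hasCompactSupport_normed (μ := volume)).mul_right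
  have hUL : ∀ z z', |U z - U z'| ≤ ∑ k, c k * |z k - z' k| := by
    intro z z'
    rw [hUd, hUd, ← integral_sub (hint z) (hint z')]
    refine abs_integral_le_integral_abs.trans ?_
    calc ∫ t, |φ.normed volume t * ψ (z - t) - φ.normed volume t * ψ (z' - t)|
        ≤ ∫ t, φ.normed volume t * ∑ k, c k * |z k - z' k| := by
          refine integral_mono ((hint z).sub (hint z')).abs
            (φ.integrable_normed.mul_const _) fun t => ?_
          simp only
          rw [← mul_sub, abs_mul, abs_of_nonneg (φ.nonneg_normed t)]
          refine mul_le_mul_of_nonneg_left ?_ (φ.nonneg_normed t)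
          simpa using hψ (z - t) (z' - t)
      _ = _ := by rw [integral_mul_const, φ.integral_normed, one_mul]
  refine ⟨U, hUc, fun z k => ?_, fun z => ?_⟩
  · have h1 := (hUc.differentiable one_ne_zero z).hasFDerivAt
    have h2 : HasDerivAt (fun u : ℝ => z + u • (Pi.single k 1 : Fin K → ℝ)) (Pi.single k 1) 0 := by
      simpa using ((hasDerivAt_id (0 : ℝ)).smul_const (Pi.single k 1 : Fin K → ℝ)).const_add z
    have h3 : HasDerivAt (fun u : ℝ => U (z + u • (Pi.single k 1 : Fin K → ℝ)))
        (fderiv ℝ U z (Pi.single k 1)) 0 :=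
      HasFDerivAt.comp_hasDerivAt (l := U) (0 : ℝ) (by simpa using h1) h2
    refine h3.le_of_lip' (hc k) (Eventually.of_forall fun u => ?_)
    refine (hUL _ _).trans (le_of_eq ?_)
    rw [Finset.sum_eq_single k]
    · simp
    · intro j _ hj
      simp [hj]
    · simp
  · have := φ.dist_normed_convolution_le (μ := volume) (g := ψ) (x₀ := z) (ε := ε)
      hcont.aestronglyMeasurable fun x hx => by
        rw [Real.dist_eq]
        refine (hψ x z).trans (le_trans ?_ hδε)
        rw [Finset.sum_mul]
        refine Finset.sum_le_sum fun k _ => mul_le_mul_of_nonneg_left ?_ (hc k)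
        have h1 : dist (x k) (z k) ≤ dist x z := dist_le_pi_dist x z k
        rw [← Real.dist_eq]
        exact h1.trans (le_of_lt hx)
    rwa [Real.dist_eq] at this

namespace WeakFlow

variable {ν : Kernel ℝ HCube} [IsMarkovKernel ν] {V : ℕ → ℝ × HCube → ℝ}

theorem lipschitz_step
    (hf : WeakFlow ν V) {K : ℕ} {ψ : (Fin K → ℝ) → ℝ} {c : Fin K → ℝ}
    (hc : ∀ k, 0 ≤ c k) (hψ : ∀ z z', |ψ z - ψ z'| ≤ ∑ k, c k * |z k - z' k|)
    {W : (Fin K → ℝ) → (Fin K → ℝ)} (hW : ContDiff ℝ 1 W) {L : ℝ}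
    (hL : ∀ (x : HCube) m, ∑ k, c k * |fderiv ℝ W (firstCoords K x) (Pi.single m 1) k| ≤ L)
    (hL0 : 0 ≤ L) {s t : ℝ} (hst : s ≤ t) :
    ∫ x, ψ (firstCoords K x) ∂(ν t) -
      ∫ x, ψ (firstCoords K x + (t - s) • W (firstCoords K x)) ∂(ν s) ≤
      ∫ r in s..t, ∫ x, ∑ k : Fin K, (c k * |V k (r, x) - W (firstCoords K x) k| +
        (t - s) * L * |V k (r, x)|) ∂(ν r) := by
  have hcc := continuous_firstCoords K
  have hcont := continuous_of_abs_sub_le_sum hψ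
  have hWc := hW.continuous
  refine le_of_forall_pos_le_add fun ε hε => ?_
  obtain ⟨U, hU, hUc, hUψ⟩ := exists_contDiff_abs_sub_le hc hψ (half_pos hε)
  have hUcont := hU.continuous
  have h0 := hf.smooth_step hU hUc hW hL hL0 hst
  have h1 : ∫ x, ψ (firstCoords K x) ∂(ν t) ≤ ∫ x, (U (firstCoords K x) + ε / 2) ∂(ν t) :=
    integral_mono (integrable_of_continuous _ (by fun_prop))
      (integrable_of_continuous _ (by fun_prop)) fun x => by
        have := (abs_le.1 (hUψ (firstCoords K x))).1
        simp only; linarith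
  have h2 : ∫ x, U (firstCoords K x + (t - s) • W (firstCoords K x)) ∂(ν s) ≤
      ∫ x, (ψ (firstCoords K x + (t - s) • W (firstCoords K x)) + ε / 2) ∂(ν s) :=
    integral_mono (integrable_of_continuous _ (by fun_prop))
      (integrable_of_continuous _ (by fun_prop)) fun x => by
        have := (abs_le.1 (hUψ (firstCoords K x + (t - s) • W (firstCoords K x)))).2
        simp only; linarith
  rw [integral_add (integrable_of_continuous _ (by fun_prop)) (integrable_const _)] at h1 h2
  simp only [integral_const, probReal_univ, one_smul] at h1 h2
  linarith

end WeakFlow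

/-- The weighted one-step defect from the Euler scheme with velocity `W`. -/
def eulerCost {K : ℕ} (c : Fin K → ℝ) (δ : ℝ) (W : C(Fin K → ℝ, Fin K → ℝ)) :
    C(HCube × HCube, ℝ) where
  toFun p := ∑ k : Fin K, c k *
    |firstCoords K p.2 k - (firstCoords K p.1 + δ • W (firstCoords K p.1)) k|
  continuous_toFun := by
    have := continuous_firstCoords K
    fun_prop

theorem WeakFlow.step_dual {ν : Kernel ℝ HCube} [IsMarkovKernel ν] {V : ℕ → ℝ × HCube → ℝ}
    (hf : WeakFlow ν V) {K : ℕ} {c : Fin K → ℝ} (hc : ∀ k, 0 ≤ c k)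
    {W : C(Fin K → ℝ, Fin K → ℝ)} (hW : ContDiff ℝ 1 W) {L : ℝ}
    (hL : ∀ (x : HCube) m, ∑ k, c k * |fderiv ℝ W (firstCoords K x) (Pi.single m 1) k| ≤ L)
    (hL0 : 0 ≤ L) {s t : ℝ} (hst : s ≤ t) (f g : C(HCube, ℝ))
    (hfg : ∀ x y, g y ≤ f x + eulerCost c (t - s) W (x, y)) :
    ∫ x, g x ∂(ν t) ≤ ∫ x, f x ∂(ν s) +
      ∫ r in s..t, ∫ x, ∑ k : Fin K, (c k * |V k (r, x) - W (firstCoords K x) k| +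
        (t - s) * L * |V k (r, x)|) ∂(ν r) := by
  have hcc := continuous_firstCoords K
  have hWc := W.continuous
  let e : HCube → Fin K → ℝ := fun x => firstCoords K x + (t - s) • W (firstCoords K x)
  let Q : (Fin K → ℝ) → HCube → ℝ := fun z x => f x + ∑ k, c k * |z k - e x k|
  let ψ : (Fin K → ℝ) → ℝ := fun z => ⨅ x, Q z x
  obtain ⟨C, hC⟩ := (isCompact_univ (X := HCube)).exists_bound_of_continuousOn
    f.continuous.continuousOn
  have hbdd : ∀ z, BddBelow (range (Q z)) := fun z => by
    refine ⟨-C, ?_⟩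
    rintro _ ⟨x, rfl⟩
    have h1 := (abs_le.1 (hC x (mem_univ _))).1
    have h2 : 0 ≤ ∑ k, c k * |z k - e x k| :=
      Finset.sum_nonneg fun k _ => mul_nonneg (hc k) (abs_nonneg _)
    simp only [Q]
    linarith
  have hne : Nonempty HCube := ⟨fun _ => ⟨0, by simp⟩⟩
  have hle : ∀ z z', ψ z ≤ ψ z' + ∑ k, c k * |z k - z' k| := fun z z' => by
    rw [← sub_le_iff_le_add]
    refine le_ciInf fun x => ?_
    rw [sub_le_iff_le_add]
    refine (ciInf_le (hbdd z) x).trans ?_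
    simp only [Q]
    rw [add_assoc, ← Finset.sum_add_distrib]
    refine add_le_add le_rfl (Finset.sum_le_sum fun k _ => ?_)
    rw [← mul_add]
    refine mul_le_mul_of_nonneg_left ?_ (hc k)
    have := abs_sub_le (z k) (z' k) (e x k)
    linarith
  have hψ : ∀ z z', |ψ z - ψ z'| ≤ ∑ k, c k * |z k - z' k| := fun z z' => by
    rw [abs_le]
    have h1 := hle z z'
    have h2 := hle z' z
    simp only [fun k => abs_sub_comm (z' k) (z k)] at h2
    constructor <;> linarith
  have hcont := continuous_of_abs_sub_le_sum hψ
  have h0 := hf.lipschitz_step hc hψ hW hL hL0 hst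
  have h1 : ∫ x, g x ∂(ν t) ≤ ∫ x, ψ (firstCoords K x) ∂(ν t) :=
    integral_mono (integrable_of_continuous _ g.continuous)
      (integrable_of_continuous _ (by fun_prop)) fun y => le_ciInf fun x => hfg x y
  have h2 : ∫ x, ψ (firstCoords K x + (t - s) • W (firstCoords K x)) ∂(ν s) ≤
      ∫ x, f x ∂(ν s) :=
    integral_mono (integrable_of_continuous _ (by fun_prop))
      (integrable_of_continuous _ f.continuous) fun x => by
        refine (ciInf_le (hbdd _) x).trans ?_
        simp [Q, e]
  linarith

/-- Smooth cylinder functions of time and of a point of the Hilbert cube. -/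
def IsCylinder (K : ℕ) (p : ℝ × HCube → ℝ) : Prop :=
  ∃ P : ℝ × (Fin K → ℝ) → ℝ, ContDiff ℝ 1 P ∧ ∀ t x, p (t, x) = P (t, firstCoords K x)

theorem IsCylinder.mono {K K' : ℕ} (h : K ≤ K') {p : ℝ × HCube → ℝ} (hp : IsCylinder K p) :
    IsCylinder K' p := by
  obtain ⟨P, hP, hPp⟩ := hp
  refine ⟨fun y => P (y.1, fun i => y.2 (Fin.castLE h i)), ?_, fun t x => hPp t x⟩
  refine hP.comp (contDiff_fst.prodMk ?_)
  rw [contDiff_pi]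
  intro i
  exact (contDiff_apply ℝ ℝ (Fin.castLE h i)).comp contDiff_snd

theorem IsCylinder.continuous {K : ℕ} {p : ℝ × HCube → ℝ} (hp : IsCylinder K p) :
    Continuous p := by
  obtain ⟨P, hP, hPp⟩ := hp
  have := continuous_firstCoords K
  have h2 := hP.continuous
  have : p = fun y => P (y.1, firstCoords K y.2) := funext fun y => hPp y.1 y.2
  rw [this]
  fun_prop

/-- Restrictions of smooth cylinder functions to a bounded time interval. -/
def cylinderSubalgebra (H : ℝ) : Subalgebra ℝ C(Icc (0 : ℝ) H × HCube, ℝ) where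
  carrier := {f | ∃ K p, IsCylinder K p ∧ ∀ y, f y = p (y.1, y.2)}
  mul_mem' := by
    rintro f g ⟨K, p, hp, hfp⟩ ⟨K', p', hp', hfp'⟩
    obtain ⟨P, hP, hPp⟩ := hp.mono (le_max_left K K')
    obtain ⟨P', hP', hPp'⟩ := hp'.mono (le_max_right K K')
    refine ⟨max K K', fun y => p y * p' y, ⟨fun y => P y * P' y, hP.mul hP', fun t x => ?_⟩,
      fun y => ?_⟩
    · simp only [hPp, hPp']
    · simp [hfp, hfp']
  add_mem' := by
    rintro f g ⟨K, p, hp, hfp⟩ ⟨K', p', hp', hfp'⟩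
    obtain ⟨P, hP, hPp⟩ := hp.mono (le_max_left K K')
    obtain ⟨P', hP', hPp'⟩ := hp'.mono (le_max_right K K')
    refine ⟨max K K', fun y => p y + p' y, ⟨fun y => P y + P' y, hP.add hP', fun t x => ?_⟩,
      fun y => ?_⟩
    · simp only [hPp, hPp']
    · simp [hfp, hfp']
  algebraMap_mem' r := ⟨0, fun _ => r, ⟨fun _ => r, contDiff_const, fun _ _ => rfl⟩, fun _ => rfl⟩

theorem cylinderSubalgebra_separatesPoints (H : ℝ) :
    (cylinderSubalgebra H).SeparatesPoints := by
  intro y y' hyy'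
  by_cases h1 : y.1 = y'.1
  · have h2 : y.2 ≠ y'.2 := fun h => hyy' (Prod.ext h1 h)
    obtain ⟨k, hk⟩ := Function.ne_iff.1 h2
    refine ⟨_, ⟨⟨fun z => (z.2 k : ℝ), by fun_prop⟩, ⟨k + 1, fun z => (z.2 k : ℝ),
      ⟨fun z => z.2 (Fin.last k), ?_, fun t x => by simp [firstCoords]⟩, fun _ => rfl⟩, rfl⟩, ?_⟩
    · exact (contDiff_apply ℝ ℝ (Fin.last k)).comp contDiff_snd
    · exact fun h => hk (Subtype.ext h)
  · refine ⟨_, ⟨⟨fun z => (z.1 : ℝ), by fun_prop⟩, ⟨0, fun z => z.1,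
      ⟨fun z => z.1, contDiff_fst, fun t x => rfl⟩, fun _ => rfl⟩, rfl⟩, ?_⟩
    exact fun h => h1 (Subtype.ext h)

theorem exists_cylinder_integral_abs_sub_le {ν : Kernel ℝ HCube} [IsMarkovKernel ν]
    {v : ℝ × HCube → ℝ} {H : ℝ}
    (hi : Integrable v (volume.restrict (Icc 0 H) ⊗ₘ ν)) {ε : ℝ} (hε : 0 < ε) :
    ∃ K p, IsCylinder K p ∧
      ∫ y, |v y - p y| ∂(volume.restrict (Icc 0 H) ⊗ₘ ν) ≤ ε := by
  set μ := volume.restrict (Icc 0 H) ⊗ₘ ν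
  obtain ⟨g, hg, hgi⟩ := hi.exists_boundedContinuous_integral_sub_le (half_pos hε)
  obtain ⟨δ, hδ, hδε⟩ : ∃ δ : ℝ, 0 < δ ∧ μ.real univ * δ ≤ ε / 2 := by
    refine ⟨(ε / 2) / (μ.real univ + 1), by positivity, ?_⟩
    rw [mul_div_assoc', div_le_iff₀ (by positivity)]
    nlinarith [measureReal_nonneg (μ := μ) (s := univ)]
  have hsw := ContinuousMap.exists_mem_subalgebra_near_continuous_of_separatesPoints
    (cylinderSubalgebra H) (cylinderSubalgebra_separatesPoints H)
    (fun y => g (y.1, y.2)) (by fun_prop) δ hδ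
  obtain ⟨⟨f, K, p, hp, hfp⟩, hfg⟩ := hsw
  refine ⟨K, p, hp, ?_⟩
  have hpc := hp.continuous
  have hpi : Integrable p μ := integrable_compProd_of_continuous hpc 0 H
  have hgp : ∀ᵐ y ∂μ, |g y - p y| ≤ δ := by
    have hpm := hpc.measurable
    have hgm := g.continuous.measurable
    rw [Measure.ae_compProd_iff (measurableSet_le (by fun_prop) measurable_const)]
    filter_upwards [ae_restrict_mem measurableSet_Icc] with r hr
    refine ae_of_all _ fun x => ?_
    have := hfg (⟨r, hr⟩, x)
    rw [abs_sub_comm]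
    simpa [hfp] using this.le
  calc ∫ y, |v y - p y| ∂μ ≤ ∫ y, (‖v y - g y‖ + δ) ∂μ := by
        refine integral_mono_ae (hi.sub hpi).abs ((hi.sub hgi).norm.add (integrable_const _)) ?_
        filter_upwards [hgp] with y hy
        have := abs_sub_le (v y) (g y) (p y)
        rw [Real.norm_eq_abs]
        linarith
    _ ≤ ε := by
        have hn : Integrable (fun y => ‖v y - g y‖) μ := (hi.sub hgi).norm
        rw [integral_add hn (integrable_const _)]
        simp only [integral_const, smul_eq_mul]
        linarith

theorem sum_fin_indicator_mul {j K : ℕ} (h : j ≤ K) (f : ℕ → ℝ) :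
    ∑ k : Fin K, (if (k : ℕ) < j then (1 : ℝ) else 0) * f k = ∑ k ∈ Finset.range j, f k := by
  rw [Fin.sum_univ_eq_sum_range (fun k => (if k < j then (1 : ℝ) else 0) * f k) K]
  have hs : Finset.range j ⊆ Finset.range K := Finset.range_subset_range.2 h
  rw [← Finset.sum_subset hs]
  · refine Finset.sum_congr rfl fun k hk => ?_
    simp [Finset.mem_range.1 hk]
  · intro k _ hk
    simp only [Finset.mem_range] at hk
    simp [hk]

theorem WeakFlow.exists_cylinder_approx {ν : Kernel ℝ HCube} [IsMarkovKernel ν]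
    {V : ℕ → ℝ × HCube → ℝ} (hf : WeakFlow ν V) (H : ℝ) (i : ℕ) {ε : ℝ} (hε : 0 < ε) :
    ∃ (K : ℕ) (p : ℕ → ℝ × HCube → ℝ), i ≤ K ∧ (∀ k, IsCylinder K (p k)) ∧
      ∑ k ∈ Finset.range i, ∫ y, |V k y - p k y| ∂(volume.restrict (Icc 0 H) ⊗ₘ ν) ≤ ε := by
  have hδ : 0 < ε / (i + 1) := by positivity
  choose K p hp hpi using fun k => exists_cylinder_integral_abs_sub_le
    (integrable_restrict_compProd (hf.meas k) (Icc 0 H) (hf.integrable k)) hδ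
  refine ⟨max i ((Finset.range i).sup K), fun k => if k < i then p k else fun _ => 0,
    le_max_left _ _, fun k => ?_, ?_⟩
  · beta_reduce
    split_ifs with hk
    · exact (hp k).mono ((Finset.le_sup (f := K) (Finset.mem_range.2 hk)).trans (le_max_right _ _))
    · exact ⟨fun _ => 0, contDiff_const, fun _ _ => rfl⟩
  · calc _ ≤ ∑ k ∈ Finset.range i, ε / (i + 1) := by
          refine Finset.sum_le_sum fun k hk => ?_
          simp only [if_pos (Finset.mem_range.1 hk)]
          exact hpi k
      _ ≤ ε := by
          rw [Finset.sum_const, Finset.card_range, nsmul_eq_mul, mul_div_assoc', div_le_iff₀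
            (by positivity)]
          nlinarith

instance : Nonempty HCube := ⟨fun _ => ⟨0, by simp⟩⟩

theorem exists_uniform_time {p : ℝ × HCube → ℝ} (hp : Continuous p) (H : ℝ) {δ : ℝ} (hδ : 0 < δ) :
    ∃ ρ > 0, ∀ s ∈ Icc 0 H, ∀ t ∈ Icc 0 H, |s - t| < ρ → ∀ x, |p (s, x) - p (t, x)| ≤ δ := by
  have hc : UniformContinuous fun y : Icc (0 : ℝ) H => (⟨fun x => p (y, x), by fun_prop⟩ :
      C(HCube, ℝ)) := by
    refine CompactSpace.uniformContinuous_of_continuous ?_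
    exact ContinuousMap.continuous_of_continuous_uncurry _ (by
      simp only [Function.uncurry_def, ContinuousMap.coe_mk]; fun_prop)
  obtain ⟨ρ, hρ, h⟩ := Metric.uniformContinuous_iff.1 hc δ hδ
  refine ⟨ρ, hρ, fun s hs t ht hst x => ?_⟩
  have := h (a := ⟨s, hs⟩) (b := ⟨t, ht⟩) (by rw [Subtype.dist_eq, Real.dist_eq]; exact hst)
  rw [ContinuousMap.dist_lt_iff hδ] at this
  have := this x
  rw [Real.dist_eq] at this
  exact this.le

/-- Total defect of a discrete path from the Euler scheme for one coordinate. -/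
def eulerDefect (p : ℝ × HCube → ℝ) (k N n : ℕ) (ω : ℚ → HCube) : ℝ :=
  ∑ l ∈ Finset.range n, |(ω (((l + 1 : ℕ) : ℚ) / N) k : ℝ) - ω ((l : ℚ) / N) k -
    (1 / N : ℝ) * p ((l : ℝ) / N, ω ((l : ℚ) / N))|

theorem continuous_eulerDefect {p : ℝ × HCube → ℝ} (hp : Continuous p) (k N n : ℕ) :
    Continuous (eulerDefect p k N n) := by
  unfold eulerDefect
  fun_prop

theorem eulerDefect_nonneg (p : ℝ × HCube → ℝ) (k N n : ℕ) (ω : ℚ → HCube) :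
    0 ≤ eulerDefect p k N n ω := Finset.sum_nonneg fun _ _ => abs_nonneg _

theorem WeakFlow.eventually_exists_chain {ν : Kernel ℝ HCube} [IsMarkovKernel ν]
    {V : ℕ → ℝ × HCube → ℝ} (hf : WeakFlow ν V) (H : ℕ) {j K : ℕ} (hjK : j ≤ K)
    {p : ℕ → ℝ × HCube → ℝ} (hp : ∀ k, IsCylinder K (p k)) {ε : ℝ} (hε : 0 < ε)
    (hpV : ∑ k ∈ Finset.range j, ∫ y, |V k y - p k y| ∂(volume.restrict (Icc 0 (H : ℝ)) ⊗ₘ ν) ≤ ε) :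
    ∀ᶠ N : ℕ in atTop, ∃ μ : Measure (ℚ → HCube), IsProbabilityMeasure μ ∧
      (∀ i ≤ H * N, ∀ F : C(HCube, ℝ), ∫ ω, F (ω ((i : ℚ) / N)) ∂μ = ∫ x, F x ∂(ν ((i : ℝ) / N))) ∧
      ∀ k < j, ∫ ω, eulerDefect (p k) k N (H * N) ω ∂μ ≤ 2 * ε := by
  have hcc := continuous_firstCoords K
  choose P hP hPp using hp
  have hPc := fun k => (hP k).continuous
  have hpc := fun k => IsCylinder.continuous ⟨P k, hP k, hPp k⟩
  let c : Fin K → ℝ := fun k => if (k : ℕ) < j then (1 : ℝ) else 0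
  have hc : ∀ k, 0 ≤ c k := fun k => by simp only [c]; split_ifs <;> norm_num
  have hc1 : ∀ k, c k ≤ 1 := fun k => by simp only [c]; split_ifs <;> norm_num
  have hP' : ∀ k, Continuous (fderiv ℝ (P k)) := fun k => (hP k).continuous_fderiv one_ne_zero
  have hPd : ∀ k y, HasFDerivAt (P k) (fderiv ℝ (P k) y) y := fun k y =>
    ((hP k).differentiable one_ne_zero y).hasFDerivAt
  obtain ⟨L, hL0, hL⟩ : ∃ L, 0 ≤ L ∧ ∀ r ∈ Icc (0 : ℝ) H, ∀ x m, ∑ k : Fin K, c k *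
      |fderiv ℝ (P k) (r, firstCoords K x) (0, Pi.single m 1)| ≤ L := by
    choose L hL using fun m : Fin K => exists_bound_on_Icc (G := fun y : ℝ × HCube =>
      ∑ k : Fin K, c k * |fderiv ℝ (P k) (y.1, firstCoords K y.2) (0, Pi.single m 1)|)
      (by fun_prop) 0 H
    refine ⟨∑ m, |L m|, Finset.sum_nonneg fun _ _ => abs_nonneg _, fun r hr x m => ?_⟩
    exact (le_abs_self _).trans ((hL m r hr x).trans ((le_abs_self _).trans
      (Finset.single_le_sum (f := fun m => |L m|) (fun _ _ => abs_nonneg _) (Finset.mem_univ m))))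
  let I : ℝ := ∑ k : Fin K, ∫ r in (0 : ℝ)..H, ∫ x, |V k (r, x)| ∂(ν r)
  obtain ⟨δ, hδ, hδε⟩ : ∃ δ : ℝ, 0 < δ ∧ K * H * δ ≤ ε / 2 := by
    refine ⟨(ε / 2) / (K * H + 1), by positivity, ?_⟩
    rw [mul_div_assoc', div_le_iff₀ (by positivity)]
    nlinarith
  choose ρ hρ0 hρ using fun k => exists_uniform_time (hpc k) H hδ
  have hev1 : ∀ᶠ N : ℕ in atTop, ∀ k : Fin K, (1 : ℝ) / N < ρ k := by
    rw [eventually_all]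
    exact fun k => (tendsto_one_div_atTop_nhds_zero_nat (𝕜 := ℝ)).eventually_lt_const (hρ0 k)
  have hev2 : ∀ᶠ N : ℕ in atTop, (1 : ℝ) / N * (L * I) < ε / 2 := by
    have := (tendsto_one_div_atTop_nhds_zero_nat (𝕜 := ℝ)).mul_const (L * I)
    rw [zero_mul] at this
    exact this.eventually_lt_const (half_pos hε)
  filter_upwards [hev1, hev2, eventually_gt_atTop 0] with N hN1 hN2 hN0
  have hNR : (0 : ℝ) < N := by exact_mod_cast hN0
  have hmemI : ∀ l ≤ H * N, (l : ℝ) / N ∈ Icc (0 : ℝ) H := fun l hl => by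
    refine ⟨by positivity, ?_⟩
    rw [div_le_iff₀ hNR]
    exact_mod_cast hl
  have hdiff : ∀ l : ℕ, ((l + 1 : ℕ) : ℝ) / N - (l : ℝ) / N = 1 / N := fun l => by
    push_cast; ring
  have hle : ∀ l : ℕ, (l : ℝ) / N ≤ ((l + 1 : ℕ) : ℝ) / N := fun l => by
    have := hdiff l
    have h2 : (0 : ℝ) < 1 / N := by positivity
    linarith
  let W : ℕ → C(Fin K → ℝ, Fin K → ℝ) := fun l =>
    ⟨fun z k => P k ((l : ℝ) / N, z), by fun_prop⟩
  have hWd : ∀ l, ContDiff ℝ 1 (W l) := fun l => by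
    rw [contDiff_pi]
    intro k
    exact (hP k).comp (contDiff_const.prodMk contDiff_id)
  have hWf : ∀ l z m k, fderiv ℝ (W l) z (Pi.single m 1) k =
      fderiv ℝ (P k) ((l : ℝ) / N, z) (0, Pi.single m 1) := by
    intro l z m k
    have h1 : HasFDerivAt (fun z => fun k : Fin K => P k ((l : ℝ) / N, z)) (ContinuousLinearMap.pi
        fun k : Fin K => (fderiv ℝ (P k) ((l : ℝ) / N, z)).comp
          (ContinuousLinearMap.inr ℝ ℝ (Fin K → ℝ))) z := by
      rw [hasFDerivAt_pi]
      intro k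
      exact (hPd k _).comp z (hasFDerivAt_prodMk_right _ _)
    have : fderiv ℝ (W l) z = _ := h1.fderiv
    rw [this]
    simp
  let κ : ℕ → ℝ := fun l => ∫ r in ((l : ℝ) / N)..(((l + 1 : ℕ) : ℝ) / N), ∫ x, ∑ k : Fin K,
    (c k * |V k (r, x) - W l (firstCoords K x) k| + 1 / N * L * |V k (r, x)|) ∂(ν r)
  have hchain := exists_chain_of_step_dual (ι := ℚ) (B := HCube) (H * N)
    (fun i => ν ((i : ℝ) / N)) (fun l => eulerCost c (1 / N) (W l)) κ
    (fun l hl f g hfg => by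
      have h := hf.step_dual hc (hWd l) (L := L) (fun x m => by
        simp only [hWf]
        exact hL _ (hmemI l hl.le) x m) hL0 (hle l) f g (by
          rw [hdiff l]; exact hfg)
      rw [hdiff l] at h
      exact h)
    (fun l => (l : ℚ) / N) (fun l l' h => by
      have hNQ : (N : ℚ) ≠ 0 := by exact_mod_cast hN0.ne'
      have := (div_left_inj' hNQ).1 h
      exact_mod_cast this)
  obtain ⟨μ, hμ, hmarg, hcost⟩ := hchain
  refine ⟨μ, hμ, hmarg, fun k hk => ?_⟩
  let G : Fin K → ℝ × HCube → ℝ := fun k y =>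
    c k * |V k y - p k y| + δ + 1 / N * L * |V k y|
  have hVm := hf.meas
  have hpm := fun k => (hpc k).measurable
  have hpi : ∀ k, Integrable (p k) (volume.restrict (Icc 0 (H : ℝ)) ⊗ₘ ν) := fun k =>
    integrable_compProd_of_continuous (hpc k) 0 H
  have hVi : ∀ k, Integrable (V k) (volume.restrict (Icc 0 (H : ℝ)) ⊗ₘ ν) := fun k =>
    integrable_restrict_compProd (hf.meas k) _ (hf.integrable k)
  have hVpi : ∀ k, Integrable (fun y => |V k y - p k y|)
      (volume.restrict (Icc 0 (H : ℝ)) ⊗ₘ ν) := fun k => ((hVi k).sub (hpi k)).abs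
  have hGki : ∀ k, Integrable (G k) (volume.restrict (Icc 0 (H : ℝ)) ⊗ₘ ν) := fun k =>
    (((hVpi k).const_mul _).add (integrable_const _)).add ((hVi k).abs.const_mul _)
  have hGi : Integrable (fun y => ∑ k, G k y) (volume.restrict (Icc 0 (H : ℝ)) ⊗ₘ ν) :=
    integrable_finsetSum _ fun k _ => hGki k
  have hGm : Measurable fun y => ∑ k, G k y := by
    simp only [G]; fun_prop
  let g : ℝ → ℝ := fun r => ∫ x, ∑ k, G k (r, x) ∂(ν r)
  have hG0 : ∀ k y, 0 ≤ G k y := fun k y => by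
    have := hc k
    positivity
  have hgi : IntegrableOn g (Icc 0 (H : ℝ)) := integrable_integral_of_compProd hGm hGi
  have hgl : ∀ l < H * N, IntervalIntegrable g volume ((l : ℝ) / N) (((l + 1 : ℕ) : ℝ) / N) := by
    intro l hl
    rw [intervalIntegrable_iff_integrableOn_Icc_of_le (hle l)]
    exact hgi.mono_set (Icc_subset_Icc (hmemI l hl.le).1 (hmemI (l + 1) hl).2)
  have hκ : ∀ l < H * N, κ l ≤ ∫ r in ((l : ℝ) / N)..(((l + 1 : ℕ) : ℝ) / N), g r := by
    intro l hl
    refine intervalIntegral_le_of_nonneg_right (hle l) (hgl l hl)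
      (fun r _ => integral_nonneg fun x => Finset.sum_nonneg fun k _ => hG0 k _) ?_
    filter_upwards [hf.ae_integrable] with r hr hrI
    have hr0 : r ∈ Icc (0 : ℝ) H :=
      Icc_subset_Icc (hmemI l hl.le).1 (hmemI (l + 1) hl).2 hrI
    refine integral_le_of_nonneg_right (integrable_finsetSum _ fun k _ => ?_)
      (fun x => Finset.sum_nonneg fun k _ => hG0 k _) fun x => Finset.sum_le_sum fun k _ => ?_
    · have h2 : Integrable (fun x => p k (r, x)) (ν r) := integrable_of_continuous _ (by
        have := hpc k; fun_prop)
      exact ((((hr k).sub h2).abs.const_mul _).add (integrable_const _)).add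
        ((hr k).abs.const_mul _)
    · have h1 : |p k (r, x) - p k ((l : ℝ) / N, x)| ≤ δ := by
        refine hρ k r hr0 _ (hmemI l hl.le) (lt_of_le_of_lt ?_ (hN1 k)) x
        rw [abs_of_nonneg (sub_nonneg.2 hrI.1), ← hdiff l]
        exact sub_le_sub_right hrI.2 _
      have h2 := abs_sub_le (V k (r, x)) (p k (r, x)) (p k ((l : ℝ) / N, x))
      have h3 : W l (firstCoords K x) k = p k ((l : ℝ) / N, x) := (hPp k _ x).symm
      rw [h3]
      simp only [G]
      have h4 := hc k
      have h5 := hc1 k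
      have h6 := mul_le_mul_of_nonneg_left h2 h4
      have h7 : c k * |p k (r, x) - p k ((l : ℝ) / N, x)| ≤ 1 * δ :=
        mul_le_mul h5 h1 (abs_nonneg _) zero_le_one
      linarith
  have hsum : ∑ l ∈ Finset.range (H * N), κ l ≤ 2 * ε := by
    refine (Finset.sum_le_sum fun l hl => hκ l (Finset.mem_range.1 hl)).trans ?_
    rw [intervalIntegral.sum_integral_adjacent_intervals (a := fun l : ℕ => (l : ℝ) / N)
      (fun l hl => hgl l hl)]
    have e1 : ((H * N : ℕ) : ℝ) / N = H := by
      push_cast; field_simp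
    simp only [Nat.cast_zero, zero_div, e1]
    rw [intervalIntegral.integral_of_le (Nat.cast_nonneg H), ← integral_Icc_eq_integral_Ioc]
    have e2 : ∫ r in Icc 0 (H : ℝ), g r = ∫ y, ∑ k, G k y ∂(volume.restrict (Icc 0 (H : ℝ)) ⊗ₘ ν) :=
      (Measure.integral_compProd hGi).symm
    rw [e2, integral_finsetSum _ fun k _ => hGki k]
    have e3 : ∀ k : Fin K, ∫ y, G k y ∂(volume.restrict (Icc 0 (H : ℝ)) ⊗ₘ ν) =
        c k * ∫ y, |V k y - p k y| ∂(volume.restrict (Icc 0 (H : ℝ)) ⊗ₘ ν) + H * δ +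
        1 / N * L * ∫ r in (0 : ℝ)..H, ∫ x, |V k (r, x)| ∂(ν r) := by
      intro k
      simp only [G]
      have h1 : Integrable (fun y => c k * |V k y - p k y| + δ)
          (volume.restrict (Icc 0 (H : ℝ)) ⊗ₘ ν) := ((hVpi k).const_mul _).add (integrable_const _)
      rw [integral_add h1 ((hVi k).abs.const_mul _), integral_add ((hVpi k).const_mul _) (integrable_const _),
        integral_const_mul, integral_const_mul, integral_const, smul_eq_mul,
        Measure.integral_compProd (hVi k).abs, intervalIntegral.integral_of_le (Nat.cast_nonneg H),
        integral_Icc_eq_integral_Ioc]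
      congr 2
      congr 1
      simp [Measure.real, Measure.compProd_apply_univ]
    simp only [e3]
    rw [Finset.sum_add_distrib, Finset.sum_add_distrib, sum_fin_indicator_mul hjK
      (fun k => ∫ y, |V k y - p k y| ∂(volume.restrict (Icc 0 (H : ℝ)) ⊗ₘ ν)),
      ← Finset.mul_sum (a := 1 / (N : ℝ) * L), Finset.sum_const, Finset.card_univ,
      Fintype.card_fin, nsmul_eq_mul]
    have : 1 / (N : ℝ) * L * I ≤ ε / 2 := by linarith
    have h1 : (K : ℝ) * (H * δ) ≤ ε / 2 := by rwa [← mul_assoc]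
    refine (add_le_add (add_le_add hpV h1) this).trans (le_of_eq ?_)
    ring
  refine le_trans ?_ (hcost.trans hsum)
  refine integral_mono (integrable_of_continuous _ (continuous_eulerDefect (hpc k) _ _ _))
    (integrable_of_continuous _ (by fun_prop)) fun ω => ?_
  refine Finset.sum_le_sum fun l _ => ?_
  have := Finset.single_le_sum (f := fun k : Fin K => c k *
    |firstCoords K (ω (((l + 1 : ℕ) : ℚ) / N)) k - (firstCoords K (ω ((l : ℚ) / N)) +
      (1 / N : ℝ) • W l (firstCoords K (ω ((l : ℚ) / N)))) k|)
    (fun k _ => mul_nonneg (hc k) (abs_nonneg _)) (Finset.mem_univ (⟨k, hk.trans_le hjK⟩ : Fin K))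
  refine le_trans (le_of_eq ?_) this
  have h3 : W l (firstCoords K (ω ((l : ℚ) / N))) ⟨k, hk.trans_le hjK⟩ =
      p k ((l : ℝ) / N, ω ((l : ℚ) / N)) := (hPp k _ _).symm
  simp only [c, if_pos hk, one_mul, Pi.add_apply, Pi.smul_apply, h3, smul_eq_mul, firstCoords,
    sub_sub]

theorem eventually_abs_riemann_sub_le {f : ℝ → ℝ} (hf : Continuous f) (H : ℕ) {ε : ℝ}
    (hε : 0 < ε) : ∀ᶠ N : ℕ in atTop, ∀ n ≤ H * N,
      |1 / (N : ℝ) * ∑ l ∈ Finset.range n, f ((l : ℝ) / N) - ∫ r in (0 : ℝ)..(n : ℝ) / N, f r| ≤ ε := by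
  have hδ : 0 < ε / (H + 1) := by positivity
  have hu : UniformContinuousOn f (Icc 0 H) := isCompact_Icc.uniformContinuousOn_of_continuous
    hf.continuousOn
  obtain ⟨ρ, hρ, hρf⟩ := Metric.uniformContinuousOn_iff.1 hu _ hδ
  filter_upwards [eventually_gt_atTop 0,
    (tendsto_one_div_atTop_nhds_zero_nat (𝕜 := ℝ)).eventually_lt_const hρ] with N hN hNρ n hn
  have hNR : (0 : ℝ) < N := by exact_mod_cast hN
  have hmemI : ∀ l ≤ H * N, (l : ℝ) / N ∈ Icc (0 : ℝ) H := fun l hl => by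
    refine ⟨by positivity, ?_⟩
    rw [div_le_iff₀ hNR]
    exact_mod_cast hl
  have hdiff : ∀ l : ℕ, ((l + 1 : ℕ) : ℝ) / N - (l : ℝ) / N = 1 / N := fun l => by
    push_cast; ring
  have hle : ∀ l : ℕ, (l : ℝ) / N ≤ ((l + 1 : ℕ) : ℝ) / N := fun l => by
    have := hdiff l
    have h2 : (0 : ℝ) < 1 / N := by positivity
    linarith
  have h0 := intervalIntegral.sum_integral_adjacent_intervals (f := f) (μ := volume)
    (a := fun l : ℕ => (l : ℝ) / N) (n := n) (fun l _ => hf.intervalIntegrable _ _)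
  simp only [Nat.cast_zero, zero_div] at h0
  rw [← h0, Finset.mul_sum, ← Finset.sum_sub_distrib]
  refine (Finset.abs_sum_le_sum_abs _ _).trans ?_
  have h1 : ∀ l ∈ Finset.range n, |1 / (N : ℝ) * f ((l : ℝ) / N) -
      ∫ r in ((l : ℝ) / N)..(((l + 1 : ℕ) : ℝ) / N), f r| ≤ ε / (H + 1) * (1 / N) := by
    intro l hl
    have hl' := (Finset.mem_range.1 hl).trans_le hn
    have e : 1 / (N : ℝ) * f ((l : ℝ) / N) =
        ∫ r in ((l : ℝ) / N)..(((l + 1 : ℕ) : ℝ) / N), f ((l : ℝ) / N) := by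
      rw [intervalIntegral.integral_const, hdiff, smul_eq_mul]
    rw [e, ← intervalIntegral.integral_sub (by simp) (hf.intervalIntegrable _ _)]
    have := intervalIntegral.norm_integral_le_of_norm_le_const (a := (l : ℝ) / N)
      (b := ((l + 1 : ℕ) : ℝ) / N) (C := ε / (H + 1)) (f := fun r => f ((l : ℝ) / N) - f r)
      (fun r hr => by
        rw [uIoc_of_le (hle l)] at hr
        rw [← dist_eq_norm]
        refine (hρf _ (hmemI l hl'.le) r ⟨(hmemI l hl'.le).1.trans hr.1.le,
          hr.2.trans (hmemI (l + 1) hl').2⟩ ?_).le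
        rw [dist_comm, Real.dist_eq, abs_of_nonneg (sub_nonneg.2 hr.1.le)]
        refine lt_of_le_of_lt ?_ hNρ
        rw [← hdiff l]
        exact sub_le_sub_right hr.2 _)
    rwa [hdiff, abs_of_pos (a := 1 / (N : ℝ)) (by positivity)] at this
  refine (Finset.sum_le_sum h1).trans ?_
  rw [Finset.sum_const, Finset.card_range, nsmul_eq_mul]
  have h2 := (hmemI n hn).2
  calc (n : ℝ) * (ε / (H + 1) * (1 / N)) = (n / N) * (ε / (H + 1)) := by ring
    _ ≤ H * (ε / (H + 1)) := mul_le_mul_of_nonneg_right h2 hδ.le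
    _ ≤ ε := by
      rw [mul_div_assoc', div_le_iff₀ (by positivity)]
      nlinarith

theorem WeakFlow.continuous_integral_time {ν : Kernel ℝ HCube} [IsMarkovKernel ν]
    {V : ℕ → ℝ × HCube → ℝ} (hf : WeakFlow ν V) {G : ℝ × HCube → ℝ} (hG : Continuous G) :
    Continuous fun t => ∫ x, G (t, x) ∂(ν t) := by
  let F : ℝ → C(HCube, ℝ) := fun t => ⟨fun x => G (t, x), by fun_prop⟩
  have hF : Continuous F := ContinuousMap.continuous_of_continuous_uncurry _ (by
      simp only [Function.uncurry_def, ContinuousMap.coe_mk, F]; fun_prop)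
  rw [continuous_iff_continuousAt]
  intro t₀
  have h1 := (hf.cont (F t₀)).tendsto t₀
  have h2 : Tendsto (fun t => ∫ x, G (t, x) ∂(ν t) - ∫ x, G (t₀, x) ∂(ν t)) (𝓝 t₀) (𝓝 0) := by
    have h3 : Tendsto (fun t => dist (F t) (F t₀)) (𝓝 t₀) (𝓝 0) :=
      tendsto_iff_dist_tendsto_zero.1 (hF.tendsto t₀)
    refine squeeze_zero_norm (fun t => ?_) h3
    rw [← integral_sub (integrable_of_continuous _ (by fun_prop))
      (integrable_of_continuous _ (by fun_prop))]
    have := norm_integral_le_of_norm_le_const (μ := ν t) (C := dist (F t) (F t₀))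
      (f := fun x => G (t, x) - G (t₀, x)) (ae_of_all _ fun x => by
        rw [← dist_eq_norm]
        exact ContinuousMap.dist_apply_le_dist (f := F t) (g := F t₀) x)
    simpa using this
  have := h2.add h1
  simpa [F, ContinuousAt] using this

/-- The defect with respect to one velocity is controlled by the defect with respect to another
velocity and the mean difference of the velocities. -/
theorem eulerDefect_le_add (p p' : ℝ × HCube → ℝ) (k N n : ℕ) (ω : ℚ → HCube) :
    eulerDefect p k N n ω ≤ eulerDefect p' k N n ω + 1 / (N : ℝ) * ∑ l ∈ Finset.range n,
      |p' ((l : ℝ) / N, ω ((l : ℚ) / N)) - p ((l : ℝ) / N, ω ((l : ℚ) / N))| := by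
  unfold eulerDefect
  rw [Finset.mul_sum, ← Finset.sum_add_distrib]
  refine Finset.sum_le_sum fun l _ => ?_
  set A := (ω (((l + 1 : ℕ) : ℚ) / N) k : ℝ) - ω ((l : ℚ) / N) k
  set u := p ((l : ℝ) / N, ω ((l : ℚ) / N))
  set u' := p' ((l : ℝ) / N, ω ((l : ℚ) / N))
  have h1 : 1 / (N : ℝ) * |u' - u| = |1 / (N : ℝ) * u' - 1 / (N : ℝ) * u| := by
    rw [← mul_sub, abs_mul, abs_of_nonneg (a := 1 / (N : ℝ)) (by positivity)]
  rw [h1]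
  have := abs_add_le (A - 1 / (N : ℝ) * u') (1 / (N : ℝ) * u' - 1 / (N : ℝ) * u)
  simpa using this

theorem WeakFlow.eventually_exists_chain_le {ν : Kernel ℝ HCube} [IsMarkovKernel ν]
    {V : ℕ → ℝ × HCube → ℝ} (hf : WeakFlow ν V) (H : ℕ) {K : ℕ → ℕ} (hK : ∀ i, i ≤ K i)
    {p : ℕ → ℕ → ℝ × HCube → ℝ} (hp : ∀ i k, IsCylinder (K i) (p i k))
    (hpV : ∀ i, ∑ k ∈ Finset.range i,
      ∫ y, |V k y - p i k y| ∂(volume.restrict (Icc 0 (H : ℝ)) ⊗ₘ ν) ≤ (1 / 2) ^ i) (j : ℕ) :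
    ∀ᶠ N : ℕ in atTop, ∃ μ : Measure (ℚ → HCube), IsProbabilityMeasure μ ∧
      (∀ i ≤ H * N, ∀ F : C(HCube, ℝ), ∫ ω, F (ω ((i : ℚ) / N)) ∂μ = ∫ x, F x ∂(ν ((i : ℝ) / N))) ∧
      ∀ i ≤ j, ∀ k < i, ∫ ω, eulerDefect (p i k) k N (H * N) ω ∂μ ≤ 5 * (1 / 2) ^ i := by
  have hpc := fun i k => (hp i k).continuous
  have hεj : (0 : ℝ) < (1 / 2) ^ j := by positivity
  let f : ℕ → ℕ → ℝ → ℝ := fun i k t => ∫ x, |p j k (t, x) - p i k (t, x)| ∂(ν t)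
  have hfc : ∀ i k, Continuous (f i k) := fun i k => hf.continuous_integral_time
    (G := fun y => |p j k y - p i k y|) (by have := hpc j k; have := hpc i k; fun_prop)
  have hR : ∀ᶠ N : ℕ in atTop, ∀ i : Fin (j + 1), ∀ k : Fin (j + 1), ∀ n ≤ H * N,
      |1 / (N : ℝ) * ∑ l ∈ Finset.range n, f i k ((l : ℝ) / N) -
        ∫ r in (0 : ℝ)..(n : ℝ) / N, f i k r| ≤ (1 / 2) ^ j := by
    rw [eventually_all]; intro i
    rw [eventually_all]; intro k
    exact eventually_abs_riemann_sub_le (hfc i k) H hεj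
  filter_upwards [hf.eventually_exists_chain H (hK j) (hp j) hεj (hpV j), hR,
    eventually_gt_atTop 0] with N ⟨μ, hμ, hmarg, hdef⟩ hRN hN
  refine ⟨μ, hμ, hmarg, fun i hij k hki => ?_⟩
  have hkj : k < j := hki.trans_le hij
  have hsingle : ∀ i, k < i → ∫ y, |V k y - p i k y| ∂(volume.restrict (Icc 0 (H : ℝ)) ⊗ₘ ν) ≤
      (1 / 2) ^ i := fun i hi => (Finset.single_le_sum
    (f := fun k => ∫ y, |V k y - p i k y| ∂(volume.restrict (Icc 0 (H : ℝ)) ⊗ₘ ν))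
    (fun k _ => integral_nonneg fun y => abs_nonneg _) (Finset.mem_range.2 hi)).trans (hpV i)
  have hpow : ((1 : ℝ) / 2) ^ j ≤ (1 / 2) ^ i :=
    pow_le_pow_of_le_one (by norm_num) (by norm_num) hij
  have hint : ∫ r in (0 : ℝ)..H, f i k r ≤ (1 / 2) ^ j + (1 / 2) ^ i := by
    have hVi : Integrable (V k) (volume.restrict (Icc 0 (H : ℝ)) ⊗ₘ ν) :=
      integrable_restrict_compProd (hf.meas k) _ (hf.integrable k)
    have hpi : ∀ i, Integrable (p i k) (volume.restrict (Icc 0 (H : ℝ)) ⊗ₘ ν) := fun i =>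
      integrable_compProd_of_continuous (hpc i k) 0 H
    have hab : Integrable (fun y => |p j k y - p i k y|)
      (volume.restrict (Icc 0 (H : ℝ)) ⊗ₘ ν) := ((hpi j).sub (hpi i)).abs
    have habs : ∀ i, Integrable (fun y => |V k y - p i k y|)
      (volume.restrict (Icc 0 (H : ℝ)) ⊗ₘ ν) := fun i => (hVi.sub (hpi i)).abs
    rw [intervalIntegral.integral_of_le (Nat.cast_nonneg H), ← integral_Icc_eq_integral_Ioc]
    have e : ∫ r in Icc 0 (H : ℝ), f i k r =
        ∫ y, |p j k y - p i k y| ∂(volume.restrict (Icc 0 (H : ℝ)) ⊗ₘ ν) :=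
      (Measure.integral_compProd hab).symm
    rw [e]
    refine le_trans ?_ (add_le_add (hsingle j hkj) (hsingle i hki))
    rw [← integral_add (habs j) (habs i)]
    refine integral_mono hab ((habs j).add (habs i)) fun y => ?_
    have := abs_sub_le (p j k y) (V k y) (p i k y)
    rw [abs_sub_comm (p j k y) (V k y)] at this
    exact this
  have hNR : (0 : ℝ) < N := by exact_mod_cast hN
  have hr := (abs_le.1 (hRN ⟨i, by omega⟩ ⟨k, by omega⟩ (H * N) le_rfl)).2
  have e1 : ((H * N : ℕ) : ℝ) / N = H := by
    push_cast; field_simp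
  simp only [e1] at hr
  have hg : ∀ l : ℕ, Continuous fun ω : ℚ → HCube =>
      |p j k ((l : ℝ) / N, ω ((l : ℚ) / N)) - p i k ((l : ℝ) / N, ω ((l : ℚ) / N))| := fun l => by
    have := hpc j k
    have := hpc i k
    fun_prop
  have hmain : ∫ ω, eulerDefect (p i k) k N (H * N) ω ∂μ ≤
      ∫ ω, eulerDefect (p j k) k N (H * N) ω ∂μ +
        1 / (N : ℝ) * ∑ l ∈ Finset.range (H * N), f i k ((l : ℝ) / N) := by
    have e2 : ∀ l ∈ Finset.range (H * N), f i k ((l : ℝ) / N) = ∫ ω : ℚ → HCube,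
        |p j k ((l : ℝ) / N, ω ((l : ℚ) / N)) - p i k ((l : ℝ) / N, ω ((l : ℚ) / N))| ∂μ := by
      intro l hl
      exact (hmarg l (Finset.mem_range.1 hl).le ⟨fun x =>
        |p j k ((l : ℝ) / N, x) - p i k ((l : ℝ) / N, x)|, by
          have := hpc j k
          have := hpc i k
          fun_prop⟩).symm
    rw [Finset.sum_congr rfl e2, ← integral_finsetSum _ fun l _ => integrable_of_continuous _ (hg l),
      ← integral_const_mul, ← integral_add (integrable_of_continuous _
        (continuous_eulerDefect (hpc j k) _ _ _)) (integrable_of_continuous _ (by fun_prop))]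
    refine integral_mono (integrable_of_continuous _ (continuous_eulerDefect (hpc i k) _ _ _))
      (integrable_of_continuous _ ((continuous_eulerDefect (hpc j k) _ _ _).add (by fun_prop)))
      fun ω => eulerDefect_le_add _ _ _ _ _ _
  have := hdef k hkj
  linarith

theorem exists_cluster_probability {B : Type*} [TopologicalSpace B] [CompactSpace B] [T2Space B]
    [MeasurableSpace B] [BorelSpace B] [SecondCountableTopology B] (μ : ℕ → Measure B)
    [∀ j, IsProbabilityMeasure (μ j)] : ∃ η : Measure B, IsProbabilityMeasure η ∧
      ∀ (Φ : C(B, ℝ)) (C : ℝ), (∀ᶠ j in atTop, ∫ ω, Φ ω ∂(μ j) ≤ C) → ∫ ω, Φ ω ∂η ≤ C := by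
  let m : ℕ → ProbabilityMeasure B := fun j => ⟨μ j, inferInstance⟩
  obtain ⟨η, hη⟩ := exists_clusterPt_of_compactSpace (map m atTop)
  refine ⟨η, inferInstance, fun Φ C h => ?_⟩
  have hc : Continuous fun η : ProbabilityMeasure B => ∫ ω, Φ ω ∂(η : Measure B) :=
    ProbabilityMeasure.continuous_integral_boundedContinuousFunction
      (BoundedContinuousFunction.mkOfCompact Φ)
  have hcl : IsClosed {η : ProbabilityMeasure B | ∫ ω, Φ ω ∂(η : Measure B) ≤ C} :=
    isClosed_le hc continuous_const
  have : η ∈ closure {η : ProbabilityMeasure B | ∫ ω, Φ ω ∂(η : Measure B) ≤ C} :=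
    hη.mem_closure_of_mem _ (by
      rw [mem_map]
      exact h)
  rwa [hcl.closure_eq] at this

theorem WeakFlow.exists_limit {ν : Kernel ℝ HCube} [IsMarkovKernel ν]
    {V : ℕ → ℝ × HCube → ℝ} (hf : WeakFlow ν V) (H : ℕ) {K : ℕ → ℕ} (hK : ∀ i, i ≤ K i)
    {p : ℕ → ℕ → ℝ × HCube → ℝ} (hp : ∀ i k, IsCylinder (K i) (p i k))
    (hpV : ∀ i, ∑ k ∈ Finset.range i,
      ∫ y, |V k y - p i k y| ∂(volume.restrict (Icc 0 (H : ℝ)) ⊗ₘ ν) ≤ (1 / 2) ^ i) :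
    ∃ η : Measure (ℚ → HCube), IsProbabilityMeasure η ∧
      (∀ q : ℚ, 0 ≤ q → q ≤ H → ∀ F : C(HCube, ℝ), ∫ ω, F (ω q) ∂η = ∫ x, F x ∂(ν q)) ∧
      ∀ (Φ : C(ℚ → HCube, ℝ)) (s : Finset (ℕ × ℕ)) (α : ℕ × ℕ → ℝ) (C : ℝ) (n₀ : ℕ),
        (∀ y ∈ s, y.2 < y.1) → (∀ y ∈ s, 0 ≤ α y) → 0 < n₀ →
        (∀ N, n₀ ∣ N → 0 < N → ∀ ω,
          Φ ω ≤ C + ∑ y ∈ s, α y * eulerDefect (p y.1 y.2) y.2 N (H * N) ω) →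
        ∫ ω, Φ ω ∂η ≤ C + ∑ y ∈ s, α y * (5 * (1 / 2) ^ y.1) := by
  have hpc := fun i k => (hp i k).continuous
  have hlev : ∀ j : ℕ, ∃ N : ℕ, 0 < N ∧ j.factorial ∣ N ∧
      ∃ μ : Measure (ℚ → HCube), IsProbabilityMeasure μ ∧
      (∀ i ≤ H * N, ∀ F : C(HCube, ℝ), ∫ ω, F (ω ((i : ℚ) / N)) ∂μ = ∫ x, F x ∂(ν ((i : ℝ) / N))) ∧
      ∀ i ≤ j, ∀ k < i, ∫ ω, eulerDefect (p i k) k N (H * N) ω ∂μ ≤ 5 * (1 / 2) ^ i := by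
    intro j
    obtain ⟨N₀, hN₀⟩ := eventually_atTop.1 (hf.eventually_exists_chain_le H hK hp hpV j)
    refine ⟨(max N₀ j).factorial, Nat.factorial_pos _, Nat.factorial_dvd_factorial
      (le_max_right _ _), hN₀ _ ((le_max_left _ _).trans (Nat.self_le_factorial _))⟩
  choose N hN0 hNj μ hμ hmarg hdef using hlev
  obtain ⟨η, hη, hlim⟩ := exists_cluster_probability μ
  refine ⟨η, hη, fun q hq0 hqH F => ?_, fun Φ s α C n₀ hs hα hn₀ hΦ => ?_⟩
  · have hev : ∀ᶠ j in atTop, ∫ ω, F (ω q) ∂(μ j) = ∫ x, F x ∂(ν q) := by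
      filter_upwards [eventually_ge_atTop q.den] with j hj
      have hd : q.den ∣ N j := (Nat.dvd_factorial q.den_pos hj).trans (hNj j)
      obtain ⟨e, he⟩ := hd
      have hNQ : (N j : ℚ) ≠ 0 := by exact_mod_cast (hN0 j).ne'
      have hq : q = ((q.num.toNat * e : ℕ) : ℚ) / N j := by
        rw [eq_div_iff hNQ, he]
        have h1 : ((q.num.toNat : ℕ) : ℚ) = q.num := by
          exact_mod_cast Int.toNat_of_nonneg (Rat.num_nonneg.2 hq0)
        push_cast
        rw [h1, ← mul_assoc, Rat.mul_den_eq_num]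
      have hle : q.num.toNat * e ≤ H * N j := by
        have : ((q.num.toNat * e : ℕ) : ℚ) / N j ≤ H := hq ▸ hqH
        rw [div_le_iff₀ (by exact_mod_cast hN0 j)] at this
        exact_mod_cast this
      have := hmarg j _ hle F
      rw [← hq] at this
      have hqR : ((q.num.toNat * e : ℕ) : ℝ) / N j = q := by
        have := congrArg (fun z : ℚ => (z : ℝ)) hq
        push_cast at this ⊢
        exact this.symm
      rw [this, hqR]
    apply le_antisymm
    · exact hlim ⟨fun ω => F (ω q), by fun_prop⟩ _ (hev.mono fun j hj => hj.le)
    · have := hlim ⟨fun ω => -F (ω q), by fun_prop⟩ (-∫ x, F x ∂(ν q)) (hev.mono fun j hj => by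
        simp only [ContinuousMap.coe_mk, integral_neg, hj, le_refl])
      simp only [ContinuousMap.coe_mk, integral_neg] at this
      linarith
  · refine hlim Φ _ ?_
    filter_upwards [eventually_ge_atTop n₀, eventually_ge_atTop (s.sup Prod.fst)] with j hj1 hj2
    have hd := hΦ (N j) ((Nat.dvd_factorial hn₀ hj1).trans (hNj j)) (hN0 j)
    have hdi : ∀ y : ℕ × ℕ, Integrable (eulerDefect (p y.1 y.2) y.2 (N j) (H * N j)) (μ j) := fun y =>
      integrable_of_continuous _ (continuous_eulerDefect (hpc y.1 y.2) _ _ _)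
    calc ∫ ω, Φ ω ∂(μ j) ≤ ∫ ω, (C + ∑ y ∈ s, α y *
          eulerDefect (p y.1 y.2) y.2 (N j) (H * N j) ω) ∂(μ j) :=
          integral_mono (integrable_of_continuous _ Φ.continuous)
            ((integrable_const _).add (integrable_finsetSum _ fun y _ => (hdi y).const_mul _)) hd
      _ = C + ∑ y ∈ s, α y * ∫ ω, eulerDefect (p y.1 y.2) y.2 (N j) (H * N j) ω ∂(μ j) := by
          rw [integral_add (integrable_const _) (integrable_finsetSum _ fun y _ =>
            (hdi y).const_mul _), integral_finsetSum _ fun y _ => (hdi y).const_mul _]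
          simp [integral_const_mul]
      _ ≤ _ := by
          refine add_le_add le_rfl (Finset.sum_le_sum fun y hy => ?_)
          exact mul_le_mul_of_nonneg_left (hdef j _ ((Finset.le_sup (f := Prod.fst) hy).trans hj2)
            _ (hs y hy)) (hα y hy)

theorem abs_sub_sub_riemann_le_eulerDefect (p : ℝ × HCube → ℝ) (k N L : ℕ) (ω : ℚ → HCube)
    {m n : ℕ} (hmn : m ≤ n) (hn : n ≤ L) :
    |(ω ((n : ℚ) / N) k : ℝ) - ω ((m : ℚ) / N) k -
      (1 / N : ℝ) * ∑ l ∈ Finset.Ico m n, p ((l : ℝ) / N, ω ((l : ℚ) / N))| ≤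
      eulerDefect p k N L ω := by
  have h1 : (ω ((n : ℚ) / N) k : ℝ) - ω ((m : ℚ) / N) k =
      ∑ l ∈ Finset.Ico m n, ((ω (((l + 1 : ℕ) : ℚ) / N) k : ℝ) - ω ((l : ℚ) / N) k) :=
    (Finset.sum_Ico_sub (fun l : ℕ => (ω ((l : ℚ) / N) k : ℝ)) hmn).symm
  rw [h1, Finset.mul_sum, ← Finset.sum_sub_distrib]
  refine (Finset.abs_sum_le_sum_abs _ _).trans ?_
  unfold eulerDefect
  refine Finset.sum_le_sum_of_subset_of_nonneg (fun l hl => ?_) (fun _ _ _ => abs_nonneg _)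
  simp only [Finset.mem_Ico, Finset.mem_range] at hl ⊢
  omega

theorem exists_natCast_div_eq {q : ℚ} (hq0 : 0 ≤ q) {H N : ℕ} (hqH : q ≤ H) (hN : 0 < N)
    (hd : q.den ∣ N) : ∃ n : ℕ, n ≤ H * N ∧ (n : ℚ) / N = q ∧ (n : ℝ) / N = q := by
  obtain ⟨e, he⟩ := hd
  have hNQ : (N : ℚ) ≠ 0 := by exact_mod_cast hN.ne'
  have hq : ((q.num.toNat * e : ℕ) : ℚ) / N = q := by
    rw [div_eq_iff hNQ, he]
    have h1 : ((q.num.toNat : ℕ) : ℚ) = q.num := by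
      exact_mod_cast Int.toNat_of_nonneg (Rat.num_nonneg.2 hq0)
    push_cast
    rw [h1, ← mul_assoc, Rat.mul_den_eq_num]
  refine ⟨q.num.toNat * e, ?_, hq, ?_⟩
  · have : ((q.num.toNat * e : ℕ) : ℚ) / N ≤ H := by rw [hq]; exact hqH
    rw [div_le_iff₀ (by exact_mod_cast hN)] at this
    exact_mod_cast this
  · have := congrArg (fun z : ℚ => (z : ℝ)) hq
    push_cast at this ⊢
    exact this

theorem abs_sub_le_eulerDefect_add {p : ℝ × HCube → ℝ} {H : ℕ} {M : ℝ}
    (hM : ∀ r ∈ Icc (0 : ℝ) H, ∀ x, |p (r, x)| ≤ M) (k : ℕ) {N : ℕ} (hN : 0 < N) (ω : ℚ → HCube)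
    {s t : ℚ} (hs0 : 0 ≤ s) (hsH : s ≤ H) (ht0 : 0 ≤ t) (htH : t ≤ H) (hsN : s.den ∣ N)
    (htN : t.den ∣ N) :
    |(ω t k : ℝ) - ω s k| ≤ eulerDefect p k N (H * N) ω + M * |(t : ℝ) - s| := by
  wlog hst : s ≤ t generalizing s t
  · rw [abs_sub_comm, abs_sub_comm (t : ℝ)]
    exact this ht0 htH hs0 hsH htN hsN (le_of_not_ge hst)
  obtain ⟨m, hm, hms, hmsR⟩ := exists_natCast_div_eq hs0 hsH hN hsN
  obtain ⟨n, hn, hnt, hntR⟩ := exists_natCast_div_eq ht0 htH hN htN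
  have hNR : (0 : ℝ) < N := by exact_mod_cast hN
  have hmn : m ≤ n := by
    have hNQ : (0 : ℚ) < N := by exact_mod_cast hN
    have : (m : ℚ) / N ≤ n / N := by rw [hms, hnt]; exact hst
    exact_mod_cast (div_le_div_iff_of_pos_right hNQ).1 this
  have h := abs_sub_sub_riemann_le_eulerDefect p k N (H * N) ω hmn hn
  rw [hms, hnt] at h
  have h2 : |(1 / N : ℝ) * ∑ l ∈ Finset.Ico m n, p ((l : ℝ) / N, ω ((l : ℚ) / N))| ≤
      M * |(t : ℝ) - s| := by
    rw [abs_mul, abs_of_pos (by positivity : (0 : ℝ) < 1 / N)]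
    calc (1 / N : ℝ) * |∑ l ∈ Finset.Ico m n, p ((l : ℝ) / N, ω ((l : ℚ) / N))|
        ≤ (1 / N : ℝ) * ((Finset.Ico m n).card • M) := by
          refine mul_le_mul_of_nonneg_left ((Finset.abs_sum_le_sum_abs _ _).trans
            (Finset.sum_le_card_nsmul _ _ _ fun l hl => hM _ ⟨by positivity, ?_⟩ _)) (by positivity)
          rw [Finset.mem_Ico] at hl
          rw [div_le_iff₀ hNR]
          exact_mod_cast (hl.2.le.trans hn)
      _ = M * |(t : ℝ) - s| := by
          rw [← hmsR, ← hntR, ← sub_div, abs_of_nonneg (div_nonneg (sub_nonneg.2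
            (by exact_mod_cast hmn)) hNR.le), Nat.card_Ico, nsmul_eq_mul, Nat.cast_sub hmn]
          ring
  calc |(ω t k : ℝ) - ω s k| = |((ω t k : ℝ) - ω s k -
        (1 / N : ℝ) * ∑ l ∈ Finset.Ico m n, p ((l : ℝ) / N, ω ((l : ℚ) / N))) +
        (1 / N : ℝ) * ∑ l ∈ Finset.Ico m n, p ((l : ℝ) / N, ω ((l : ℚ) / N))| := by
        congr 1; ring
    _ ≤ _ := (abs_add_le _ _).trans (add_le_add h h2)

theorem lintegral_iSup_toNNReal_le {B : Type*} [TopologicalSpace B] [CompactSpace B]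
    [MeasurableSpace B] [BorelSpace B] {η : Measure B} [IsProbabilityMeasure η]
    {ι : Type*} [Countable ι] {g : ι → B → ℝ} (hg : ∀ y, Continuous (g y)) {c : ℝ}
    (h : ∀ S : Finset ι, ∫ ω, ((S.sup fun y => (g y ω).toNNReal : NNReal) : ℝ) ∂η ≤ c) :
    ∫⁻ ω, ⨆ y, ENNReal.ofReal (g y ω) ∂η ≤ ENNReal.ofReal c := by
  classical
  have hcont : ∀ S : Finset ι, Continuous fun ω => (S.sup fun y => (g y ω).toNNReal : NNReal) := by
    intro S
    exact Continuous.finset_sup_apply fun y _ => continuous_real_toNNReal.comp (hg y)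
  have heq : ∀ ω, ⨆ y, ENNReal.ofReal (g y ω) =
      ⨆ S : Finset ι, ((S.sup fun y => (g y ω).toNNReal : NNReal) : ENNReal) := by
    intro ω
    rw [iSup_eq_iSup_finset]
    congr 1; ext1 S
    rw [ENNReal.coe_finset_sup, Finset.sup_eq_iSup]
    rfl
  simp_rw [heq]
  rw [lintegral_iSup_directed (fun S => (hcont S).measurable.coe_nnreal_ennreal.aemeasurable)]
  · refine iSup_le fun S => ?_
    have hi : Integrable (fun ω => ((S.sup fun y => (g y ω).toNNReal : NNReal) : ℝ)) η :=
      integrable_of_continuous _ (NNReal.continuous_coe.comp (hcont S))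
    have := ofReal_integral_eq_lintegral_ofReal hi (ae_of_all _ fun ω => NNReal.coe_nonneg _)
    simp only [ENNReal.ofReal_coe_nnreal] at this
    rw [← this]
    exact ENNReal.ofReal_le_ofReal (h S)
  · intro S S'
    refine ⟨S ∪ S', fun ω => ?_, fun ω => ?_⟩
    · exact ENNReal.coe_le_coe.2 (Finset.sup_mono Finset.subset_union_left)
    · exact ENNReal.coe_le_coe.2 (Finset.sup_mono Finset.subset_union_right)

/-- A path on the nonnegative rationals bounded by `H` is almost Lipschitz if each of its
coordinates is Lipschitz up to an arbitrarily small additive error. -/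
def AlmostLipschitz (H : ℕ) (ω : ℚ → HCube) : Prop :=
  ∀ k, ∀ ε > 0, ∃ M : ℝ, 0 ≤ M ∧ ∀ s t : ℚ, 0 ≤ s → s ≤ H → 0 ≤ t → t ≤ H →
    |(ω t k : ℝ) - ω s k| ≤ ε + M * |(t : ℝ) - s|

theorem ae_almostLipschitz {η : Measure (ℚ → HCube)} [IsProbabilityMeasure η] (H : ℕ)
    {p : ℕ → ℕ → ℝ × HCube → ℝ} (hpc : ∀ i k, Continuous (p i k))
    (hlim : ∀ (Φ : C(ℚ → HCube, ℝ)) (s : Finset (ℕ × ℕ)) (α : ℕ × ℕ → ℝ) (C : ℝ) (n₀ : ℕ),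
        (∀ y ∈ s, y.2 < y.1) → (∀ y ∈ s, 0 ≤ α y) → 0 < n₀ →
        (∀ N, n₀ ∣ N → 0 < N → ∀ ω,
          Φ ω ≤ C + ∑ y ∈ s, α y * eulerDefect (p y.1 y.2) y.2 N (H * N) ω) →
        ∫ ω, Φ ω ∂η ≤ C + ∑ y ∈ s, α y * (5 * (1 / 2) ^ y.1)) :
    ∀ᵐ ω ∂η, AlmostLipschitz H ω := by
  classical
  unfold AlmostLipschitz
  rw [ae_all_iff]
  intro k
  have hM : ∀ i, ∃ M : ℝ, 0 ≤ M ∧ ∀ r ∈ Icc (0 : ℝ) H, ∀ x, |p i k (r, x)| ≤ M := fun i => by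
    obtain ⟨M, hM⟩ := exists_bound_on_Icc (hpc i k) 0 H
    exact ⟨max M 0, le_max_right _ _, fun r hr x => (hM r hr x).trans (le_max_left _ _)⟩
  choose M hM0 hM using hM
  let J := {y : ℚ × ℚ // (0 ≤ y.1 ∧ y.1 ≤ H) ∧ 0 ≤ y.2 ∧ y.2 ≤ H}
  let g : ℕ → J → (ℚ → HCube) → ℝ := fun i y ω =>
    |(ω y.1.2 k : ℝ) - ω y.1.1 k| - M i * |(y.1.2 : ℝ) - y.1.1|
  have hg : ∀ i y, Continuous (g i y) := fun i y => by fun_prop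
  have hint : ∀ i, k < i → ∫⁻ ω, ⨆ y, ENNReal.ofReal (g i y ω) ∂η ≤
      ENNReal.ofReal (5 * (1 / 2) ^ i) := by
    intro i hi
    refine lintegral_iSup_toNNReal_le (hg i) fun S => ?_
    have hcont : Continuous fun ω =>
        ((S.sup fun y => (g i y ω).toNNReal : NNReal) : ℝ) :=
      NNReal.continuous_coe.comp (Continuous.finset_sup_apply fun y _ =>
        continuous_real_toNNReal.comp (hg i y))
    have := hlim ⟨_, hcont⟩ {(i, k)} 1 0 (∏ y ∈ S, y.1.1.den * y.1.2.den) (by simpa using hi)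
      (by simp) (Finset.prod_pos fun y _ => Nat.mul_pos y.1.1.den_pos y.1.2.den_pos) ?_
    · simpa using this
    · intro N hN hN0 ω
      have h0 := eulerDefect_nonneg (p i k) k N (H * N) ω
      simp only [ContinuousMap.coe_mk, Finset.sum_singleton, Pi.one_apply, one_mul, zero_add]
      rw [← NNReal.coe_mk _ h0, NNReal.coe_le_coe]
      refine Finset.sup_le fun y hy => ?_
      rw [Real.toNNReal_le_iff_le_coe, NNReal.coe_mk]
      have hd := (Finset.dvd_prod_of_mem (fun y : J => y.1.1.den * y.1.2.den) hy).trans hN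
      have := abs_sub_le_eulerDefect_add (hM i) k hN0 ω y.2.1.1 y.2.1.2 y.2.2.1 y.2.2.2
        ((Dvd.intro _ rfl).trans hd) ((Dvd.intro_left _ rfl).trans hd)
      simp only [g]
      linarith
  have hmeas : ∀ i, Measurable fun ω => ⨆ y, ENNReal.ofReal (g i y ω) := fun i =>
    Measurable.iSup fun y => (hg i y).measurable.ennreal_ofReal
  have hsum : ∫⁻ ω, ∑' i, ⨆ y, ENNReal.ofReal (g (i + (k + 1)) y ω) ∂η < ⊤ := by
    rw [lintegral_tsum fun i => (hmeas _).aemeasurable]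
    calc ∑' i, ∫⁻ ω, ⨆ y, ENNReal.ofReal (g (i + (k + 1)) y ω) ∂η
        ≤ ∑' i : ℕ, ENNReal.ofReal (5 * (1 / 2) ^ (i + (k + 1))) :=
          ENNReal.tsum_le_tsum fun i => hint _ (by omega)
      _ < ⊤ := by
          refine Summable.tsum_ofReal_lt_top ?_
          have : Summable fun i : ℕ => (5 : ℝ) * (1 / 2) ^ i :=
            (summable_geometric_two).mul_left 5
          exact (summable_nat_add_iff (f := fun i : ℕ => (5 : ℝ) * (1 / 2) ^ i) (k + 1)).2 this
  filter_upwards [ae_lt_top (Measurable.tsum fun i => hmeas _) hsum.ne] with ω hω ε hε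
  have ht := ENNReal.tendsto_atTop_zero_of_tsum_ne_top hω.ne
  obtain ⟨i, hi⟩ := ((ht.eventually (gt_mem_nhds (ENNReal.ofReal_pos.2 hε))).exists)
  refine ⟨M (i + (k + 1)), hM0 _, fun s t hs0 hsH ht0 htH => ?_⟩
  have := (le_iSup (fun y => ENNReal.ofReal (g (i + (k + 1)) y ω)) ⟨(s, t), ⟨hs0, hsH⟩, ht0, htH⟩)
    |>.trans hi.le
  rw [ENNReal.ofReal_le_ofReal_iff hε.le] at this
  simp only [g] at this
  linarith

theorem measurableSet_almostLipschitz (H : ℕ) : MeasurableSet {ω | AlmostLipschitz H ω} := by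
  have : {ω | AlmostLipschitz H ω} = ⋂ k : ℕ, ⋂ n : ℕ, ⋃ M : ℕ, ⋂ s : ℚ, ⋂ t : ℚ,
      {ω | 0 ≤ s → s ≤ H → 0 ≤ t → t ≤ H →
        |(ω t k : ℝ) - ω s k| ≤ 1 / (n + 1 : ℝ) + M * |(t : ℝ) - s|} := by
    ext ω
    simp only [mem_ofPred_eq, mem_iInter, mem_iUnion, AlmostLipschitz]
    refine forall_congr' fun k => ⟨fun h n => ?_, fun h ε hε => ?_⟩
    · obtain ⟨M, hM0, hM⟩ := h (1 / (n + 1 : ℝ)) (by positivity)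
      refine ⟨⌈M⌉₊, fun s t h1 h2 h3 h4 => (hM s t h1 h2 h3 h4).trans ?_⟩
      gcongr
      exact Nat.le_ceil M
    · obtain ⟨n, hn⟩ := exists_nat_one_div_lt hε
      obtain ⟨M, hM⟩ := h n
      refine ⟨M, by positivity, fun s t h1 h2 h3 h4 => (hM s t h1 h2 h3 h4).trans ?_⟩
      gcongr
  rw [this]
  refine MeasurableSet.iInter fun k => MeasurableSet.iInter fun n => MeasurableSet.iUnion fun M =>
    MeasurableSet.iInter fun s => MeasurableSet.iInter fun t => ?_
  by_cases h : 0 ≤ s ∧ s ≤ H ∧ 0 ≤ t ∧ t ≤ H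
  · simp only [h, forall_const]
    have hc : ∀ q : ℚ, Continuous fun ω : ℚ → HCube => (ω q k : ℝ) := fun q => by fun_prop
    exact (isClosed_le ((hc t).sub (hc s)).abs continuous_const).measurableSet
  · have : {ω : ℚ → HCube | 0 ≤ s → s ≤ H → 0 ≤ t → t ≤ H →
        |(ω t k : ℝ) - ω s k| ≤ 1 / (n + 1 : ℝ) + M * |(t : ℝ) - s|} = univ := by
      refine eq_univ_of_forall fun ω h1 h2 h3 h4 => absurd ⟨h1, h2, h3, h4⟩ h
    rw [this]
    exact MeasurableSet.univ

/-- Rational approximation of the point of `[0, H]` closest to `t`. -/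
def ratApprox (H : ℕ) (t : ℝ) (n : ℕ) : ℚ := (⌊max 0 (min t H) * n⌋₊ : ℚ) / n

theorem ratApprox_nonneg (H : ℕ) (t : ℝ) (n : ℕ) : 0 ≤ ratApprox H t n := by
  unfold ratApprox; positivity

theorem ratApprox_le (H : ℕ) (t : ℝ) (n : ℕ) : ratApprox H t n ≤ H := by
  unfold ratApprox
  rcases Nat.eq_zero_or_pos n with rfl | hn
  · simp
  rw [div_le_iff₀ (by exact_mod_cast hn)]
  have h1 : max 0 (min t H) * n ≤ (H * n : ℕ) := by
    push_cast
    refine mul_le_mul_of_nonneg_right (max_le (by positivity) (min_le_right _ _)) (by positivity)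
  exact_mod_cast Nat.floor_le_of_le h1

theorem tendsto_ratApprox (H : ℕ) (t : ℝ) :
    Tendsto (fun n => (ratApprox H t n : ℝ)) atTop (𝓝 (max 0 (min t H))) := by
  have := (tendsto_nat_floor_mul_div_atTop (R := ℝ) (a := max 0 (min t H)) (le_max_left _ _)).comp
    tendsto_natCast_atTop_atTop
  refine this.congr fun n => ?_
  simp [ratApprox]

theorem AlmostLipschitz.exists_tendsto {H : ℕ} {ω : ℚ → HCube} (h : AlmostLipschitz H ω) (t : ℝ) :
    ∃ z : HCube, Tendsto (fun n => ω (ratApprox H t n)) atTop (𝓝 z) := by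
  have : ∀ k, ∃ z : Icc (-1 : ℝ) 1, Tendsto (fun n => ω (ratApprox H t n) k) atTop (𝓝 z) := by
    intro k
    refine cauchySeq_tendsto_of_complete (Metric.cauchySeq_iff'.2 fun ε hε => ?_)
    obtain ⟨M, hM0, hM⟩ := h k (ε / 2) (by positivity)
    have hc := Metric.cauchySeq_iff'.1 (tendsto_ratApprox H t).cauchySeq (ε / 2 / (M + 1))
      (by positivity)
    obtain ⟨N, hN⟩ := hc
    refine ⟨N, fun n hn => ?_⟩
    have h1 := hN n hn
    rw [Real.dist_eq, lt_div_iff₀ (by positivity)] at h1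
    have h2 := hM (ratApprox H t N) (ratApprox H t n) (ratApprox_nonneg _ _ _)
      (ratApprox_le _ _ _) (ratApprox_nonneg _ _ _) (ratApprox_le _ _ _)
    rw [Subtype.dist_eq, Real.dist_eq]
    nlinarith [abs_nonneg ((ratApprox H t n : ℝ) - ratApprox H t N)]
  choose z hz using this
  exact ⟨z, tendsto_pi_nhds.2 hz⟩

open Classical in
/-- The continuous extension to the reals of an almost Lipschitz path on the rationals. -/
def pathExt (H : ℕ) (t : ℝ) (ω : ℚ → HCube) : HCube :=
  if h : AlmostLipschitz H ω then (h.exists_tendsto t).choose else fun _ => ⟨0, by simp⟩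

theorem AlmostLipschitz.tendsto_pathExt {H : ℕ} {ω : ℚ → HCube} (h : AlmostLipschitz H ω) (t : ℝ) :
    Tendsto (fun n => ω (ratApprox H t n)) atTop (𝓝 (pathExt H t ω)) := by
  unfold pathExt
  rw [dif_pos h]
  exact (h.exists_tendsto t).choose_spec

theorem tendsto_apply_coord {ι : Type*} {l : Filter ι} {f : ι → HCube} {z : HCube}
    (h : Tendsto f l (𝓝 z)) (k : ℕ) : Tendsto (fun n => (f n k : ℝ)) l (𝓝 (z k)) :=
  (continuous_subtype_val.tendsto _).comp ((tendsto_pi_nhds.1 h) k)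

theorem AlmostLipschitz.pathExt_le {H : ℕ} {ω : ℚ → HCube} (h : AlmostLipschitz H ω) (k : ℕ)
    {ε : ℝ} (hε : 0 < ε) : ∃ M : ℝ, 0 ≤ M ∧ ∀ s t : ℝ,
      |(pathExt H t ω k : ℝ) - pathExt H s ω k| ≤
        ε + M * |max 0 (min t H) - max 0 (min s H)| := by
  obtain ⟨M, hM0, hM⟩ := h k ε hε
  refine ⟨M, hM0, fun s t => ?_⟩
  refine le_of_tendsto_of_tendsto
    ((tendsto_apply_coord (h.tendsto_pathExt t) k).sub
      (tendsto_apply_coord (h.tendsto_pathExt s) k)).abs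
    (((tendsto_ratApprox H t).sub (tendsto_ratApprox H s)).abs.const_mul M |>.const_add ε)
    (Eventually.of_forall fun n => ?_)
  exact hM _ _ (ratApprox_nonneg _ _ _) (ratApprox_le _ _ _) (ratApprox_nonneg _ _ _)
      (ratApprox_le _ _ _)

theorem AlmostLipschitz.pathExt_ratCast {H : ℕ} {ω : ℚ → HCube} (h : AlmostLipschitz H ω) {q : ℚ}
    (hq0 : 0 ≤ q) (hqH : q ≤ H) : pathExt H q ω = ω q := by
  funext k
  apply Subtype.ext
  have hqR : max 0 (min (q : ℝ) H) = q := by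
    rw [min_eq_left (by exact_mod_cast hqH), max_eq_right (by exact_mod_cast hq0)]
  refine eq_of_abs_sub_le_all fun ε hε => ?_
  obtain ⟨M, hM0, hM⟩ := h k ε hε
  have ht := tendsto_ratApprox H q
  rw [hqR] at ht
  have h1 := (tendsto_apply_coord (h.tendsto_pathExt q) k).sub_const (ω q k : ℝ) |>.abs
  have h2 := ((ht.sub_const (q : ℝ)).abs.const_mul M).const_add ε
  simp only [sub_self, abs_zero, mul_zero, add_zero] at h2
  exact le_of_tendsto_of_tendsto h1 h2 (Eventually.of_forall fun n =>
    hM _ _ hq0 hqH (ratApprox_nonneg _ _ _) (ratApprox_le _ _ _))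

theorem continuous_pathExt (H : ℕ) (ω : ℚ → HCube) : Continuous fun t => pathExt H t ω := by
  by_cases h : AlmostLipschitz H ω
  · refine continuous_pi fun k => Continuous.subtype_mk (f := fun t => (pathExt H t ω k : ℝ)) ?_ _
    rw [Metric.continuous_iff']
    intro t ε hε
    obtain ⟨M, hM0, hM⟩ := h.pathExt_le k (half_pos hε)
    have hc : Continuous fun s : ℝ => ε / 2 + M * |max 0 (min s H) - max 0 (min t H)| := by
      fun_prop
    have := hc.tendsto t
    simp only [sub_self, abs_zero, mul_zero, add_zero] at this
    filter_upwards [this.eventually (gt_mem_nhds (half_lt_self hε))] with s hs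
    rw [Real.dist_eq]
    exact (hM t s).trans_lt hs
  · have : (fun t => pathExt H t ω) = fun _ _ => ⟨0, by simp⟩ := by
      funext t
      simp [pathExt, h]
    rw [this]
    exact continuous_const

theorem measurable_pathExt (H : ℕ) (t : ℝ) : Measurable (pathExt H t) := by
  classical
  let f : ℕ → (ℚ → HCube) → HCube := fun n ω =>
    if AlmostLipschitz H ω then ω (ratApprox H t n) else fun _ => ⟨0, by simp⟩
  have hf : ∀ n, Measurable (f n) := fun n =>
    Measurable.ite (measurableSet_almostLipschitz H) (measurable_pi_apply _) measurable_const
  refine measurable_of_tendsto_metrizable hf (tendsto_pi_nhds.2 fun ω => ?_)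
  by_cases h : AlmostLipschitz H ω
  · simpa [f, h] using h.tendsto_pathExt t
  · simp [f, h, pathExt]

theorem integral_pathExt {ν : Kernel ℝ HCube} [IsMarkovKernel ν]
    (hν : ∀ F : C(HCube, ℝ), Continuous fun t => ∫ x, F x ∂(ν t)) {H : ℕ}
    {η : Measure (ℚ → HCube)} [IsProbabilityMeasure η]
    (hη : ∀ q : ℚ, 0 ≤ q → q ≤ H → ∀ F : C(HCube, ℝ), ∫ ω, F (ω q) ∂η = ∫ x, F x ∂(ν q))
    (hL : ∀ᵐ ω ∂η, AlmostLipschitz H ω) {t : ℝ} (ht : t ∈ Icc (0 : ℝ) H) (F : C(HCube, ℝ)) :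
    ∫ ω, F (pathExt H t ω) ∂η = ∫ x, F x ∂(ν t) := by
  have h1 : Tendsto (fun n => ∫ ω, F (ω (ratApprox H t n)) ∂η) atTop
      (𝓝 (∫ ω, F (pathExt H t ω) ∂η)) := by
    refine tendsto_integral_of_dominated_convergence (fun _ => ‖F‖)
      (fun n => (by fun_prop : Continuous fun ω : ℚ → HCube =>
        F (ω (ratApprox H t n))).aestronglyMeasurable) (integrable_const _)
      (fun n => ae_of_all _ fun ω => F.norm_coe_le_norm _) ?_
    filter_upwards [hL] with ω hω
    exact (F.continuous.tendsto _).comp (hω.tendsto_pathExt t)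
  have h2 : Tendsto (fun n => ∫ ω, F (ω (ratApprox H t n)) ∂η) atTop (𝓝 (∫ x, F x ∂(ν t))) := by
    have := ((hν F).tendsto _).comp (tendsto_ratApprox H t)
    rw [min_eq_left ht.2, max_eq_right ht.1] at this
    refine this.congr fun n => ?_
    rw [hη _ (ratApprox_nonneg _ _ _) (ratApprox_le _ _ _)]
    rfl
  exact tendsto_nhds_unique h1 h2

theorem map_pathExt {ν : Kernel ℝ HCube} [IsMarkovKernel ν]
    (hν : ∀ F : C(HCube, ℝ), Continuous fun t => ∫ x, F x ∂(ν t)) {H : ℕ}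
    {η : Measure (ℚ → HCube)} [IsProbabilityMeasure η]
    (hη : ∀ q : ℚ, 0 ≤ q → q ≤ H → ∀ F : C(HCube, ℝ), ∫ ω, F (ω q) ∂η = ∫ x, F x ∂(ν q))
    (hL : ∀ᵐ ω ∂η, AlmostLipschitz H ω) {t : ℝ} (ht : t ∈ Icc (0 : ℝ) H) :
    η.map (pathExt H t) = ν t := by
  have hm := measurable_pathExt H t
  have : IsProbabilityMeasure (η.map (pathExt H t)) :=
    Measure.isProbabilityMeasure_map hm.aemeasurable
  refine ext_of_forall_integral_eq_of_IsFiniteMeasure fun F => ?_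
  rw [integral_map hm.aemeasurable F.continuous.aestronglyMeasurable]
  exact integral_pathExt hν hη hL ht ⟨F, F.continuous⟩

theorem IsCylinder.exists_lipschitz {K : ℕ} {p : ℝ × HCube → ℝ} (hp : IsCylinder K p) (H : ℝ) :
    ∃ C : ℝ, 0 ≤ C ∧ ∀ r ∈ Icc 0 H, ∀ s ∈ Icc 0 H, ∀ x y : HCube,
      |p (r, x) - p (s, y)| ≤ C * (|r - s| + ∑ k ∈ Finset.range K, |(x k : ℝ) - y k|) := by
  obtain ⟨P, hP, hPp⟩ := hp
  have hconv : Convex ℝ (Icc (0 : ℝ) H ×ˢ Icc (fun _ : Fin K => (-1 : ℝ)) 1) :=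
    (convex_Icc _ _).prod (convex_Icc _ _)
  obtain ⟨C, hC⟩ := hP.contDiffOn.exists_lipschitzOnWith one_ne_zero hconv
    (isCompact_Icc.prod isCompact_Icc)
  refine ⟨C, C.2, fun r hr s hs x y => ?_⟩
  have hmem : ∀ x : HCube, firstCoords K x ∈ Icc (fun _ : Fin K => (-1 : ℝ)) 1 := fun x =>
    ⟨fun i => (x i).2.1, fun i => (x i).2.2⟩
  have h := hC.dist_le_mul (r, firstCoords K x) ⟨hr, hmem x⟩ (s, firstCoords K y) ⟨hs, hmem y⟩
  rw [Real.dist_eq, ← hPp, ← hPp] at h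
  refine h.trans (mul_le_mul_of_nonneg_left ?_ C.2)
  have h0 : 0 ≤ ∑ k ∈ Finset.range K, |(x k : ℝ) - y k| :=
    Finset.sum_nonneg fun _ _ => abs_nonneg _
  rw [Prod.dist_eq]
  refine max_le ?_ ?_
  · simp only [Real.dist_eq]
    linarith
  · refine (dist_pi_le_iff (by positivity)).2 fun i => ?_
    have := Finset.single_le_sum (f := fun k => |(x k : ℝ) - y k|) (fun _ _ => abs_nonneg _)
      (Finset.mem_range.2 i.2)
    simp only [firstCoords, Real.dist_eq]
    have h1 := abs_nonneg (r - s)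
    linarith

theorem sum_range_mul_div (g : ℕ → ℝ) (A : ℕ) {e : ℕ} (he : 0 < e) :
    ∑ l ∈ Finset.range (A * e), g (l / e) = e * ∑ q ∈ Finset.range A, g q := by
  induction A with
  | zero => simp
  | succ A ih =>
    rw [Nat.succ_mul, Finset.sum_range_add, ih, Finset.sum_range_succ, mul_add]
    congr 1
    rw [Finset.sum_congr rfl (g := fun _ => g A), Finset.sum_const, Finset.card_range, nsmul_eq_mul]
    intro r hr
    rw [mul_comm A e, Nat.mul_add_div he, Nat.div_eq_of_lt (Finset.mem_range.1 hr), add_zero]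

/-- Comparison of a path with the Riemann sum of a velocity on a coarse grid. -/
theorem abs_sub_sub_coarse_riemann_le {p : ℝ × HCube → ℝ} {K H : ℕ} {C M : ℝ} (hC0 : 0 ≤ C)
    (hC : ∀ r ∈ Icc (0 : ℝ) H, ∀ s ∈ Icc (0 : ℝ) H, ∀ x y : HCube,
      |p (r, x) - p (s, y)| ≤ C * (|r - s| + ∑ k ∈ Finset.range K, |(x k : ℝ) - y k|))
    {p' : ℕ → ℝ × HCube → ℝ} (hM0 : 0 ≤ M)
    (hM : ∀ k < K, ∀ r ∈ Icc (0 : ℝ) H, ∀ x, |p' k (r, x)| ≤ M) (k : ℕ) {m A N : ℕ}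
    (hN : 0 < N) (hmN : m ∣ N) (hA : A ≤ H * m) (ω : ℚ → HCube) :
    |(ω ((A : ℚ) / m) k : ℝ) - ω 0 k -
      (1 / m : ℝ) * ∑ q ∈ Finset.range A, p ((q : ℝ) / m, ω ((q : ℚ) / m))| ≤
      eulerDefect p k N (H * N) ω + H * C * (1 / m + ∑ k' ∈ Finset.range K,
        (eulerDefect (p' k') k' N (H * N) ω + M / m)) := by
  obtain ⟨e, rfl⟩ := hmN
  have hm : 0 < m := Nat.pos_of_mul_pos_right hN
  have he : 0 < e := Nat.pos_of_mul_pos_left hN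
  have hmR : (0 : ℝ) < m := by exact_mod_cast hm
  have heR : (0 : ℝ) < e := by exact_mod_cast he
  have hmQ : (m : ℚ) ≠ 0 := by exact_mod_cast hm.ne'
  have heQ : (e : ℚ) ≠ 0 := by exact_mod_cast he.ne'
  have hq1 : ∀ q : ℕ, (q : ℚ) / m = ((q * e : ℕ) : ℚ) / (m * e : ℕ) := fun q => by
    push_cast; field_simp
  have hq2 : ∀ q : ℕ, (q : ℝ) / m = ((q * e : ℕ) : ℝ) / (m * e : ℕ) := fun q => by
    push_cast; field_simp
  set N := m * e with hNe
  have hNR : (0 : ℝ) < N := by exact_mod_cast hN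
  have hAN : A * e ≤ H * N := by
    rw [hNe, ← mul_assoc]; exact Nat.mul_le_mul_right e hA
  have h1 := abs_sub_sub_riemann_le_eulerDefect p k N (H * N) ω (Nat.zero_le (A * e)) hAN
  rw [← hq1, Nat.cast_zero, zero_div, ← Finset.range_eq_Ico] at h1
  set B := 1 / m + ∑ k' ∈ Finset.range K, (eulerDefect (p' k') k' N (H * N) ω + M / m) with hB
  have hB0 : 0 ≤ B := by
    refine add_nonneg (by positivity) (Finset.sum_nonneg fun k' _ => add_nonneg
      (eulerDefect_nonneg _ _ _ _ _) (by positivity))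
  let g : ℕ → ℝ := fun q => p ((q : ℝ) / m, ω ((q : ℚ) / m))
  have h2 : (1 / m : ℝ) * ∑ q ∈ Finset.range A, g q =
      1 / N * ∑ l ∈ Finset.range (A * e), g (l / e) := by
    rw [sum_range_mul_div g A he, hNe]
    push_cast
    field_simp
  have h3 : ∀ l ∈ Finset.range (A * e),
      |p ((l : ℝ) / N, ω ((l : ℚ) / N)) - g (l / e)| ≤ C * B := by
    intro l hl
    rw [Finset.mem_range] at hl
    set q := l / e with hq
    have hql : q * e ≤ l := Nat.div_mul_le_self l e
    have hlq : l ≤ q * e + e := by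
      have := Nat.lt_div_mul_add (a := l) he
      rw [← hq] at this
      omega
    have hlN : l ≤ H * N := hl.le.trans hAN
    have hdist : |(l : ℝ) / N - (q : ℝ) / m| ≤ 1 / m := by
      rw [hq2, ← sub_div, abs_of_nonneg (div_nonneg (sub_nonneg.2 (by exact_mod_cast hql)) hNR.le),
        div_le_div_iff₀ hNR hmR, hNe]
      have : (l : ℝ) - (q * e : ℕ) ≤ e := by
        have : (l : ℝ) ≤ (q * e : ℕ) + e := by exact_mod_cast hlq
        linarith
      push_cast at this ⊢
      nlinarith
    have hmem : ∀ n : ℕ, n ≤ H * N → (n : ℝ) / N ∈ Icc (0 : ℝ) H := fun n hn =>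
      ⟨by positivity, by rw [div_le_iff₀ hNR]; exact_mod_cast hn⟩
    have hmemQ : ∀ n : ℕ, n ≤ H * N → (0 : ℚ) ≤ (n : ℚ) / N ∧ (n : ℚ) / N ≤ H := fun n hn =>
      ⟨by positivity, by
        rw [div_le_iff₀ (by exact_mod_cast hN)]; exact_mod_cast hn⟩
    have hden : ∀ n : ℕ, ((n : ℚ) / N).den ∣ N := fun n => by
      have := Rat.den_dvd (n : ℤ) (N : ℤ)
      rw [Rat.divInt_eq_div] at this
      simp only [Int.cast_natCast] at this
      exact Int.natCast_dvd_natCast.1 this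
    refine (hC _ (hmem l hlN) _ (by rw [hq2]; exact hmem _ (hql.trans hlN)) _ _).trans
      (mul_le_mul_of_nonneg_left (add_le_add hdist (Finset.sum_le_sum fun k' hk' => ?_)) hC0)
    have hqQ := hmemQ _ (hql.trans hlN)
    have := abs_sub_le_eulerDefect_add (hM k' (Finset.mem_range.1 hk')) k' hN ω
      hqQ.1 hqQ.2 (hmemQ l hlN).1 (hmemQ l hlN).2 (hden _) (hden _)
    rw [← hq1] at this
    refine this.trans (add_le_add le_rfl ?_)
    rw [div_eq_mul_one_div M]
    refine mul_le_mul_of_nonneg_left ?_ hM0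
    push_cast
    exact hdist
  have h4 : |1 / N * ∑ l ∈ Finset.range (A * e), p ((l : ℝ) / N, ω ((l : ℚ) / N)) -
      1 / N * ∑ l ∈ Finset.range (A * e), g (l / e)| ≤ H * C * B := by
    rw [← mul_sub, ← Finset.sum_sub_distrib, abs_mul, abs_of_pos (by positivity : (0 : ℝ) < 1 / N)]
    calc (1 / N : ℝ) * |∑ l ∈ Finset.range (A * e),
            (p ((l : ℝ) / N, ω ((l : ℚ) / N)) - g (l / e))|
        ≤ 1 / N * ((Finset.range (A * e)).card • (C * B)) := by
          refine mul_le_mul_of_nonneg_left ((Finset.abs_sum_le_sum_abs _ _).trans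
            (Finset.sum_le_card_nsmul _ _ _ h3)) (by positivity)
      _ ≤ 1 / N * ((H * N : ℕ) * (C * B)) := by
          rw [Finset.card_range, nsmul_eq_mul]
          gcongr
      _ = H * C * B := by push_cast; field_simp
  have h5 : (1 / m : ℝ) * ∑ q ∈ Finset.range A, p ((q : ℝ) / m, ω ((q : ℚ) / m)) =
      1 / N * ∑ l ∈ Finset.range (A * e), g (l / e) := h2
  rw [h5]
  refine le_trans ?_ (add_le_add h1 h4)
  refine le_trans (le_of_eq ?_) (abs_add_le _ _)
  congr 1
  ring

theorem integral_abs_sub_sub_coarse_riemann_le {η : Measure (ℚ → HCube)} {H : ℕ}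
    {K : ℕ → ℕ} {p : ℕ → ℕ → ℝ × HCube → ℝ} (hp : ∀ i k, IsCylinder (K i) (p i k))
    (hlim : ∀ (Φ : C(ℚ → HCube, ℝ)) (s : Finset (ℕ × ℕ)) (α : ℕ × ℕ → ℝ) (C : ℝ) (n₀ : ℕ),
        (∀ y ∈ s, y.2 < y.1) → (∀ y ∈ s, 0 ≤ α y) → 0 < n₀ →
        (∀ N, n₀ ∣ N → 0 < N → ∀ ω,
          Φ ω ≤ C + ∑ y ∈ s, α y * eulerDefect (p y.1 y.2) y.2 N (H * N) ω) →
        ∫ ω, Φ ω ∂η ≤ C + ∑ y ∈ s, α y * (5 * (1 / 2) ^ y.1)) {i k : ℕ} (hki : k < i) :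
    ∃ L : ℝ, ∀ i', i < i' → K i ≤ i' → ∃ L' : ℝ, ∀ m A : ℕ, 0 < m → A ≤ H * m →
      ∫ ω, |(ω ((A : ℚ) / m) k : ℝ) - ω 0 k -
        (1 / m : ℝ) * ∑ q ∈ Finset.range A, p i k ((q : ℝ) / m, ω ((q : ℚ) / m))| ∂η ≤
        5 * (1 / 2) ^ i + L * (1 / 2) ^ i' + L' / m := by
  classical
  have hpc := fun i k => (hp i k).continuous
  obtain ⟨C, hC0, hC⟩ := (hp i k).exists_lipschitz H
  refine ⟨H * C * K i * 5, fun i' hi' hKi' => ?_⟩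
  have hM : ∃ M : ℝ, 0 ≤ M ∧ ∀ k < K i, ∀ r ∈ Icc (0 : ℝ) H, ∀ x, |p i' k (r, x)| ≤ M := by
    choose M hM using fun k => exists_bound_on_Icc (hpc i' k) 0 H
    refine ⟨∑ k ∈ Finset.range (K i), |M k|, Finset.sum_nonneg fun _ _ => abs_nonneg _,
      fun k hk r hr x => (hM k r hr x).trans ((le_abs_self _).trans ?_)⟩
    exact Finset.single_le_sum (f := fun k => |M k|) (fun _ _ => abs_nonneg _)
      (Finset.mem_range.2 hk)
  obtain ⟨M, hM0, hM⟩ := hM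
  refine ⟨H * C * (1 + K i * M), fun m A hm hA => ?_⟩
  have hcont : Continuous fun ω : ℚ → HCube => |(ω ((A : ℚ) / m) k : ℝ) - ω 0 k -
        (1 / m : ℝ) * ∑ q ∈ Finset.range A, p i k ((q : ℝ) / m, ω ((q : ℚ) / m))| := by
    have := hpc i k
    fun_prop
  let s : Finset (ℕ × ℕ) := insert (i, k) ((Finset.range (K i)).image fun k' => (i', k'))
  let α : ℕ × ℕ → ℝ := fun y => if y.1 = i then 1 else H * C
  have hsum : ∀ f : ℕ × ℕ → ℝ, ∑ y ∈ s, α y * f y =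
      f (i, k) + H * C * ∑ k' ∈ Finset.range (K i), f (i', k') := by
    intro f
    rw [Finset.sum_insert, Finset.sum_image]
    · simp [α, hi'.ne', Finset.mul_sum]
    · intro x _ y _ hxy
      exact (Prod.mk.inj hxy).2
    · simp [hi'.ne']
  have hmR : (0 : ℝ) < m := by exact_mod_cast hm
  have := hlim ⟨_, hcont⟩ s α (H * C * (1 + K i * M) / m) m ?_ ?_ hm ?_
  · rw [hsum] at this
    simp only [ContinuousMap.coe_mk, Finset.sum_const, Finset.card_range, nsmul_eq_mul] at this
    refine this.trans (le_of_eq ?_)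
    ring
  · intro y hy
    simp only [s, Finset.mem_insert, Finset.mem_image, Finset.mem_range] at hy
    rcases hy with rfl | ⟨k', hk', rfl⟩
    · exact hki
    · exact hk'.trans_le hKi'
  · intro y _
    simp only [α]
    split_ifs <;> positivity
  · intro N hmN hN ω
    rw [hsum fun y => eulerDefect (p y.1 y.2) y.2 N (H * N) ω]
    refine (abs_sub_sub_coarse_riemann_le hC0 hC hM0 hM k hN hmN hA ω).trans (le_of_eq ?_)
    rw [Finset.sum_add_distrib]
    simp only [Finset.sum_const, Finset.card_range, nsmul_eq_mul]
    ring

theorem continuous_comp_pathExt {p : ℝ × HCube → ℝ} (hp : Continuous p) (H : ℕ) (ω : ℚ → HCube) :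
    Continuous fun r => p (r, pathExt H r ω) :=
  hp.comp (continuous_id.prodMk (continuous_pathExt H ω))

theorem integral_abs_sub_sub_intervalIntegral_le {η : Measure (ℚ → HCube)} [IsProbabilityMeasure η]
    {H : ℕ} {K : ℕ → ℕ} {p : ℕ → ℕ → ℝ × HCube → ℝ} (hp : ∀ i k, IsCylinder (K i) (p i k))
    (hL : ∀ᵐ ω ∂η, AlmostLipschitz H ω)
    (hlim : ∀ (Φ : C(ℚ → HCube, ℝ)) (s : Finset (ℕ × ℕ)) (α : ℕ × ℕ → ℝ) (C : ℝ) (n₀ : ℕ),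
        (∀ y ∈ s, y.2 < y.1) → (∀ y ∈ s, 0 ≤ α y) → 0 < n₀ →
        (∀ N, n₀ ∣ N → 0 < N → ∀ ω,
          Φ ω ≤ C + ∑ y ∈ s, α y * eulerDefect (p y.1 y.2) y.2 N (H * N) ω) →
        ∫ ω, Φ ω ∂η ≤ C + ∑ y ∈ s, α y * (5 * (1 / 2) ^ y.1)) {i k : ℕ} (hki : k < i)
    {q : ℚ} (hq0 : 0 ≤ q) (hqH : q ≤ H) :
    ∫ ω, |(pathExt H q ω k : ℝ) - pathExt H 0 ω k -
      ∫ r in (0 : ℝ)..q, p i k (r, pathExt H r ω)| ∂η ≤ 5 * (1 / 2) ^ i := by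
  have hpc := (hp i k).continuous
  obtain ⟨L, hL'⟩ := integral_abs_sub_sub_coarse_riemann_le hp hlim hki
  let m : ℕ → ℕ := fun n => q.den * (n + 1)
  have hm0 : ∀ n, 0 < m n := fun n => Nat.mul_pos q.den_pos n.succ_pos
  have hmR : ∀ n, (0 : ℝ) < m n := fun n => by exact_mod_cast hm0 n
  have hA : ∀ n, ∃ A : ℕ, A ≤ H * m n ∧ (A : ℚ) / m n = q ∧ (A : ℝ) / m n = q := fun n =>
    exists_natCast_div_eq hq0 hqH (hm0 n) (Dvd.intro _ rfl)
  choose A hAH hAq hAqR using hA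
  have hmt : Tendsto m atTop atTop := tendsto_atTop_mono (fun n => by
    simp only [m, id]
    exact (Nat.le_succ n).trans (Nat.le_mul_of_pos_left _ q.den_pos)) tendsto_id
  let X : ℕ → (ℚ → HCube) → ℝ := fun n ω => |(ω ((A n : ℚ) / m n) k : ℝ) - ω 0 k -
    (1 / m n : ℝ) * ∑ l ∈ Finset.range (A n), p i k ((l : ℝ) / m n, ω ((l : ℚ) / m n))|
  have hXc : ∀ n, Continuous (X n) := fun n => by fun_prop
  obtain ⟨M, hM⟩ := exists_bound_on_Icc hpc 0 H
  have hM0 : 0 ≤ M := (abs_nonneg _).trans (hM 0 ⟨le_rfl, by positivity⟩ fun _ => ⟨0, by simp⟩)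
  have hcoord : ∀ z : Icc (-1 : ℝ) 1, |(z : ℝ)| ≤ 1 := fun z => abs_le.2 z.2
  have hXb : ∀ n ω, ‖X n ω‖ ≤ 2 + H * M := by
    intro n ω
    simp only [X, Real.norm_eq_abs, abs_abs]
    refine (abs_sub _ _).trans (add_le_add ?_ ?_)
    · exact (abs_sub _ _).trans ((add_le_add (hcoord _) (hcoord _)).trans (by norm_num))
    · rw [abs_mul, abs_of_pos (by have := hmR n; positivity : (0 : ℝ) < 1 / m n)]
      have h1 : |∑ l ∈ Finset.range (A n), p i k ((l : ℝ) / m n, ω ((l : ℚ) / m n))| ≤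
          (H * m n : ℕ) * M := by
        refine (Finset.abs_sum_le_sum_abs _ _).trans ((Finset.sum_le_card_nsmul _ _ M
          fun l hl => hM _ ⟨by positivity, ?_⟩ _).trans ?_)
        · rw [div_le_iff₀ (hmR n)]
          exact_mod_cast (Finset.mem_range.1 hl).le.trans (hAH n)
        · rw [Finset.card_range, nsmul_eq_mul]
          have := hAH n
          gcongr
      calc (1 / m n : ℝ) * _ ≤ 1 / m n * ((H * m n : ℕ) * M) := by
            have := hmR n
            gcongr
        _ = H * M := by
            have := (hmR n).ne'
            push_cast; field_simp
  have hXt : Tendsto (fun n => ∫ ω, X n ω ∂η) atTop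
      (𝓝 (∫ ω, |(pathExt H q ω k : ℝ) - pathExt H 0 ω k -
        ∫ r in (0 : ℝ)..q, p i k (r, pathExt H r ω)| ∂η)) := by
    refine tendsto_integral_of_dominated_convergence (fun _ => 2 + H * M)
      (fun n => (hXc n).aestronglyMeasurable) (integrable_const _)
      (fun n => ae_of_all _ fun ω => hXb n ω) ?_
    filter_upwards [hL] with ω hω
    have h0 : pathExt H 0 ω = ω 0 := by
      have := hω.pathExt_ratCast le_rfl (by positivity : (0 : ℚ) ≤ H)
      simpa using this
    have hR : Tendsto (fun n => (1 / m n : ℝ) * ∑ l ∈ Finset.range (A n),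
        p i k ((l : ℝ) / m n, ω ((l : ℚ) / m n))) atTop
        (𝓝 (∫ r in (0 : ℝ)..q, p i k (r, pathExt H r ω))) := by
      rw [Metric.tendsto_atTop']
      intro ε hε
      obtain ⟨N, hN⟩ := eventually_atTop.1 (hmt.eventually (eventually_abs_riemann_sub_le
        (continuous_comp_pathExt hpc H ω) H (half_pos hε)))
      refine ⟨N, fun n hn => ?_⟩
      have := hN n hn.le (A n) (hAH n)
      rw [hAqR] at this
      rw [Real.dist_eq]
      refine lt_of_le_of_lt (le_of_eq ?_) (this.trans_lt (half_lt_self hε))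
      congr 3
      refine Finset.sum_congr rfl fun l hl => ?_
      have hlH : (l : ℚ) / m n ≤ H := by
        rw [div_le_iff₀ (by exact_mod_cast hm0 n)]
        exact_mod_cast (Finset.mem_range.1 hl).le.trans (hAH n)
      have := hω.pathExt_ratCast (by positivity : (0 : ℚ) ≤ (l : ℚ) / m n) hlH
      push_cast at this
      rw [this]
    rw [hω.pathExt_ratCast hq0 hqH, h0]
    refine (((tendsto_const_nhds (x := (ω q k : ℝ) - ω 0 k)).sub hR).abs).congr fun n => ?_
    simp only [X, hAq]
  have hbound : ∀ i', i < i' → K i ≤ i' → ∫ ω, |(pathExt H q ω k : ℝ) - pathExt H 0 ω k -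
      ∫ r in (0 : ℝ)..q, p i k (r, pathExt H r ω)| ∂η ≤
        5 * (1 / 2) ^ i + L * (1 / 2) ^ i' := by
    intro i' h1 h2
    obtain ⟨L', hb⟩ := hL' i' h1 h2
    have ht : Tendsto (fun n => 5 * (1 / 2 : ℝ) ^ i + L * (1 / 2) ^ i' + L' / m n) atTop
        (𝓝 (5 * (1 / 2) ^ i + L * (1 / 2) ^ i' + 0)) :=
      tendsto_const_nhds.add (tendsto_const_nhds.div_atTop
        (tendsto_natCast_atTop_atTop.comp hmt))
    rw [add_zero] at ht
    exact le_of_tendsto_of_tendsto hXt ht (Eventually.of_forall fun n => hb _ _ (hm0 n) (hAH n))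
  have ht : Tendsto (fun i' : ℕ => 5 * (1 / 2 : ℝ) ^ i + L * (1 / 2) ^ i') atTop
      (𝓝 (5 * (1 / 2) ^ i + L * 0)) :=
    tendsto_const_nhds.add ((tendsto_pow_atTop_nhds_zero_of_lt_one (by norm_num)
      (by norm_num)).const_mul L)
  rw [mul_zero, add_zero] at ht
  refine ge_of_tendsto ht ?_
  filter_upwards [eventually_gt_atTop i, eventually_ge_atTop (K i)] with i' h1 h2
  exact hbound i' h1 h2

theorem measurable_uncurry_pathExt (H : ℕ) :
    Measurable fun y : ℝ × (ℚ → HCube) => pathExt H y.1 y.2 :=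
  measurable_uncurry_of_continuous_of_measurable (u := pathExt H) (continuous_pathExt H)
    (measurable_pathExt H)

theorem map_prod_pathExt {ν : Kernel ℝ HCube} [IsMarkovKernel ν] {H : ℕ}
    {η : Measure (ℚ → HCube)} [IsProbabilityMeasure η]
    (h : ∀ t ∈ Icc (0 : ℝ) H, η.map (pathExt H t) = ν t) :
    ((volume.restrict (Icc 0 (H : ℝ))).prod η).map (fun y => (y.1, pathExt H y.1 y.2)) =
      volume.restrict (Icc 0 (H : ℝ)) ⊗ₘ ν := by
  have hm : Measurable fun y : ℝ × (ℚ → HCube) => (y.1, pathExt H y.1 y.2) :=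
    measurable_fst.prodMk (measurable_uncurry_pathExt H)
  refine Measure.ext_of_lintegral _ fun f hf => ?_
  rw [lintegral_map hf hm, lintegral_prod (fun y => f (y.1, pathExt H y.1 y.2)) (hf.comp hm).aemeasurable,
    Measure.lintegral_compProd hf]
  refine setLIntegral_congr_fun measurableSet_Icc fun t ht => ?_
  rw [← h t ht, lintegral_map (f := fun b => f (t, b)) (hf.comp measurable_prodMk_left) (measurable_pathExt H t)]

/-- Superposition principle on the Hilbert cube: a weak flow is the family of marginals of a
random continuous path which almost surely solves the associated ordinary differential equation. -/
theorem WeakFlow.exists_superposition {ν : Kernel ℝ HCube} [IsMarkovKernel ν]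
    {V : ℕ → ℝ × HCube → ℝ} (hf : WeakFlow ν V) (H : ℕ) :
    ∃ η : Measure (ℚ → HCube), IsProbabilityMeasure η ∧
      (∀ t ∈ Icc (0 : ℝ) H, η.map (pathExt H t) = ν t) ∧
      ∀ k, ∀ᵐ ω ∂η, IntegrableOn (fun r => V k (r, pathExt H r ω)) (Icc 0 H) ∧
        ∀ t ∈ Icc (0 : ℝ) H, (pathExt H t ω k : ℝ) - pathExt H 0 ω k =
          ∫ r in (0 : ℝ)..t, V k (r, pathExt H r ω) := by
  have hap : ∀ i, ∃ K, ∃ p : ℕ → ℝ × HCube → ℝ, i ≤ K ∧ (∀ k, IsCylinder K (p k)) ∧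
      ∑ k ∈ Finset.range i,
        ∫ y, |V k y - p k y| ∂(volume.restrict (Icc 0 (H : ℝ)) ⊗ₘ ν) ≤ (1 / 2) ^ i := fun i =>
    hf.exists_cylinder_approx H i (by positivity)
  choose K p hK hp hpV using hap
  obtain ⟨η, hη, hmarg, hlim⟩ := hf.exists_limit H hK hp hpV
  have hpc := fun i k => (hp i k).continuous
  have hL := ae_almostLipschitz H hpc hlim
  have hmap := fun t ht => map_pathExt (t := t) hf.cont hmarg hL ht
  refine ⟨η, hη, hmap, fun k => ?_⟩
  have hprod := map_prod_pathExt hmap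
  have hm : Measurable fun y : ℝ × (ℚ → HCube) => (y.1, pathExt H y.1 y.2) :=
    measurable_fst.prodMk (measurable_uncurry_pathExt H)
  have hVi : Integrable (V k) (volume.restrict (Icc 0 (H : ℝ)) ⊗ₘ ν) :=
    integrable_restrict_compProd (hf.meas k) _ (hf.integrable k)
  have hpi : ∀ i, Integrable (p i k) (volume.restrict (Icc 0 (H : ℝ)) ⊗ₘ ν) := fun i =>
    integrable_compProd_of_continuous (hpc i k) 0 H
  have hdi : ∀ i, Integrable (fun y => |V k y - p i k y|)
      (volume.restrict (Icc 0 (H : ℝ)) ⊗ₘ ν) := fun i => (hVi.sub (hpi i)).abs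
  have hVo : ∀ᵐ ω ∂η, IntegrableOn (fun r => V k (r, pathExt H r ω)) (Icc 0 H) := by
    have h1 := hVi
    rw [← hprod] at h1
    exact (h1.comp_measurable hm).prod_left_ae
  have hdo : ∀ i, Integrable (fun y : ℝ × (ℚ → HCube) =>
      |V k (y.1, pathExt H y.1 y.2) - p i k (y.1, pathExt H y.1 y.2)|)
      ((volume.restrict (Icc 0 (H : ℝ))).prod η) := by
    intro i
    have h1 := hdi i
    rw [← hprod] at h1
    exact h1.comp_measurable hm
  have hdint : ∀ i, k < i → ∫ ω, (∫ r in Icc 0 (H : ℝ),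
      |V k (r, pathExt H r ω) - p i k (r, pathExt H r ω)|) ∂η ≤ (1 / 2) ^ i := by
    intro i hi
    rw [← integral_prod_symm _ (hdo i)]
    have h1 : ∫ y, |V k y - p i k y| ∂(volume.restrict (Icc 0 (H : ℝ)) ⊗ₘ ν) ≤ (1 / 2) ^ i :=
      (Finset.single_le_sum (f := fun k =>
        ∫ y, |V k y - p i k y| ∂(volume.restrict (Icc 0 (H : ℝ)) ⊗ₘ ν))
        (fun _ _ => integral_nonneg fun _ => abs_nonneg _) (Finset.mem_range.2 hi)).trans (hpV i)
    have h2 := hdi i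
    rw [← hprod] at h1 h2
    rwa [integral_map hm.aemeasurable h2.aestronglyMeasurable] at h1
  have hrat : ∀ q : ℚ, 0 ≤ q → q ≤ H → ∀ᵐ ω ∂η, (pathExt H q ω k : ℝ) - pathExt H 0 ω k =
      ∫ r in (0 : ℝ)..q, V k (r, pathExt H r ω) := by
    intro q hq0 hqH
    have hq0R : (0 : ℝ) ≤ q := by exact_mod_cast hq0
    have hqHR : (q : ℝ) ≤ H := by exact_mod_cast hqH
    have hsub : Ioc (0 : ℝ) q ⊆ Icc 0 H := fun r hr => ⟨hr.1.le, hr.2.trans hqHR⟩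
    have hZm : ∀ t, Measurable fun ω => (pathExt H t ω k : ℝ) := fun t =>
      measurable_subtype_coe.comp ((measurable_pi_apply k).comp (measurable_pathExt H t))
    let D : (ℚ → HCube) → ℝ := fun ω => (pathExt H q ω k : ℝ) - pathExt H 0 ω k -
      ∫ r in (0 : ℝ)..q, V k (r, pathExt H r ω)
    have hg : ∀ i, k < i → ∫⁻ ω, ENNReal.ofReal |D ω| ∂η ≤
        ENNReal.ofReal (6 * (1 / 2) ^ i) := by
      intro i hi
      let g : (ℚ → HCube) → ℝ := fun ω => |(pathExt H q ω k : ℝ) - pathExt H 0 ω k -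
        ∫ r in (0 : ℝ)..q, p i k (r, pathExt H r ω)|
      let h : (ℚ → HCube) → ℝ := fun ω => ∫ r in Icc 0 (H : ℝ),
        |V k (r, pathExt H r ω) - p i k (r, pathExt H r ω)|
      have hgm : AEStronglyMeasurable g η := by
        have h1 : StronglyMeasurable fun ω => ∫ r in (0 : ℝ)..q, p i k (r, pathExt H r ω) := by
          simp only [intervalIntegral.integral_of_le hq0R]
          have : StronglyMeasurable fun y : (ℚ → HCube) × ℝ => p i k (y.2, pathExt H y.2 y.1) :=
            ((hpc i k).measurable.comp (hm.comp measurable_swap)).stronglyMeasurable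
          exact this.integral_prod_right'
        exact ((((hZm q).sub (hZm 0)).sub h1.measurable).norm).aestronglyMeasurable
      have hgi : Integrable g η := by
        obtain ⟨M, hM⟩ := exists_bound_on_Icc (hpc i k) 0 H
        refine Integrable.of_bound hgm (2 + M * |(q : ℝ) - 0|) (ae_of_all _ fun ω => ?_)
        have hcoord : ∀ z : Icc (-1 : ℝ) 1, |(z : ℝ)| ≤ 1 := fun z => abs_le.2 z.2
        simp only [g, Real.norm_eq_abs, abs_abs]
        refine (abs_sub _ _).trans (add_le_add ((abs_sub _ _).trans
          ((add_le_add (hcoord _) (hcoord _)).trans (by norm_num))) ?_)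
        refine intervalIntegral.norm_integral_le_of_norm_le_const
          (f := fun r => p i k (r, pathExt H r ω)) fun r hr => ?_
        rw [uIoc_of_le hq0R] at hr
        exact hM r (hsub hr) _
      have hhi : Integrable h η := (hdo i).integral_prod_right
      have h1 : ∀ᵐ ω ∂η, |D ω| ≤ g ω + h ω := by
        filter_upwards [hVo] with ω hω
        have hp' : IntegrableOn (fun r => p i k (r, pathExt H r ω)) (Icc 0 (H : ℝ)) :=
          (continuous_comp_pathExt (hpc i k) H ω).continuousOn.integrableOn_Icc
        have e : (∫ r in (0 : ℝ)..q, V k (r, pathExt H r ω)) -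
            ∫ r in (0 : ℝ)..q, p i k (r, pathExt H r ω) =
            ∫ r in Ioc (0 : ℝ) q, (V k (r, pathExt H r ω) - p i k (r, pathExt H r ω)) := by
          rw [intervalIntegral.integral_of_le hq0R, intervalIntegral.integral_of_le hq0R,
            integral_sub (hω.mono_set hsub) (hp'.mono_set hsub)]
        have e2 : |∫ r in Ioc (0 : ℝ) q, (V k (r, pathExt H r ω) - p i k (r, pathExt H r ω))| ≤
            h ω := by
          refine (abs_integral_le_integral_abs).trans (setIntegral_mono_set ?_
            (ae_of_all _ fun _ => abs_nonneg _) hsub.eventuallyLE)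
          exact (hω.sub hp').abs
        rw [← e] at e2
        calc |D ω| = |((pathExt H q ω k : ℝ) - pathExt H 0 ω k -
              ∫ r in (0 : ℝ)..q, p i k (r, pathExt H r ω)) -
              ((∫ r in (0 : ℝ)..q, V k (r, pathExt H r ω)) -
                ∫ r in (0 : ℝ)..q, p i k (r, pathExt H r ω))| := by
              simp only [D]; congr 1; ring
          _ ≤ g ω + h ω := (abs_sub _ _).trans (add_le_add le_rfl e2)
      calc ∫⁻ ω, ENNReal.ofReal |D ω| ∂η ≤ ∫⁻ ω, ENNReal.ofReal (g ω + h ω) ∂η :=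
            lintegral_mono_ae (h1.mono fun ω hω => ENNReal.ofReal_le_ofReal hω)
        _ = ENNReal.ofReal (∫ ω, (g ω + h ω) ∂η) :=
            (ofReal_integral_eq_lintegral_ofReal (hgi.add hhi) (ae_of_all _ fun ω =>
              add_nonneg (abs_nonneg _) (integral_nonneg fun _ => abs_nonneg _))).symm
        _ ≤ _ := by
            refine ENNReal.ofReal_le_ofReal ?_
            rw [integral_add hgi hhi]
            have a1 : ∫ ω, g ω ∂η ≤ _ :=
              integral_abs_sub_sub_intervalIntegral_le hp hL hlim hi hq0 hqH
            have a2 : ∫ ω, h ω ∂η ≤ _ := hdint i hi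
            linarith
    have hz : ∫⁻ ω, ENNReal.ofReal |D ω| ∂η = 0 := by
      refine le_antisymm ?_ zero_le
      have ht : Tendsto (fun i : ℕ => ENNReal.ofReal (6 * (1 / 2) ^ i)) atTop
          (𝓝 (ENNReal.ofReal (6 * 0))) :=
        ENNReal.tendsto_ofReal ((tendsto_pow_atTop_nhds_zero_of_lt_one (by norm_num)
          (by norm_num)).const_mul 6)
      rw [mul_zero, ENNReal.ofReal_zero] at ht
      exact ge_of_tendsto ht ((eventually_gt_atTop k).mono fun i hi => hg i hi)
    have hDm : Measurable D := by
      have h1 : StronglyMeasurable fun ω => ∫ r in (0 : ℝ)..q, V k (r, pathExt H r ω) := by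
        simp only [intervalIntegral.integral_of_le hq0R]
        have : StronglyMeasurable fun y : (ℚ → HCube) × ℝ => V k (y.2, pathExt H y.2 y.1) :=
          ((hf.meas k).comp (hm.comp measurable_swap)).stronglyMeasurable
        exact this.integral_prod_right'
      exact ((hZm q).sub (hZm 0)).sub h1.measurable
    have h3 := (lintegral_eq_zero_iff hDm.norm.ennreal_ofReal).1 hz
    filter_upwards [h3] with ω hω
    have h4 : |D ω| ≤ 0 := ENNReal.ofReal_eq_zero.1 hω
    exact sub_eq_zero.1 (abs_nonpos_iff.1 h4)
  have hrat' : ∀ᵐ ω ∂η, ∀ q : ℚ, 0 ≤ q → q ≤ H → (pathExt H q ω k : ℝ) - pathExt H 0 ω k =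
      ∫ r in (0 : ℝ)..q, V k (r, pathExt H r ω) := by
    rw [ae_all_iff]
    intro q
    by_cases hq : 0 ≤ q ∧ q ≤ H
    · exact (hrat q hq.1 hq.2).mono fun ω h _ _ => h
    · exact ae_of_all _ fun ω h1 h2 => absurd ⟨h1, h2⟩ hq
  filter_upwards [hVo, hrat'] with ω hω hωq
  refine ⟨hω, fun t ht => ?_⟩
  have hr := tendsto_ratApprox H t
  rw [min_eq_left ht.2, max_eq_right ht.1] at hr
  have hc : Continuous fun t => (pathExt H t ω k : ℝ) :=
    continuous_subtype_val.comp ((continuous_apply k).comp (continuous_pathExt H ω))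
  have hmem : ∀ n, (ratApprox H t n : ℝ) ∈ Icc (0 : ℝ) H := fun n =>
    ⟨by exact_mod_cast ratApprox_nonneg H t n, by exact_mod_cast ratApprox_le H t n⟩
  have hI : ContinuousOn (fun t => ∫ r in (0 : ℝ)..t, V k (r, pathExt H r ω)) (Icc 0 (H : ℝ)) :=
    intervalIntegral.continuousOn_primitive_interval
      (by rwa [uIcc_of_le (by positivity : (0 : ℝ) ≤ H)])
      |>.mono (by rw [uIcc_of_le (by positivity : (0 : ℝ) ≤ H)])
  have h1 := ((hc.tendsto t).comp hr).sub_const (pathExt H 0 ω k : ℝ)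
  have h2 := (hI t ht).tendsto.comp (tendsto_nhdsWithin_iff.2 ⟨hr, Eventually.of_forall hmem⟩)
  refine tendsto_nhds_unique (h1.congr fun n => ?_) h2
  exact hωq _ (ratApprox_nonneg _ _ _) (ratApprox_le _ _ _)

theorem measurable_toMeasure_of_borel {Ω : Type*} [TopologicalSpace Ω] [MeasurableSpace Ω]
    [BorelSpace Ω] [HasOuterApproxClosed Ω] {mP : MeasurableSpace (ProbabilityMeasure Ω)}
    (hP : mP = borel _) : Measurable fun μ : ProbabilityMeasure Ω => (μ : Measure Ω) := by
  have : BorelSpace (ProbabilityMeasure Ω) := ⟨hP⟩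
  refine Measurable.measure_of_isPiSystem_of_isProbabilityMeasure
    ((BorelSpace.measurable_eq (α := Ω)).trans rfl) isPiSystem_isOpen fun G hG => ?_
  refine LowerSemicontinuous.measurable fun μ => ?_
  refine lowerSemicontinuousAt_iff_le_liminf.2 ?_
  exact ProbabilityMeasure.le_liminf_measure_open_of_tendsto tendsto_id hG

/-- A weakly continuous curve of probability measures, as a Markov kernel. -/
def continuousCurveKernel {X Ω : Type*} [TopologicalSpace X] [MeasurableSpace X] [BorelSpace X]
    [TopologicalSpace Ω] [MeasurableSpace Ω] [BorelSpace Ω] [HasOuterApproxClosed Ω]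
    (ν : X → ProbabilityMeasure Ω) (hν : Continuous ν) : Kernel X Ω where
  toFun t := ν t
  measurable' := by
    borelize (ProbabilityMeasure Ω)
    exact (measurable_toMeasure_of_borel rfl).comp hν.measurable

instance {X Ω : Type*} [TopologicalSpace X] [MeasurableSpace X] [BorelSpace X]
    [TopologicalSpace Ω] [MeasurableSpace Ω] [BorelSpace Ω] [HasOuterApproxClosed Ω]
    (ν : X → ProbabilityMeasure Ω) (hν : Continuous ν) :
    IsMarkovKernel (continuousCurveKernel ν hν) :=
  ⟨fun t => (ν t).2⟩

/-- The evaluations generate the Borel sets of a space of continuous functions on a compact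
space. -/
theorem borel_continuousMap_eq_iSup_comap {X Y : Type*} [TopologicalSpace X] [CompactSpace X]
    [TopologicalSpace.MetrizableSpace X] [TopologicalSpace Y]
    [TopologicalSpace.PseudoMetrizableSpace Y] [SecondCountableTopology Y] :
    borel C(X, Y) = ⨆ x : X, (borel Y).comap fun f : C(X, Y) => f x := by
  let : MetricSpace X := TopologicalSpace.metrizableSpaceMetric X
  let : PseudoMetricSpace Y := TopologicalSpace.pseudoMetrizableSpacePseudoMetric Y
  apply le_antisymm
  · rw [borel_eq_generateFrom_of_subbasis (ContinuousMap.compactOpen_eq (X := X) (Y := Y))]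
    refine MeasurableSpace.generateFrom_le ?_
    rintro _ ⟨K, hK, U, hU, rfl⟩
    obtain ⟨D, hDK, hDc, hD⟩ :=
      (TopologicalSpace.IsSeparable.of_separableSpace K).exists_countable_dense_subset
    have heq : {f : C(X, Y) | MapsTo f K U} = ⋃ n : ℕ, ⋂ x ∈ D,
        {f : C(X, Y) | f x ∈ {y | (n + 1 : ENNReal)⁻¹ ≤ Metric.infEDist y Uᶜ}} := by
      ext f
      simp only [mem_ofPred_eq, mem_iUnion, mem_iInter]
      have hpos : ∀ y, y ∈ U ↔ 0 < Metric.infEDist y Uᶜ := fun y => by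
        rw [pos_iff_ne_zero, Ne, ← Metric.mem_closure_iff_infEDist_zero, hU.isClosed_compl.closure_eq,
          notMem_compl_iff]
      constructor
      · intro hf
        rcases K.eq_empty_or_nonempty with rfl | hKn
        · exact ⟨0, fun x hx => absurd (hDK hx) (notMem_empty x)⟩
        obtain ⟨x₀, hx₀, hmin⟩ := hK.exists_isMinOn hKn
          (f := fun x => Metric.infEDist (f x) Uᶜ)
          (Metric.continuous_infEDist.comp f.continuous).continuousOn
        obtain ⟨n, hn⟩ := ENNReal.exists_inv_nat_lt ((hpos _).1 (hf hx₀)).ne'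
        refine ⟨n, fun x hx => le_trans ?_ (hn.le.trans (hmin (hDK hx)))⟩
        exact ENNReal.inv_le_inv.2 (self_le_add_right _ _)
      · rintro ⟨n, hn⟩ x hx
        rw [hpos]
        have hcl : IsClosed {x | (n + 1 : ENNReal)⁻¹ ≤ Metric.infEDist (f x) Uᶜ} :=
          isClosed_le continuous_const (Metric.continuous_infEDist.comp f.continuous)
        have := closure_minimal (fun x hx => hn x hx) hcl (hD hx)
        refine lt_of_lt_of_le ?_ this
        simp
    change MeasurableSet[⨆ x : X, (borel Y).comap fun f : C(X, Y) => f x] {f : C(X, Y) | MapsTo f K U}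
    rw [heq]
    refine MeasurableSet.iUnion fun n => MeasurableSet.biInter hDc fun x _ => ?_
    refine (le_iSup (fun x : X => (borel Y).comap fun f : C(X, Y) => f x) x) _
      ⟨{y | (n + 1 : ENNReal)⁻¹ ≤ Metric.infEDist y Uᶜ}, ?_, rfl⟩
    borelize Y
    exact (isClosed_le continuous_const Metric.continuous_infEDist).measurableSet
  · refine iSup_le fun x => ?_
    borelize Y
    borelize C(X, Y)
    exact Measurable.comap_le (continuous_eval_const x).measurable

instance (d : ℕ) : BorelSpace (Pm d) := ⟨rfl⟩

instance (T : ℝ) (d : ℕ) : BorelSpace (CurveSp T d) := ⟨rfl⟩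

theorem measurable_Pm_toMeasure (d : ℕ) : Measurable fun μ : Pm d => (μ : Measure (Ed d)) :=
  measurable_toMeasure_of_borel rfl

/-- The tautological Markov kernel from `P(ℝ^d)` to `ℝ^d`. -/
def tautKernel (d : ℕ) : Kernel (Pm d) (Ed d) where
  toFun μ := μ
  measurable' := measurable_Pm_toMeasure d

instance (d : ℕ) : IsMarkovKernel (tautKernel d) := ⟨fun μ => μ.2⟩

/-- The weighted `C²` bound adapted to the integrand `wInt`. -/
def WBound {d : ℕ} (φ : Ed d → ℝ) (C : ℝ) : Prop :=
  ∀ x, |φ x| ≤ C ∧ ‖gradient φ x‖ * (1 + ‖x‖) ≤ C ∧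
    ‖fderiv ℝ (gradient φ) x‖ * (1 + ‖x‖ ^ 2) ≤ C

theorem contDiff_gradient {d : ℕ} {φ : Ed d → ℝ} (h : ContDiff ℝ 2 φ) :
    ContDiff ℝ 1 (gradient φ) :=
  (InnerProductSpace.toDual ℝ (Ed d)).symm.contDiff.comp
    (h.fderiv_right (m := 1) (by norm_num))

theorem gradient_sub_smul {d : ℕ} {φ ψ : Ed d → ℝ} (hφ : ContDiff ℝ 2 φ) (hψ : ContDiff ℝ 2 ψ)
    (r : ℝ) : gradient (fun x => ψ x - r * φ x) = fun x => gradient ψ x - r • gradient φ x := by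
  ext1 x
  have h1 := (hφ.differentiable (by norm_num)) x
  have h2 := (hψ.differentiable (by norm_num)) x
  simp only [gradient]
  rw [fderiv_fun_sub h2 (h1.const_mul r), fderiv_const_mul h1, map_sub, map_smul]

theorem fderiv_gradient_sub_smul {d : ℕ} {φ ψ : Ed d → ℝ} (hφ : ContDiff ℝ 2 φ)
    (hψ : ContDiff ℝ 2 ψ) (r : ℝ) (x : Ed d) :
    fderiv ℝ (gradient (fun x => ψ x - r * φ x)) x =
      fderiv ℝ (gradient ψ) x - r • fderiv ℝ (gradient φ) x := by
  rw [gradient_sub_smul hφ hψ]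
  have h1 := ((contDiff_gradient hφ).differentiable (by norm_num)) x
  have h2 := ((contDiff_gradient hψ).differentiable (by norm_num)) x
  exact (h2.hasFDerivAt.sub (h1.hasFDerivAt.const_smul r)).fderiv

theorem Lop_sub_smul {d : ℕ} {b : ℝ → Ed d → Pm d → Ed d}
    {a : ℝ → Ed d → Pm d → (Ed d →L[ℝ] Ed d)} (μ : Pm d) (t : ℝ) {φ ψ : Ed d → ℝ}
    (hφ : ContDiff ℝ 2 φ) (hψ : ContDiff ℝ 2 ψ) (r : ℝ) (x : Ed d) :
    Lop b a μ t (fun x => ψ x - r * φ x) x = Lop b a μ t ψ x - r * Lop b a μ t φ x := by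
  unfold Lop
  rw [fderiv_gradient_sub_smul hφ hψ, gradient_sub_smul hφ hψ]
  simp only [inner_sub_right, inner_smul_right, ContinuousLinearMap.comp_sub,
    ContinuousLinearMap.comp_smul, ContinuousLinearMap.toLinearMap_sub,
    ContinuousLinearMap.toLinearMap_smul, map_sub, map_smul, smul_eq_mul]
  ring

theorem abs_trace_le {d : ℕ} (A : Ed d →L[ℝ] Ed d) :
    |LinearMap.trace ℝ (Ed d) A.toLinearMap| ≤ d * ‖A‖ := by
  rw [LinearMap.trace_eq_sum_inner _ (EuclideanSpace.basisFun (Fin d) ℝ)]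
  refine (Finset.abs_sum_le_sum_abs _ _).trans ((Finset.sum_le_card_nsmul _ _ ‖A‖ ?_).trans ?_)
  · intro i _
    refine (abs_real_inner_le_norm _ _).trans ?_
    have h1 : ‖(EuclideanSpace.basisFun (Fin d) ℝ) i‖ = 1 :=
      (EuclideanSpace.basisFun (Fin d) ℝ).orthonormal.1 i
    have h2 := A.le_opNorm ((EuclideanSpace.basisFun (Fin d) ℝ) i)
    rw [h1, mul_one] at h2
    rw [h1, one_mul]
    exact h2
  · simp

theorem WBound.abs_Lop_le {d : ℕ} {φ : Ed d → ℝ} {C : ℝ} (h : WBound φ C)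
    (b : ℝ → Ed d → Pm d → Ed d) (a : ℝ → Ed d → Pm d → (Ed d →L[ℝ] Ed d)) (μ : Pm d) (t : ℝ)
    (x : Ed d) : |Lop b a μ t φ x| ≤ C * (1 + d) * wInt b a t x μ := by
  obtain ⟨h0, h1, h2⟩ := h x
  have hC : 0 ≤ C := (abs_nonneg _).trans h0
  have hx : 0 < 1 + ‖x‖ := by positivity
  have hx2 : 0 < 1 + ‖x‖ ^ 2 := by positivity
  have e1 : |⟪b t x μ, gradient φ x⟫| ≤ C * (‖b t x μ‖ / (1 + ‖x‖)) := by
    refine (abs_real_inner_le_norm _ _).trans ?_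
    rw [← mul_div_assoc, le_div_iff₀ hx]
    nlinarith [norm_nonneg (b t x μ)]
  have e2 : |LinearMap.trace ℝ (Ed d)
      ((a t x μ ∘L fderiv ℝ (gradient φ) x).toLinearMap)| ≤
      d * (C * (‖a t x μ‖ / (1 + ‖x‖ ^ 2))) := by
    refine (abs_trace_le _).trans (mul_le_mul_of_nonneg_left ?_ (Nat.cast_nonneg d))
    refine (ContinuousLinearMap.opNorm_comp_le _ _).trans ?_
    rw [← mul_div_assoc, le_div_iff₀ hx2]
    nlinarith [norm_nonneg (a t x μ)]
  have p1 : 0 ≤ C * (‖b t x μ‖ / (1 + ‖x‖)) := by positivity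
  have p2 : 0 ≤ C * (‖a t x μ‖ / (1 + ‖x‖ ^ 2)) := by positivity
  have hd : (0 : ℝ) ≤ d := Nat.cast_nonneg d
  unfold Lop wInt
  refine (abs_add_le _ _).trans ?_
  rw [abs_mul, abs_of_pos (by norm_num : (0 : ℝ) < 1 / 2)]
  nlinarith [mul_nonneg hd p1, mul_nonneg hd p2]

theorem wInt_nonneg {d : ℕ} (b : ℝ → Ed d → Pm d → Ed d)
    (a : ℝ → Ed d → Pm d → (Ed d →L[ℝ] Ed d)) (μ : Pm d) (t : ℝ) (x : Ed d) :
    0 ≤ wInt b a t x μ := by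
  unfold wInt; positivity

theorem gradient_eq_zero_of_notMem_tsupport {d : ℕ} {φ : Ed d → ℝ} {x : Ed d}
    (hx : x ∉ tsupport φ) : gradient φ x = 0 := by
  rw [gradient, fderiv_of_notMem_tsupport ℝ hx, map_zero]

theorem tsupport_gradient_subset {d : ℕ} (φ : Ed d → ℝ) : tsupport (gradient φ) ⊆ tsupport φ :=
  closure_minimal (fun _ hx => by_contra fun h => hx (gradient_eq_zero_of_notMem_tsupport h))
    isClosed_closure

theorem exists_norm_mul_le {X F : Type*} [TopologicalSpace X] [NormedAddCommGroup F] {f : X → F}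
    (hf : Continuous f) (hc : HasCompactSupport f) {w : X → ℝ} (hw : Continuous w) :
    ∃ C, 0 ≤ C ∧ ∀ x, ‖f x‖ * w x ≤ C := by
  have hs : HasCompactSupport fun x => ‖f x‖ * w x := hc.norm.mul_right
  obtain ⟨C, hC⟩ := Continuous.bounded_above_of_compact_support (hf.norm.mul hw) hs
  refine ⟨|C|, abs_nonneg C, fun x => ?_⟩
  have h1 := hC x
  rw [Real.norm_eq_abs] at h1
  exact (le_abs_self _).trans (h1.trans (le_abs_self C))

theorem IsTestPhi.hasCompactSupport_gradient {d : ℕ} {φ : Ed d → ℝ} (h : IsTestPhi φ) :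
    HasCompactSupport (gradient φ) :=
  IsCompact.of_isClosed_subset (s := tsupport φ) h.2 (isClosed_tsupport _)
    (tsupport_gradient_subset φ)

theorem IsTestPhi.exists_wBound {d : ℕ} {φ : Ed d → ℝ} (h : IsTestPhi φ) :
    ∃ C > 0, WBound φ C := by
  have hG := contDiff_gradient h.1
  have hsG := h.hasCompactSupport_gradient
  obtain ⟨A, hA0, hA⟩ := exists_norm_mul_le h.1.continuous h.2 (w := fun _ => 1) continuous_const
  obtain ⟨B, hB0, hB⟩ := exists_norm_mul_le hG.continuous hsG (w := fun x => 1 + ‖x‖)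
    (continuous_const.add continuous_norm)
  obtain ⟨D, hD0, hD⟩ := exists_norm_mul_le (hG.continuous_fderiv (by norm_num)) (hsG.fderiv ℝ)
    (w := fun x => 1 + ‖x‖ ^ 2) (continuous_const.add (continuous_norm.pow 2))
  refine ⟨A + B + D + 1, by positivity, fun x => ⟨?_, ?_, ?_⟩⟩
  · have := hA x
    rw [Real.norm_eq_abs, mul_one] at this
    linarith
  · linarith [hB x]
  · linarith [hD x]

theorem WBound.dilate {d : ℕ} {φ : Ed d → ℝ} {C : ℝ} (h : WBound φ C) (hφ : ContDiff ℝ 2 φ)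
    (n : ℕ) : WBound (fun x => φ ((n + 1 : ℝ)⁻¹ • x)) C := by
  have hG : gradient (fun x => φ ((n + 1 : ℝ)⁻¹ • x)) =
      fun x => (n + 1 : ℝ)⁻¹ • gradient φ ((n + 1 : ℝ)⁻¹ • x) := by
    ext1 x
    simp only [gradient]
    rw [fderiv_comp_smul, map_smul]
  intro x
  obtain ⟨h0, h1, h2⟩ := h ((n + 1 : ℝ)⁻¹ • x)
  set c : ℝ := (n + 1 : ℝ)⁻¹ with hc
  have hc0 : 0 < c := by positivity
  have hc1 : c ≤ 1 := inv_le_one_of_one_le₀ (by simp)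
  have hn : ‖c • x‖ = c * ‖x‖ := by rw [norm_smul, Real.norm_of_nonneg hc0.le]
  rw [hn] at h1 h2
  refine ⟨h0, ?_, ?_⟩
  · rw [hG]
    simp only
    rw [norm_smul, Real.norm_of_nonneg hc0.le]
    refine le_trans ?_ h1
    nlinarith [norm_nonneg (gradient φ (c • x)), norm_nonneg x]
  · have e : fderiv ℝ (gradient fun x => φ (c • x)) x = (c * c) • fderiv ℝ (gradient φ) (c • x) := by
      rw [hG]
      have hd : DifferentiableAt ℝ (fun x => gradient φ (c • x)) x :=
        DifferentiableAt.comp (g := gradient φ) x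
          ((contDiff_gradient hφ).differentiable (by norm_num) _) (differentiableAt_id.const_smul c)
      refine (hd.hasFDerivAt.const_smul c).fderiv.trans ?_
      rw [fderiv_comp_smul, smul_smul]
    rw [e, norm_smul, Real.norm_of_nonneg (by positivity)]
    refine le_trans ?_ h2
    rw [mul_comm (c * c), mul_assoc]
    refine mul_le_mul_of_nonneg_left ?_ (norm_nonneg _)
    nlinarith [sq_nonneg ‖x‖]

/-- The second order jet of a test function on a closed ball. -/
def jetOnBall {d : ℕ} (n : ℕ)
    (φ : {φ : Ed d → ℝ // IsTestPhi φ ∧ tsupport φ ⊆ Metric.closedBall (0 : Ed d) n}) :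
    C(Metric.closedBall (0 : Ed d) n, ℝ × Ed d × (Ed d →L[ℝ] Ed d)) where
  toFun x := (φ.1 x, gradient φ.1 x, fderiv ℝ (gradient φ.1) x)
  continuous_toFun := by
    have h0 := φ.2.1.1.continuous
    have h1 := (contDiff_gradient φ.2.1.1).continuous
    have h2 := (contDiff_gradient φ.2.1.1).continuous_fderiv (by norm_num)
    fun_prop

theorem wBound_sub_of_dist_jetOnBall_lt {d n : ℕ}
    {φ ψ : {φ : Ed d → ℝ // IsTestPhi φ ∧ tsupport φ ⊆ Metric.closedBall (0 : Ed d) n}} {ε : ℝ}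
    (h : dist (jetOnBall n φ) (jetOnBall n ψ) < ε / (1 + n + n ^ 2)) :
    WBound (fun x => φ.1 x - ψ.1 x) ε := by
  have hn : (0 : ℝ) < 1 + n + n ^ 2 := by positivity
  rw [lt_div_iff₀ hn] at h
  set δ := dist (jetOnBall n φ) (jetOnBall n ψ)
  have hδ : 0 ≤ δ := dist_nonneg
  have hδn : 0 ≤ δ * n := by positivity
  have hδn2 : 0 ≤ δ * n ^ 2 := by positivity
  have hε : 0 ≤ ε := by nlinarith
  have hg : gradient (fun x => φ.1 x - ψ.1 x) = fun x => gradient φ.1 x - gradient ψ.1 x := by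
    simpa using gradient_sub_smul ψ.2.1.1 φ.2.1.1 1
  have hf : ∀ x, fderiv ℝ (gradient (fun x => φ.1 x - ψ.1 x)) x =
      fderiv ℝ (gradient φ.1) x - fderiv ℝ (gradient ψ.1) x := fun x => by
    simpa using fderiv_gradient_sub_smul ψ.2.1.1 φ.2.1.1 1 x
  intro x
  rw [hf x, hg]
  by_cases hx : x ∈ Metric.closedBall (0 : Ed d) n
  · have hxn : ‖x‖ ≤ n := by simpa using hx
    have hd := ContinuousMap.dist_apply_le_dist (f := jetOnBall n φ) (g := jetOnBall n ψ) ⟨x, hx⟩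
    simp only [jetOnBall, ContinuousMap.coe_mk, Prod.dist_eq, max_le_iff] at hd
    obtain ⟨d0, d1, d2⟩ := hd
    rw [dist_eq_norm] at d0 d1 d2
    refine ⟨?_, ?_, ?_⟩
    · exact d0.trans (by change δ ≤ ε; nlinarith)
    · refine (mul_le_mul d1 (add_le_add_right hxn 1) (by positivity) hδ).trans ?_
      change δ * _ ≤ ε
      nlinarith
    · refine (mul_le_mul d2 (add_le_add_right (pow_le_pow_left₀ (norm_nonneg x) hxn 2) 1)
        (by positivity) hδ).trans ?_
      change δ * _ ≤ ε
      nlinarith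
  · have h1 : x ∉ tsupport φ.1 := fun h => hx (φ.2.2 h)
    have h2 : x ∉ tsupport ψ.1 := fun h => hx (ψ.2.2 h)
    have h3 : x ∉ tsupport (gradient φ.1) := fun h => h1 (tsupport_gradient_subset _ h)
    have h4 : x ∉ tsupport (gradient ψ.1) := fun h => h2 (tsupport_gradient_subset _ h)
    rw [fderiv_of_notMem_tsupport ℝ h3, fderiv_of_notMem_tsupport ℝ h4]
    simp only [gradient_eq_zero_of_notMem_tsupport h1, gradient_eq_zero_of_notMem_tsupport h2,
      image_eq_zero_of_notMem_tsupport h1, image_eq_zero_of_notMem_tsupport h2]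
    simp [hε]

theorem exists_dense_sequence_test (d : ℕ) : ∃ θ : ℕ → Ed d → ℝ, (∀ k, IsTestPhi (θ k)) ∧
    ∀ ψ : Ed d → ℝ, IsTestPhi ψ → ∀ ε > 0, ∃ k, WBound (fun x => ψ x - θ k x) ε := by
  have key : ∀ n : ℕ, ∃ s : Set {φ : Ed d → ℝ // IsTestPhi φ ∧
      tsupport φ ⊆ Metric.closedBall (0 : Ed d) n}, s.Countable ∧
      ∀ φ, jetOnBall n φ ∈ closure (jetOnBall n '' s) := by
    intro n
    obtain ⟨t, htr, htc, ht⟩ := (TopologicalSpace.IsSeparable.of_separableSpace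
      (range (jetOnBall (d := d) n))).exists_countable_dense_subset
    obtain ⟨s, hs⟩ := subset_range_iff_exists_image_eq.1 htr
    obtain ⟨u, hus, hu⟩ := (surjOn_image (jetOnBall (d := d) n) s).exists_bijOn_subset
    have hcu : u.Countable := by
      refine countable_of_injective_of_countable_image hu.injOn ?_
      rw [hu.image_eq, hs]; exact htc
    refine ⟨u, hcu, fun φ => ?_⟩
    rw [hu.image_eq, hs]
    exact ht (mem_range_self φ)
  choose s hsc hs using key
  have hc : (⋃ n, Subtype.val '' s n : Set (Ed d → ℝ)).Countable :=
    countable_iUnion fun n => (hsc n).image _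
  have h0 : IsTestPhi (fun _ : Ed d => (0 : ℝ)) := ⟨contDiff_const, HasCompactSupport.zero⟩
  obtain ⟨θ, hθ⟩ := (hc.insert fun _ : Ed d => (0 : ℝ)).exists_eq_range (insert_nonempty _ _)
  refine ⟨θ, fun k => ?_, fun ψ hψ ε hε => ?_⟩
  · have : θ k ∈ range θ := mem_range_self k
    rw [← hθ] at this
    rcases this with h | h
    · rw [h]; exact h0
    · obtain ⟨n, φ, -, h⟩ := mem_iUnion.1 h
      rw [← h]; exact φ.2.1
  · obtain ⟨R, hR⟩ := (IsCompact.isBounded hψ.2).subset_closedBall (0 : Ed d)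
    obtain ⟨n, hn⟩ := exists_nat_ge R
    have hψn : tsupport ψ ⊆ Metric.closedBall (0 : Ed d) n :=
      hR.trans (Metric.closedBall_subset_closedBall hn)
    obtain ⟨_, ⟨φ, hφ, rfl⟩, hd⟩ := (Metric.mem_closure_iff
      (α := C(Metric.closedBall (0 : Ed d) n, ℝ × Ed d × (Ed d →L[ℝ] Ed d)))).1 (hs n ⟨ψ, hψ, hψn⟩)
      (ε / (1 + n + n ^ 2)) (by positivity)
    have : φ.1 ∈ range θ := by
      rw [← hθ]
      exact Or.inr (mem_iUnion.2 ⟨n, φ, hφ, rfl⟩)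
    obtain ⟨k, hk⟩ := this
    refine ⟨k, ?_⟩
    rw [hk]
    exact wBound_sub_of_dist_jetOnBall_lt hd

theorem WBound.const_mul {d : ℕ} {φ : Ed d → ℝ} {C : ℝ} (h : WBound φ C) (hφ : ContDiff ℝ 2 φ)
    {r : ℝ} (hr : 0 ≤ r) : WBound (fun x => r * φ x) (r * C) := by
  have hg : gradient (fun x => r * φ x) = fun x => r • gradient φ x := by
    have := gradient_sub_smul hφ (contDiff_const (c := (0 : ℝ))) (-r)
    simpa [gradient_const] using this
  have hf : ∀ x, fderiv ℝ (gradient (fun x => r * φ x)) x = r • fderiv ℝ (gradient φ) x :=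
    fun x => by
      rw [hg]
      exact ((((contDiff_gradient hφ).differentiable (by norm_num)) x).hasFDerivAt.const_smul
        r).fderiv
  intro x
  obtain ⟨h0, h1, h2⟩ := h x
  rw [hf, hg]
  simp only [norm_smul, abs_mul, Real.norm_eq_abs, abs_of_nonneg hr, mul_assoc]
  exact ⟨by gcongr, by gcongr, by gcongr⟩

/-- A smooth bump function equal to one on the unit ball. -/
def unitBump (d : ℕ) : ContDiffBump (0 : Ed d) := ⟨1, 2, one_pos, one_lt_two⟩

/-- Smooth cutoffs exhausting the space. -/
def cutoff (d n : ℕ) (x : Ed d) : ℝ := unitBump d ((n + 1 : ℝ)⁻¹ • x)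

theorem isTestPhi_unitBump (d : ℕ) : IsTestPhi (unitBump d) :=
  ⟨(unitBump d).contDiff, (unitBump d).hasCompactSupport⟩

theorem isTestPhi_cutoff (d n : ℕ) : IsTestPhi (cutoff d n) :=
  ⟨(unitBump d).contDiff.comp (contDiff_const_smul _),
    (unitBump d).hasCompactSupport.comp_smul (by positivity)⟩

theorem cutoff_nonneg (d n : ℕ) (x : Ed d) : 0 ≤ cutoff d n x := (unitBump d).nonneg

theorem cutoff_le_one (d n : ℕ) (x : Ed d) : cutoff d n x ≤ 1 := (unitBump d).le_one

theorem cutoff_eventuallyEq_one {d n : ℕ} {x : Ed d} (hx : ‖x‖ ≤ n) :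
    cutoff d n =ᶠ[𝓝 x] fun _ => 1 := by
  have : {y : Ed d | ‖y‖ < n + 1} ∈ 𝓝 x :=
    (isOpen_lt continuous_norm continuous_const).mem_nhds (by
      change ‖x‖ < n + 1; linarith)
  filter_upwards [this] with y hy
  have hy' : ‖y‖ < n + 1 := hy
  refine (unitBump d).one_of_mem_closedBall ?_
  rw [mem_closedBall_zero_iff, norm_smul, Real.norm_of_nonneg (by positivity)]
  change _ ≤ (1 : ℝ)
  rw [inv_mul_le_iff₀ (by positivity)]
  linarith

theorem Lop_cutoff_eq_zero {d n : ℕ} {x : Ed d} (hx : ‖x‖ ≤ n) (b : ℝ → Ed d → Pm d → Ed d)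
    (a : ℝ → Ed d → Pm d → (Ed d →L[ℝ] Ed d)) (μ : Pm d) (t : ℝ) :
    Lop b a μ t (cutoff d n) x = 0 := by
  have h1 := (cutoff_eventuallyEq_one hx).gradient
  have h0 : gradient (fun _ : Ed d => (1 : ℝ)) = fun _ => 0 := funext fun y => gradient_fun_const y 1
  rw [h0] at h1
  unfold Lop
  rw [h1.fderiv_eq, h1.self_of_nhds]
  simp

/-- A countable family of test functions, dense in the weighted `C²` sense, containing
multiples of the cutoffs. -/
structure IsTestFamily {d : ℕ} (φ : ℕ → Ed d → ℝ) (κ : ℝ) : Prop where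
  test : ∀ k, IsTestPhi (φ k)
  bound : ∀ k, WBound (φ k) (1 / (1 + d))
  dense : ∀ ψ, IsTestPhi ψ → ∀ ε > 0, ∃ (k : ℕ) (r : ℝ), WBound (fun x => ψ x - r * φ k x) ε
  pos : 0 < κ
  cut : ∀ n x, φ (2 * n + 1) x = κ * cutoff d n x

theorem exists_isTestFamily (d : ℕ) : ∃ (φ : ℕ → Ed d → ℝ) (κ : ℝ), IsTestFamily φ κ := by
  obtain ⟨θ, hθ, hd⟩ := exists_dense_sequence_test d
  choose N hN0 hN using fun k => (hθ k).exists_wBound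
  obtain ⟨C, hC0, hC⟩ := (isTestPhi_unitBump d).exists_wBound
  have hcut : ∀ n, WBound (cutoff d n) C := fun n => hC.dilate (isTestPhi_unitBump d).1 n
  have hmul : ∀ {ψ : Ed d → ℝ} {D : ℝ}, IsTestPhi ψ → 0 < D → WBound ψ D →
      IsTestPhi (fun x => (1 / (D * (1 + d))) * ψ x) ∧
      WBound (fun x => (1 / (D * (1 + d))) * ψ x) (1 / (1 + d)) := by
    intro ψ D hψ hD hb
    refine ⟨⟨contDiff_const.mul hψ.1, hψ.2.mul_left⟩, ?_⟩
    have h := hb.const_mul hψ.1 (r := 1 / (D * (1 + d))) (by positivity)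
    convert h using 1
    field_simp
  refine ⟨fun m => if m % 2 = 0 then fun x => (1 / (N (m / 2) * (1 + d))) * θ (m / 2) x else
    fun x => (1 / (C * (1 + d))) * cutoff d (m / 2) x, 1 / (C * (1 + d)), ?_, ?_, ?_, by positivity,
    ?_⟩
  · intro k
    split_ifs
    · exact (hmul (hθ _) (hN0 _) (hN _)).1
    · exact (hmul (isTestPhi_cutoff d _) hC0 (hcut _)).1
  · intro k
    split_ifs
    · exact (hmul (hθ _) (hN0 _) (hN _)).2
    · exact (hmul (isTestPhi_cutoff d _) hC0 (hcut _)).2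
  · intro ψ hψ ε hε
    obtain ⟨k, hk⟩ := hd ψ hψ ε hε
    refine ⟨2 * k, N k * (1 + d), ?_⟩
    have e : (2 * k) / 2 = k := by omega
    have hne : N k * (1 + d) ≠ 0 := by have := hN0 k; positivity
    have e' : (2 * k) % 2 = 0 := by omega
    simp only [e, e', if_true]
    convert hk using 3 with x
    rw [← mul_assoc, mul_one_div, div_self hne, one_mul]
  · intro n x
    have e : (2 * n + 1) / 2 = n := by omega
    have e' : (2 * n + 1) % 2 = 1 := by omega
    simp [e, e']

theorem IsTestPhi.integrable {d : ℕ} {ψ : Ed d → ℝ} (h : IsTestPhi ψ) (μ : Pm d) :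
    Integrable ψ (μ : Measure (Ed d)) :=
  h.1.continuous.integrable_of_hasCompactSupport h.2

theorem IsTestPhi.continuous_integral {d : ℕ} {ψ : Ed d → ℝ} (h : IsTestPhi ψ) :
    Continuous fun μ : Pm d => ∫ x, ψ x ∂(μ : Measure (Ed d)) := by
  obtain ⟨C, -, hC⟩ := h.exists_wBound
  exact ProbabilityMeasure.continuous_integral_boundedContinuousFunction
    (BoundedContinuousFunction.ofNormedAddCommGroup ψ h.1.continuous C fun x => (hC x).1)

theorem WBound.abs_integral_le {d : ℕ} {ψ : Ed d → ℝ} {C : ℝ} (h : WBound ψ C) (μ : Pm d) :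
    |∫ x, ψ x ∂(μ : Measure (Ed d))| ≤ C := by
  have := norm_integral_le_of_norm_le_const (μ := (μ : Measure (Ed d)))
    (f := ψ) (C := C) (Eventually.of_forall fun x => (h x).1)
  simpa using this

/-- The map recording the integrals of a family of test functions. -/
def momentMap {d : ℕ} (φ : ℕ → Ed d → ℝ) (μ : Pm d) : HCube :=
  fun k => projIcc (-1) 1 (by norm_num) (∫ x, φ k x ∂(μ : Measure (Ed d)))

theorem one_div_one_add_le_one (d : ℕ) : (1 : ℝ) / (1 + d) ≤ 1 := by
  rw [div_le_one (by positivity)]; simp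

theorem tendsto_integral_of_momentMap_aux {d : ℕ} {ψ φ : Ed d → ℝ} (hψ : IsTestPhi ψ)
    (hφ : IsTestPhi φ) {ε r : ℝ} (h : WBound (fun x => ψ x - r * φ x) ε) (μ : Pm d) :
    |∫ x, ψ x ∂(μ : Measure (Ed d)) - r * ∫ x, φ x ∂(μ : Measure (Ed d))| ≤ ε := by
  have := h.abs_integral_le μ
  rwa [integral_sub (hψ.integrable μ) ((hφ.integrable μ).const_mul r), integral_const_mul] at this

theorem exists_test_tendsto_measure {d : ℕ} {G : Set (Ed d)} (hG : IsOpen G) :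
    ∃ g : ℕ → Ed d → ℝ, (∀ n, IsTestPhi (g n)) ∧ (∀ n x, 0 ≤ g n x) ∧
      (∀ n x, g n x ≤ G.indicator (fun _ => 1) x) ∧
      ∀ x, Tendsto (fun n => g n x) atTop (𝓝 (G.indicator (fun _ => 1) x)) := by
  obtain ⟨f, hfs, hf, hf0⟩ := hG.exists_contDiff_support_eq (n := ⊤)
  have hout : ∀ x ∉ G, f x = 0 := fun x hx => by rwa [← hfs, Function.notMem_support] at hx
  refine ⟨fun n x => Real.smoothTransition (n * f x) * cutoff d n x, fun n => ⟨?_, ?_⟩,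
    fun n x => mul_nonneg (Real.smoothTransition.nonneg _) (cutoff_nonneg d n x), fun n x => ?_,
    fun x => ?_⟩
  · exact ((Real.smoothTransition.contDiff (n := 2)).comp
      (contDiff_const.mul (hf.of_le (by exact_mod_cast le_top)))).mul (isTestPhi_cutoff d n).1
  · exact (isTestPhi_cutoff d n).2.mul_left
  · by_cases hx : x ∈ G
    · rw [indicator_of_mem hx]
      exact mul_le_one₀ (Real.smoothTransition.le_one _) (cutoff_nonneg d n x)
        (cutoff_le_one d n x)
    · dsimp only
      rw [indicator_of_notMem hx, hout x hx, mul_zero, Real.smoothTransition.zero, zero_mul]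
  · refine tendsto_const_nhds.congr' ?_
    by_cases hx : x ∈ G
    · have hpos : 0 < f x := lt_of_le_of_ne (hf0 (mem_range_self x)).1 (Ne.symm (by rwa [← hfs] at hx))
      obtain ⟨N, hN⟩ := exists_nat_ge ((f x)⁻¹)
      obtain ⟨N', hN'⟩ := exists_nat_ge ‖x‖
      filter_upwards [eventually_ge_atTop N, eventually_ge_atTop N'] with n hn hn'
      have h1 : (1 : ℝ) ≤ n * f x := by
        have : (f x)⁻¹ ≤ n := hN.trans (by exact_mod_cast hn)
        calc (1 : ℝ) = (f x)⁻¹ * f x := (inv_mul_cancel₀ hpos.ne').symm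
          _ ≤ n * f x := by gcongr
      rw [indicator_of_mem hx, Real.smoothTransition.one_of_one_le h1, one_mul]
      exact (cutoff_eventuallyEq_one (hN'.trans (by exact_mod_cast hn'))).self_of_nhds.symm
    · filter_upwards with n
      rw [indicator_of_notMem hx, hout x hx, mul_zero, Real.smoothTransition.zero, zero_mul]

theorem tendsto_of_forall_test {d : ℕ} {ι : Type*} {L : Filter ι} [L.IsCountablyGenerated]
    {μs : ι → Pm d} {μ : Pm d}
    (h : ∀ ψ, IsTestPhi ψ → Tendsto (fun i => ∫ x, ψ x ∂(μs i : Measure (Ed d))) L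
      (𝓝 (∫ x, ψ x ∂(μ : Measure (Ed d))))) : Tendsto μs L (𝓝 μ) := by
  refine tendsto_of_forall_isOpen_le_liminf' fun G hG => ?_
  obtain ⟨g, hg, hg0, hgG, hlim⟩ := exists_test_tendsto_measure hG
  have hint : ∀ (ν : Pm d), Integrable (G.indicator fun _ => (1 : ℝ)) (ν : Measure (Ed d)) :=
    fun ν => (integrable_const 1).indicator hG.measurableSet
  have hval : ∀ ν : Pm d, ENNReal.ofReal (∫ x, G.indicator (fun _ => (1 : ℝ)) x
      ∂(ν : Measure (Ed d))) = (ν : Measure (Ed d)) G := fun ν => by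
    rw [integral_indicator_const _ hG.measurableSet, smul_eq_mul, mul_one, ofReal_measureReal]
  have hle : ∀ n, ENNReal.ofReal (∫ x, g n x ∂(μ : Measure (Ed d))) ≤
      L.liminf fun i => (μs i : Measure (Ed d)) G := fun n => by
    rcases L.eq_or_neBot with rfl | hL
    · simp
    have ht := ENNReal.tendsto_ofReal (h _ (hg n))

    rw [← ht.liminf_eq]
    refine liminf_le_liminf (Eventually.of_forall fun i => ?_)
    rw [← hval]
    exact ENNReal.ofReal_le_ofReal (integral_mono ((hg n).integrable _) (hint _) (hgG n))
  refine le_of_tendsto' (x := atTop) (f := fun n => ENNReal.ofReal (∫ x, g n x ∂(μ : Measure (Ed d)))) ?_ hle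
  rw [← hval]
  refine ENNReal.tendsto_ofReal (tendsto_integral_of_dominated_convergence (fun _ => 1)
    (fun n => ((hg n).integrable _).1) (integrable_const _) (fun n => ?_)
    (Eventually.of_forall hlim))
  filter_upwards with x
  rw [Real.norm_of_nonneg (hg0 n x)]
  exact (hgG n x).trans (indicator_le_self' (fun _ _ => zero_le_one) x)

namespace IsTestFamily

variable {d : ℕ} {φ : ℕ → Ed d → ℝ} {κ : ℝ}

theorem coe_momentMap (h : IsTestFamily φ κ) (μ : Pm d) (k : ℕ) :
    (momentMap φ μ k : ℝ) = ∫ x, φ k x ∂(μ : Measure (Ed d)) := by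
  have h1 := ((h.bound k).abs_integral_le μ).trans (one_div_one_add_le_one d)
  rw [momentMap, projIcc_of_mem _ (abs_le.1 h1)]

theorem continuous_momentMap (h : IsTestFamily φ κ) : Continuous (momentMap φ) :=
  continuous_pi fun k => continuous_projIcc.comp (h.test k).continuous_integral

theorem isEmbedding_momentMap (h : IsTestFamily φ κ) : IsEmbedding (momentMap φ) := by
  refine IsInducing.isEmbedding (isInducing_iff_nhds.2 fun μ => le_antisymm
    (h.continuous_momentMap.tendsto μ).le_comap ?_)
  have hid : Tendsto id (comap (momentMap φ) (𝓝 (momentMap φ μ))) (𝓝 μ) := by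
    refine tendsto_of_forall_test fun ψ hψ => ?_
    rw [Metric.tendsto_nhds]
    intro ε hε
    obtain ⟨k, r, hk⟩ := h.dense ψ hψ (ε / 4) (by positivity)
    have hc : Tendsto (fun ν : Pm d => r * ∫ x, φ k x ∂(ν : Measure (Ed d)))
        (comap (momentMap φ) (𝓝 (momentMap φ μ))) (𝓝 (r * ∫ x, φ k x ∂(μ : Measure (Ed d)))) := by
      refine Tendsto.const_mul r ?_
      simp_rw [← h.coe_momentMap]
      have hcc : Continuous fun y : HCube => (y k : ℝ) :=
        continuous_subtype_val.comp (continuous_apply k)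
      exact (hcc.tendsto (momentMap φ μ)).comp tendsto_comap
    filter_upwards [(Metric.tendsto_nhds.1 hc) (ε / 4) (by positivity)] with ν hν
    have h1 := tendsto_integral_of_momentMap_aux hψ (h.test k) hk ν
    have h2 := tendsto_integral_of_momentMap_aux hψ (h.test k) hk μ
    rw [Real.dist_eq] at hν ⊢
    rw [abs_lt] at hν ⊢
    rw [abs_le] at h1 h2
    constructor <;> simp only [id] <;> linarith [h1.1, h1.2, h2.1, h2.2, hν.1, hν.2]
  exact hid

end IsTestFamily

instance (d : ℕ) : SecondCountableTopology (Pm d) := by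
  obtain ⟨φ, κ, h⟩ := exists_isTestFamily d
  exact h.isEmbedding_momentMap.secondCountableTopology

theorem tendsto_integral_cutoff {d : ℕ} (μ : Pm d) :
    Tendsto (fun n => ∫ x, cutoff d n x ∂(μ : Measure (Ed d))) atTop (𝓝 1) := by
  have h1 : (1 : ℝ) = ∫ _, (1 : ℝ) ∂(μ : Measure (Ed d)) := by simp
  rw [h1]
  refine tendsto_integral_of_dominated_convergence (fun _ => 1)
    (fun n => ((isTestPhi_cutoff d n).integrable μ).1) (integrable_const _) (fun n => ?_) ?_
  · filter_upwards with x
    rw [Real.norm_of_nonneg (cutoff_nonneg d n x)]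
    exact cutoff_le_one d n x
  · filter_upwards with x
    refine tendsto_const_nhds.congr' ?_
    obtain ⟨N, hN⟩ := exists_nat_ge ‖x‖
    filter_upwards [eventually_ge_atTop N] with n hn
    exact (cutoff_eventuallyEq_one (hN.trans (by exact_mod_cast hn))).self_of_nhds.symm

theorem cutoff_eq_zero {d n : ℕ} {x : Ed d} (hx : 2 * (n + 1 : ℝ) < ‖x‖) : cutoff d n x = 0 := by
  refine (unitBump d).zero_of_le_dist ?_
  rw [dist_zero_right, norm_smul, Real.norm_of_nonneg (by positivity)]
  change (2 : ℝ) ≤ _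
  rw [inv_mul_eq_div, le_div_iff₀ (by positivity)]
  exact hx.le

theorem measure_norm_gt_le {d n : ℕ} {r : ℝ} (hr : 2 * (n + 1 : ℝ) ≤ r) (μ : Pm d) :
    (μ : Measure (Ed d)) {x | r < ‖x‖} ≤
      ENNReal.ofReal (1 - ∫ x, cutoff d n x ∂(μ : Measure (Ed d))) := by
  have hm : MeasurableSet {x : Ed d | r < ‖x‖} :=
    (isOpen_lt continuous_const continuous_norm).measurableSet
  have hc := (isTestPhi_cutoff d n).integrable μ
  have h1 : 1 - ∫ x, cutoff d n x ∂(μ : Measure (Ed d)) =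
      ∫ x, (1 - cutoff d n x) ∂(μ : Measure (Ed d)) := by
    rw [integral_sub (integrable_const _) hc]; simp
  rw [h1, ← ofReal_measureReal]
  refine ENNReal.ofReal_le_ofReal ?_
  rw [← mul_one ((μ : Measure (Ed d)).real _), ← smul_eq_mul, ← integral_indicator_const _ hm]
  refine integral_mono ((integrable_const _).indicator hm) ((integrable_const _).sub hc) fun x => ?_
  by_cases hx : r < ‖x‖
  · rw [indicator_of_mem (show x ∈ {x : Ed d | r < ‖x‖} from hx)]
    simp [cutoff_eq_zero (hr.trans_lt hx)]
  · rw [indicator_of_notMem (show x ∉ {x : Ed d | r < ‖x‖} from hx)]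
    simpa using cutoff_le_one d n x

namespace IsTestFamily

variable {d : ℕ} {φ : ℕ → Ed d → ℝ} {κ : ℝ}

theorem momentMap_cutoff (h : IsTestFamily φ κ) (μ : Pm d) (n : ℕ) :
    (momentMap φ μ (2 * n + 1) : ℝ) = κ * ∫ x, cutoff d n x ∂(μ : Measure (Ed d)) := by
  rw [h.coe_momentMap]
  simp_rw [h.cut]
  rw [integral_const_mul]

theorem mem_range_momentMap (h : IsTestFamily φ κ) {y : HCube}
    (hy : y ∈ closure (range (momentMap φ))) (hm : ∀ ε > 0, ∃ n, κ - ε < (y (2 * n + 1) : ℝ)) :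
    y ∈ range (momentMap φ) := by
  obtain ⟨u, hu, hlim⟩ := mem_closure_iff_seq_limit.1 hy
  choose μ hμ using hu
  obtain rfl : (fun j => momentMap φ (μ j)) = u := funext hμ
  have hcoord : ∀ n, Tendsto (fun j => ∫ x, cutoff d n x ∂(μ j : Measure (Ed d))) atTop
      (𝓝 (κ⁻¹ * y (2 * n + 1))) := fun n => by
    have hcc : Continuous fun y : HCube => (y (2 * n + 1) : ℝ) :=
      continuous_subtype_val.comp (continuous_apply _)
    have := ((hcc.tendsto y).comp hlim).const_mul κ⁻¹
    refine this.congr fun j => ?_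
    simp only [Function.comp]
    rw [h.momentMap_cutoff, inv_mul_cancel_left₀ h.pos.ne']
  have htight : IsTightMeasureSet (range fun j => (μ j : Measure (Ed d))) := by
    refine isTightMeasureSet_range_of_tendsto_limsup_measure_norm_gt ?_
    rw [ENNReal.tendsto_nhds_zero]
    intro ε hε
    obtain ⟨δ, hδ0, hδ⟩ : ∃ δ : ℝ, 0 < δ ∧ ENNReal.ofReal δ ≤ ε := by
      rcases eq_or_ne ε ∞ with rfl | hne
      · exact ⟨1, one_pos, le_top⟩
      · exact ⟨ε.toReal, ENNReal.toReal_pos hε.ne' hne, ENNReal.ofReal_toReal_le⟩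
    obtain ⟨n, hn⟩ := hm (κ * δ) (mul_pos h.pos hδ0)
    filter_upwards [eventually_ge_atTop (2 * (n + 1 : ℝ))] with r hr
    have ht := ENNReal.tendsto_ofReal ((hcoord n).const_sub 1)
    refine (limsup_le_limsup (Eventually.of_forall fun j => measure_norm_gt_le hr (μ j))).trans ?_
    rw [ht.limsup_eq]
    refine (ENNReal.ofReal_le_ofReal ?_).trans hδ
    have : 1 - δ ≤ κ⁻¹ * y (2 * n + 1) := by
      rw [inv_mul_eq_div, le_div_iff₀ h.pos]
      linarith
    linarith
  have hset : {(ν : Measure (Ed d)) | ν ∈ range μ} = range fun j => (μ j : Measure (Ed d)) := by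
    ext ν
    constructor
    · rintro ⟨_, ⟨j, rfl⟩, rfl⟩; exact ⟨j, rfl⟩
    · rintro ⟨j, rfl⟩; exact ⟨_, ⟨j, rfl⟩, rfl⟩
  have hcomp : IsCompact (closure (range μ)) :=
    isCompact_closure_of_isTightMeasureSet (by rw [hset]; exact htight)
  obtain ⟨ν, -, ψ, hψ, hν⟩ := hcomp.tendsto_subseq (x := μ) fun j => subset_closure (mem_range_self j)
  exact ⟨ν, tendsto_nhds_unique ((h.continuous_momentMap.tendsto ν).comp hν)
    (hlim.comp hψ.tendsto_atTop)⟩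

theorem exists_lt_momentMap (h : IsTestFamily φ κ) (μ : Pm d) {ε : ℝ} (hε : 0 < ε) :
    ∃ n, κ - ε < (momentMap φ μ (2 * n + 1) : ℝ) := by
  have ht := (tendsto_integral_cutoff μ).const_mul κ
  rw [mul_one] at ht
  obtain ⟨n, hn⟩ := (ht.eventually (lt_mem_nhds (sub_lt_self κ hε))).exists
  exact ⟨n, by rwa [h.momentMap_cutoff]⟩

theorem measurableSet_range_momentMap (h : IsTestFamily φ κ) :
    MeasurableSet (range (momentMap φ)) := by
  have heq : range (momentMap φ) = closure (range (momentMap φ)) ∩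
      ⋂ m : ℕ, ⋃ n : ℕ, {y : HCube | κ - 1 / (m + 1 : ℝ) < (y (2 * n + 1) : ℝ)} := by
    refine Subset.antisymm ?_ ?_
    · rintro _ ⟨μ, rfl⟩
      refine ⟨subset_closure (mem_range_self μ), mem_iInter.2 fun m => mem_iUnion.2 ?_⟩
      exact h.exists_lt_momentMap μ (by positivity)
    · rintro y ⟨hy, hm⟩
      refine h.mem_range_momentMap hy fun ε hε => ?_
      obtain ⟨m, hmε⟩ := exists_nat_one_div_lt hε
      obtain ⟨n, hn⟩ := mem_iUnion.1 (mem_iInter.1 hm m)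
      have hn' : κ - 1 / (m + 1 : ℝ) < (y (2 * n + 1) : ℝ) := hn
      exact ⟨n, by linarith⟩
  rw [heq]
  refine isClosed_closure.measurableSet.inter (MeasurableSet.iInter fun m =>
    MeasurableSet.iUnion fun n => ?_)
  have hcc : Continuous fun y : HCube => (y (2 * n + 1) : ℝ) :=
    continuous_subtype_val.comp (continuous_apply _)
  exact (isOpen_lt continuous_const hcc).measurableSet

theorem measurableEmbedding_momentMap (h : IsTestFamily φ κ) :
    MeasurableEmbedding (momentMap φ) :=
  h.isEmbedding_momentMap.measurableEmbedding h.measurableSet_range_momentMap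

end IsTestFamily

theorem nonempty_Pm (d : ℕ) : Nonempty (Pm d) := ⟨⟨Measure.dirac 0, Measure.dirac.isProbabilityMeasure⟩⟩

namespace IsTestFamily

variable {d : ℕ} {φ : ℕ → Ed d → ℝ} {κ : ℝ}

theorem exists_leftInverse (h : IsTestFamily φ κ) :
    ∃ r : HCube → Pm d, Measurable r ∧ ∀ μ, r (momentMap φ μ) = μ := by
  obtain ⟨r, hr, hrl⟩ := h.measurableEmbedding_momentMap.exists_measurable_extend measurable_id
    fun _ => nonempty_Pm d
  exact ⟨r, hr, fun μ => congrFun hrl μ⟩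

end IsTestFamily

theorem measurable_curve {Ω : Type*} [MeasurableSpace Ω] {T : ℝ} {d : ℕ} {f : Ω → CurveSp T d}
    (hf : ∀ t, Measurable fun ω => f ω t) : Measurable f := by
  have e : borel (CurveSp T d) = _ := borel_continuousMap_eq_iSup_comap
  intro s hs
  have hs' : MeasurableSet[⨆ t, (borel (Pm d)).comap fun c : CurveSp T d => c t] s := by
    rw [← e]; exact hs
  have hle : (⨆ t, (borel (Pm d)).comap fun c : CurveSp T d => c t) ≤
      MeasurableSpace.map f inferInstance :=
    iSup_le fun t => MeasurableSpace.comap_le_iff_le_map.2 fun A hA => hf t hA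
  exact hle s hs'

theorem IsTestXi.eq_zero {T : ℝ} {ξ : ℝ → ℝ} (h : IsTestXi T ξ) {t : ℝ} (ht : t ∉ Ioo 0 T) :
    ξ t = 0 := by
  by_contra hne
  exact ht (h.2.2 hne)

theorem isTestXi_primitive {T : ℝ} {η : ℝ → ℝ} (hη : Continuous η)
    (hs : Function.support η ⊆ Ioo 0 T) (h0 : ∫ t in (0:ℝ)..T, η t = 0) :
    IsTestXi T (fun t => ∫ r in (0:ℝ)..t, η r) := by
  have hz : ∀ t, t ∉ Ioo 0 T → ∫ r in (0:ℝ)..t, η r = 0 := by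
    intro t ht
    by_cases h1 : t ≤ 0
    · rw [intervalIntegral.integral_congr (g := fun _ => (0:ℝ))]
      · simp
      · intro r hr
        rw [uIcc_of_ge h1] at hr
        by_contra hne
        exact absurd (hs hne).1 (not_lt.mpr hr.2)
    · have h2 : T ≤ t := by
        by_contra h2
        exact ht ⟨not_le.mp h1, not_le.mp h2⟩
      rw [← intervalIntegral.integral_add_adjacent_intervals
        (hη.intervalIntegrable 0 T) (hη.intervalIntegrable T t), h0, zero_add,
        intervalIntegral.integral_congr (g := fun _ => (0:ℝ))]
      · simp
      · intro r hr
        rw [uIcc_of_le h2] at hr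
        by_contra hne
        exact absurd (hs hne).2 (not_lt.mpr hr.1)
  have hd : ∀ t, HasDerivAt (fun t => ∫ r in (0:ℝ)..t, η r) (η t) t := fun t =>
    intervalIntegral.integral_hasDerivAt_right (hη.intervalIntegrable 0 t)
      (hη.stronglyMeasurableAtFilter _ _) hη.continuousAt
  refine ⟨?_, ?_, ?_⟩
  · rw [contDiff_one_iff_deriv]
    refine ⟨fun t => (hd t).differentiableAt, ?_⟩
    have : deriv (fun t => ∫ r in (0:ℝ)..t, η r) = η := funext fun t => (hd t).deriv
    rw [this]
    exact hη
  · exact HasCompactSupport.intro isCompact_Icc fun t ht =>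
      hz t fun h => ht (Ioo_subset_Icc_self h)
  · intro t ht
    by_contra h
    exact ht (hz t h)

theorem eq_const_of_weak {T : ℝ} (hT : 0 < T) {G : ℝ → ℝ} (hG : ContinuousOn G (Icc 0 T))
    (h : ∀ ξ, IsTestXi T ξ → ∫ t in (0:ℝ)..T, deriv ξ t * G t = 0) :
    ∀ t ∈ Icc 0 T, G t = G 0 := by
  let ρ : ContDiffBump (T / 2) := ⟨T / 8, T / 4, by linarith, by linarith⟩
  have hρs : Function.support (ρ.normed volume) ⊆ Ioo 0 T := by
    rw [ρ.support_normed_eq, Real.ball_eq_Ioo]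
    intro x hx
    change T / 2 - T / 4 < x ∧ x < T / 2 + T / 4 at hx
    exact ⟨by linarith [hx.1], by linarith [hx.2]⟩
  have hρc : Continuous (ρ.normed volume) := ρ.continuous_normed
  have full : ∀ f : ℝ → ℝ, Function.support f ⊆ Ioo 0 T → ∫ t in (0:ℝ)..T, f t = ∫ t, f t := by
    intro f hf
    exact intervalIntegral.integral_eq_integral_of_support_subset
      (hf.trans Ioo_subset_Ioc_self)
  have hρ1 : ∫ t in (0:ℝ)..T, ρ.normed volume t = 1 := by
    rw [full _ hρs]
    exact ρ.integral_normed
  set c : ℝ := ∫ t in (0:ℝ)..T, ρ.normed volume t * G t with hc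
  have hGi : ∀ f : ℝ → ℝ, Continuous f →
      IntervalIntegrable (fun t => f t * G t) volume 0 T := fun f hf => by
    apply ContinuousOn.intervalIntegrable
    rw [uIcc_of_le hT.le]
    exact hf.continuousOn.mul hG
  have key : ∀ η : ℝ → ℝ, Continuous η → Function.support η ⊆ Ioo 0 T →
      ∫ t in (0:ℝ)..T, η t * (G t - c) = 0 := by
    intro η hη hηs
    set m : ℝ := ∫ t in (0:ℝ)..T, η t with hm
    have hζc : Continuous fun t => η t - m * ρ.normed volume t :=
      hη.sub (continuous_const.mul hρc)
    have hζ := isTestXi_primitive hζc (by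
        intro t ht
        by_contra hne
        apply ht
        have h1 : η t = 0 := by by_contra h; exact hne (hηs h)
        have h2 : ρ.normed volume t = 0 := by by_contra h; exact hne (hρs h)
        simp [h1, h2]) (by
        rw [intervalIntegral.integral_sub (hη.intervalIntegrable _ _)
          ((hρc.intervalIntegrable _ _).const_mul m),
          intervalIntegral.integral_const_mul, hρ1, ← hm]
        ring)
    have h1 := h _ hζ
    have hd : ∀ t, deriv (fun t => ∫ r in (0:ℝ)..t, (η r - m * ρ.normed volume r)) t
        = η t - m * ρ.normed volume t := fun t =>
      (intervalIntegral.integral_hasDerivAt_right (hζc.intervalIntegrable 0 t)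
        (hζc.stronglyMeasurableAtFilter _ _) hζc.continuousAt).deriv
    simp only [hd] at h1
    have e1 : ∀ t, (η t - m * ρ.normed volume t) * G t
        = η t * G t - m * (ρ.normed volume t * G t) := fun t => by ring
    simp only [e1] at h1
    rw [intervalIntegral.integral_sub (hGi η hη) ((hGi _ hρc).const_mul m),
      intervalIntegral.integral_const_mul, ← hc] at h1
    have e2 : ∀ t, η t * (G t - c) = η t * G t - c * η t := fun t => by ring
    simp only [e2]
    rw [intervalIntegral.integral_sub (hGi η hη)
      ((hη.intervalIntegrable _ _).const_mul c),
      intervalIntegral.integral_const_mul, ← hm]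
    linarith
  have hae : ∀ᵐ t, t ∈ Ioo 0 T → G t - c = 0 := by
    apply isOpen_Ioo.ae_eq_zero_of_integral_contDiff_smul_eq_zero
    · apply ContinuousOn.locallyIntegrableOn _ measurableSet_Ioo
      exact (hG.mono Ioo_subset_Icc_self).sub continuousOn_const
    · intro g hg _ hgs
      have hs := (subset_tsupport g).trans hgs
      have := key g hg.continuous hs
      rw [full] at this
      · simpa only [smul_eq_mul] using this
      · intro t ht
        apply hs
        intro h0
        exact ht (by simp [h0])
  have hIoo : ∀ t ∈ Ioo 0 T, G t = c := by
    have h1 : G =ᵐ[volume.restrict (Ioo 0 T)] fun _ => c := by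
      rw [Filter.EventuallyEq, ae_restrict_iff' measurableSet_Ioo]
      filter_upwards [hae] with t ht hm
      linarith [ht hm]
    exact fun t ht => Measure.eqOn_open_of_ae_eq h1 isOpen_Ioo (hG.mono Ioo_subset_Icc_self)
      continuousOn_const ht
  have hIcc : EqOn G (fun _ => c) (Icc 0 T) := by
    refine EqOn.of_subset_closure (s := Ioo 0 T) (fun t ht => hIoo t ht) hG continuousOn_const
      Ioo_subset_Icc_self ?_
    rw [closure_Ioo hT.ne]
  intro t ht
  exact (hIcc ht).trans (hIcc (left_mem_Icc.mpr hT.le)).symm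

theorem IsTestXi.integral_deriv_mul {T : ℝ} {ξ f : ℝ → ℝ} (hξ : IsTestXi T ξ)
    (hf : AbsolutelyContinuousOnInterval f 0 T) :
    ∫ t in (0:ℝ)..T, deriv ξ t * f t = - ∫ t in (0:ℝ)..T, ξ t * deriv f t := by
  have hx : AbsolutelyContinuousOnInterval ξ 0 T := hξ.1.contDiffOn.absolutelyContinuousOnInterval
  rw [hx.integral_mul_deriv_eq_deriv_mul hf, hξ.eq_zero (t := 0) (by simp),
    hξ.eq_zero (t := T) (by simp)]
  ring

theorem integral_mul_deriv_primitive {T : ℝ} {f B : ℝ → ℝ} (ξ : ℝ → ℝ)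
    (hf : ∀ᵐ t, t ∈ uIcc 0 T → HasDerivAt f (B t) t) :
    ∫ t in (0:ℝ)..T, ξ t * deriv f t = ∫ t in (0:ℝ)..T, ξ t * B t := by
  apply intervalIntegral.integral_congr_ae
  filter_upwards [hf] with t ht hm
  rw [(ht (uIoc_subset_uIcc hm)).deriv]

/-- The fundamental lemma of the calculus of variations: a weak derivative on `(0,T)` is a
strong one. -/
theorem sub_eq_integral_of_weak {T : ℝ} (hT : 0 ≤ T) {A B : ℝ → ℝ}
    (hA : ContinuousOn A (Icc 0 T)) (hB : IntervalIntegrable B volume 0 T)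
    (h : ∀ ξ, IsTestXi T ξ →
      ∫ t in (0:ℝ)..T, deriv ξ t * A t = - ∫ t in (0:ℝ)..T, ξ t * B t) :
    ∀ t ∈ Icc 0 T, A t - A 0 = ∫ r in (0:ℝ)..t, B r := by
  rcases hT.eq_or_lt with rfl | hT'
  · intro t ht
    have : t = 0 := le_antisymm ht.2 ht.1
    simp [this]
  have hac := hB.absolutelyContinuousOnInterval_intervalIntegral (c := 0) (by simp)
  have hd : ∀ᵐ t, t ∈ uIcc 0 T → HasDerivAt (fun x => ∫ v in (0:ℝ)..x, B v) (B t) t := by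
    filter_upwards [hB.ae_hasDerivAt_integral] with t ht hm using ht hm 0 (by simp)
  have hPc : ContinuousOn (fun x => ∫ v in (0:ℝ)..x, B v) (Icc 0 T) := by
    have := hac.continuousOn
    rwa [uIcc_of_le hT] at this
  have key := eq_const_of_weak hT' (hA.sub hPc) (by
    intro ξ hξ
    have h1 := h ξ hξ
    have h2 := hξ.integral_deriv_mul hac
    rw [integral_mul_deriv_primitive ξ hd] at h2
    have hdc : Continuous (deriv ξ) := hξ.1.continuous_deriv le_rfl
    simp only [Pi.sub_apply, mul_sub]
    rw [intervalIntegral.integral_sub, h1, h2, sub_self]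
    · apply ContinuousOn.intervalIntegrable
      rw [uIcc_of_le hT]
      exact hdc.continuousOn.mul hA
    · apply ContinuousOn.intervalIntegrable
      rw [uIcc_of_le hT]
      exact hdc.continuousOn.mul hPc)
  intro t ht
  have := key t ht
  simp at this
  linarith

theorem LipschitzOnWith.comp_absolutelyContinuousOnInterval {X Y : Type*} [PseudoMetricSpace X]
    [PseudoMetricSpace Y] {g : X → Y} {f : ℝ → X} {K : NNReal} {s : Set X} {a b : ℝ}
    (hg : LipschitzOnWith K g s) (hf : AbsolutelyContinuousOnInterval f a b)
    (hs : MapsTo f (uIcc a b) s) : AbsolutelyContinuousOnInterval (g ∘ f) a b := by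
  rw [absolutelyContinuousOnInterval_iff] at hf ⊢
  intro ε hε
  obtain ⟨δ, hδ, h⟩ := hf (ε / (K + 1)) (by positivity)
  refine ⟨δ, hδ, fun E hE hl => ?_⟩
  have h1 := h E hE hl
  calc _ ≤ ∑ i ∈ Finset.range E.1, K * dist (f (E.2 i).1) (f (E.2 i).2) :=
        Finset.sum_le_sum fun i hi => hg.dist_le_mul _ (hs (hE.1 i hi).1) _ (hs (hE.1 i hi).2)
    _ = K * ∑ i ∈ Finset.range E.1, dist (f (E.2 i).1) (f (E.2 i).2) :=
        (Finset.mul_sum _ _ _).symm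
    _ ≤ K * (ε / (K + 1)) := by gcongr
    _ < (K + 1) * (ε / (K + 1)) := by gcongr; linarith
    _ = ε := by field_simp

theorem absolutelyContinuousOnInterval_pi {ι : Type*} [Fintype ι] {f : ℝ → ι → ℝ} {a b : ℝ}
    (hf : ∀ i, AbsolutelyContinuousOnInterval (fun t => f t i) a b) :
    AbsolutelyContinuousOnInterval f a b := by
  unfold AbsolutelyContinuousOnInterval at *
  refine squeeze_zero (fun E => Finset.sum_nonneg fun _ _ => dist_nonneg) (fun E => ?_)
    (by simpa using tendsto_finsetSum Finset.univ fun i _ => hf i)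
  rw [Finset.sum_comm]
  refine Finset.sum_le_sum fun n _ => ?_
  refine (dist_pi_le_iff (Finset.sum_nonneg fun _ _ => dist_nonneg)).mpr fun i => ?_
  exact Finset.single_le_sum (f := fun i => dist (f (E.2 n).1 i) (f (E.2 n).2 i))
    (fun _ _ => dist_nonneg) (Finset.mem_univ i)

theorem integral_deriv_mul_comp {T : ℝ} (hT : 0 ≤ T) {K : ℕ} {Ψ : (Fin K → ℝ) → ℝ}
    (hΨ : ContDiff ℝ 1 Ψ) {A B : ℝ → Fin K → ℝ}
    (hB : ∀ m, IntervalIntegrable (fun t => B t m) volume 0 T)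
    (h : ∀ m, ∀ t ∈ Icc 0 T, A t m - A 0 m = ∫ r in (0:ℝ)..t, B r m)
    {ξ : ℝ → ℝ} (hξ : IsTestXi T ξ) :
    ∫ t in (0:ℝ)..T, deriv ξ t * Ψ (A t)
      = - ∫ t in (0:ℝ)..T, ξ t * ∑ m, fderiv ℝ Ψ (A t) (Pi.single m 1) * B t m := by
  let P : ℝ → Fin K → ℝ := fun t m => A 0 m + ∫ r in (0:ℝ)..t, B r m
  have hPA : ∀ t ∈ Icc 0 T, A t = P t := fun t ht => by
    ext m
    simp only [P, ← h m t ht]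
    ring
  have hPac : AbsolutelyContinuousOnInterval P 0 T := by
    refine absolutelyContinuousOnInterval_pi fun m => ?_
    have h1 := (hB m).absolutelyContinuousOnInterval_intervalIntegral (c := 0) (by simp)
    have h2 : AbsolutelyContinuousOnInterval (fun _ : ℝ => A 0 m) 0 T :=
      (contDiff_const (n := 1)).contDiffOn.absolutelyContinuousOnInterval
    exact h2.fun_add h1
  have hPc := hPac.continuousOn
  obtain ⟨R, hR⟩ := ((isCompact_uIcc (a := (0:ℝ)) (b := T)).image_of_continuousOn
    hPc).isBounded.subset_closedBall 0
  obtain ⟨L, hL⟩ := hΨ.contDiffOn.exists_lipschitzOnWith (by simp)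
    (convex_closedBall (0 : Fin K → ℝ) R) (isCompact_closedBall _ _)
  have hac := hL.comp_absolutelyContinuousOnInterval hPac (mapsTo_iff_image_subset.mpr hR)
  have hd : ∀ᵐ t, t ∈ uIcc 0 T →
      HasDerivAt (Ψ ∘ P) (∑ m, fderiv ℝ Ψ (P t) (Pi.single m 1) * B t m) t := by
    have h1 : ∀ᵐ t, ∀ m, t ∈ uIcc 0 T →
        HasDerivAt (fun x => ∫ v in (0:ℝ)..x, B v m) (B t m) t := by
      rw [ae_all_iff]
      intro m
      filter_upwards [(hB m).ae_hasDerivAt_integral] with t ht hm using ht hm 0 (by simp)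
    filter_upwards [h1] with t ht hm
    have hP : HasDerivAt P (B t) t := by
      rw [hasDerivAt_pi]
      intro m
      exact (ht m hm).const_add (A 0 m)
    have := ((hΨ.differentiable (by simp)) (P t)).hasFDerivAt.comp_hasDerivAt t hP
    have hsum : fderiv ℝ Ψ (P t) (B t) = ∑ m, fderiv ℝ Ψ (P t) (Pi.single m (B t m)) := by
      rw [← map_sum, Finset.univ_sum_single]
    rw [hsum] at this
    refine this.congr_deriv ?_
    refine Finset.sum_congr rfl fun m _ => ?_
    have : (Pi.single m (B t m) : Fin K → ℝ) = B t m • Pi.single m (1:ℝ) := by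
      rw [← Pi.single_smul, smul_eq_mul, mul_one]
    rw [this, map_smul, smul_eq_mul, mul_comm]
  have h1 := hξ.integral_deriv_mul hac
  rw [integral_mul_deriv_primitive ξ hd] at h1
  have e : ∀ t ∈ uIcc 0 T, A t = P t := by
    rw [uIcc_of_le hT]; exact hPA
  rw [intervalIntegral.integral_congr (g := fun t => deriv ξ t * (Ψ ∘ P) t), h1]
  · congr 1
    refine intervalIntegral.integral_congr fun t ht => ?_
    simp only [e t ht]
  · intro t ht
    simp only [e t ht, Function.comp_apply]

section Coefficients

variable {d : ℕ} {b : ℝ → Ed d → Pm d → Ed d} {a : ℝ → Ed d → Pm d → (Ed d →L[ℝ] Ed d)}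

theorem measurable_wInt (hb : Measurable fun p : ℝ × Ed d × Pm d => b p.1 p.2.1 p.2.2)
    (ha : Measurable fun p : ℝ × Ed d × Pm d => a p.1 p.2.1 p.2.2) :
    Measurable fun p : ℝ × Ed d × Pm d => wInt b a p.1 p.2.1 p.2.2 := by
  unfold wInt
  have hx : Measurable fun p : ℝ × Ed d × Pm d => ‖p.2.1‖ := measurable_snd.fst.norm
  exact (hb.norm.div (measurable_const.add hx)).add
    (ha.norm.div (measurable_const.add (hx.pow_const 2)))

theorem measurable_Lop (hb : Measurable fun p : ℝ × Ed d × Pm d => b p.1 p.2.1 p.2.2)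
    (ha : Measurable fun p : ℝ × Ed d × Pm d => a p.1 p.2.1 p.2.2)
    {φ : Ed d → ℝ} (hφ : ContDiff ℝ 2 φ) :
    Measurable fun p : ℝ × Ed d × Pm d => Lop b a p.2.2 p.1 φ p.2.1 := by
  have hg := contDiff_gradient hφ
  have h1 : Measurable fun p : ℝ × Ed d × Pm d => gradient φ p.2.1 :=
    hg.continuous.measurable.comp measurable_snd.fst
  have h2 : Measurable fun p : ℝ × Ed d × Pm d => fderiv ℝ (gradient φ) p.2.1 :=
    (hg.continuous_fderiv (by simp)).measurable.comp measurable_snd.fst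
  have ht : Continuous fun A : Ed d →L[ℝ] Ed d => LinearMap.trace ℝ (Ed d) A.toLinearMap :=
    ((LinearMap.trace ℝ (Ed d)).comp
      (ContinuousLinearMap.coeLM ℝ : (Ed d →L[ℝ] Ed d) →ₗ[ℝ] _)).continuous_of_finiteDimensional
  have hc : Continuous fun q : (Ed d →L[ℝ] Ed d) × (Ed d →L[ℝ] Ed d) => q.1 ∘L q.2 :=
    continuous_fst.clm_comp continuous_snd
  have h3 := (ht.comp hc).measurable.comp (ha.prodMk h2)
  exact (hb.inner h1).add (h3.const_mul (1 / 2))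

/-- The mass `∫ (|b|/(1+|x|) + |a|/(1+|x|²)) dμ`. -/
def wMass (b : ℝ → Ed d → Pm d → Ed d) (a : ℝ → Ed d → Pm d → (Ed d →L[ℝ] Ed d))
    (t : ℝ) (μ : Pm d) : ℝ≥0∞ :=
  ∫⁻ x, ENNReal.ofReal (wInt b a t x μ) ∂(μ : Measure (Ed d))

theorem measurable_wMass (hb : Measurable fun p : ℝ × Ed d × Pm d => b p.1 p.2.1 p.2.2)
    (ha : Measurable fun p : ℝ × Ed d × Pm d => a p.1 p.2.1 p.2.2) :
    Measurable fun p : ℝ × Pm d => wMass b a p.1 p.2 := by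
  have h : Measurable fun q : (ℝ × Pm d) × Ed d =>
      ENNReal.ofReal (wInt b a q.1.1 q.2 q.1.2) :=
    ((measurable_wInt hb ha).comp
      (measurable_fst.fst.prodMk (measurable_snd.prodMk measurable_fst.snd))).ennreal_ofReal
  exact h.lintegral_kernel_prod_right' (κ := (tautKernel d).comap Prod.snd measurable_snd)

/-- The value of the cylinder operator integrated in space. -/
def cylDrift (b : ℝ → Ed d → Pm d → Ed d) (a : ℝ → Ed d → Pm d → (Ed d →L[ℝ] Ed d))
    {k : ℕ} (Ψ : (Fin k → ℝ) → ℝ) (Φ : Fin k → Ed d → ℝ) (t : ℝ) (μ : Pm d) : ℝ :=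
  ∫ x, (∑ i, fderiv ℝ Ψ (fun j => ∫ y, Φ j y ∂(μ : Measure (Ed d))) (Pi.single i 1) *
    Lop b a μ t (Φ i) x) ∂(μ : Measure (Ed d))

/-- `∫ L φ dμ`. -/
def drift (b : ℝ → Ed d → Pm d → Ed d) (a : ℝ → Ed d → Pm d → (Ed d →L[ℝ] Ed d))
    (φ : Ed d → ℝ) (t : ℝ) (μ : Pm d) : ℝ :=
  ∫ x, Lop b a μ t φ x ∂(μ : Measure (Ed d))

theorem measurable_Lop_right (hb : Measurable fun p : ℝ × Ed d × Pm d => b p.1 p.2.1 p.2.2)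
    (ha : Measurable fun p : ℝ × Ed d × Pm d => a p.1 p.2.1 p.2.2)
    {φ : Ed d → ℝ} (hφ : ContDiff ℝ 2 φ) :
    Measurable fun q : (ℝ × Pm d) × Ed d => Lop b a q.1.2 q.1.1 φ q.2 := by
  have h : Measurable fun q : (ℝ × Pm d) × Ed d => (q.1.1, q.2, q.1.2) :=
    measurable_fst.fst.prodMk (measurable_snd.prodMk measurable_fst.snd)
  have h2 := measurable_Lop hb ha hφ
  generalize hf : (fun p : ℝ × Ed d × Pm d => Lop b a p.2.2 p.1 φ p.2.1) = f at h2
  have h3 : (fun q : (ℝ × Pm d) × Ed d => Lop b a q.1.2 q.1.1 φ q.2) =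
      f ∘ fun q => (q.1.1, q.2, q.1.2) := by
    rw [← hf]
    rfl
  rw [h3]
  exact h2.comp h

theorem measurable_drift (hb : Measurable fun p : ℝ × Ed d × Pm d => b p.1 p.2.1 p.2.2)
    (ha : Measurable fun p : ℝ × Ed d × Pm d => a p.1 p.2.1 p.2.2)
    {φ : Ed d → ℝ} (hφ : ContDiff ℝ 2 φ) :
    Measurable fun p : ℝ × Pm d => drift b a φ p.1 p.2 :=
  ((measurable_Lop_right hb ha hφ).stronglyMeasurable.integral_kernel_prod_right'
    (κ := (tautKernel d).comap Prod.snd measurable_snd)).measurable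

theorem measurable_cylDrift (hb : Measurable fun p : ℝ × Ed d × Pm d => b p.1 p.2.1 p.2.2)
    (ha : Measurable fun p : ℝ × Ed d × Pm d => a p.1 p.2.1 p.2.2)
    {k : ℕ} {Ψ : (Fin k → ℝ) → ℝ} (hΨ : ContDiff ℝ 1 Ψ) {Φ : Fin k → Ed d → ℝ}
    (hΦ : ∀ i, IsTestPhi (Φ i)) :
    Measurable fun p : ℝ × Pm d => cylDrift b a Ψ Φ p.1 p.2 := by
  have hc : Continuous fun μ : Pm d => fun j => ∫ y, Φ j y ∂(μ : Measure (Ed d)) :=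
    continuous_pi fun j => (hΦ j).continuous_integral
  have h : Measurable fun q : (ℝ × Pm d) × Ed d =>
      ∑ i, fderiv ℝ Ψ (fun j => ∫ y, Φ j y ∂(q.1.2 : Measure (Ed d))) (Pi.single i 1) *
        Lop b a q.1.2 q.1.1 (Φ i) q.2 := by
    refine Finset.measurable_sum _ fun i _ => Measurable.mul ?_
      (measurable_Lop_right hb ha (hΦ i).1)
    have h1 : Continuous fun μ : Pm d =>
        fderiv ℝ Ψ (fun j => ∫ y, Φ j y ∂(μ : Measure (Ed d))) (Pi.single i 1) :=
      ((hΨ.continuous_fderiv (by simp)).comp hc).clm_apply continuous_const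
    exact h1.measurable.comp measurable_fst.snd
  exact (h.stronglyMeasurable.integral_kernel_prod_right'
    (κ := (tautKernel d).comap Prod.snd measurable_snd)).measurable

theorem WBound.enorm_Lop_le {φ : Ed d → ℝ} {C : ℝ} (h : WBound φ C) (t : ℝ) (μ : Pm d)
    (x : Ed d) :
    ‖Lop b a μ t φ x‖ₑ ≤ ENNReal.ofReal (C * (1 + d)) * ENNReal.ofReal (wInt b a t x μ) := by
  rw [← ENNReal.ofReal_mul' (wInt_nonneg b a μ t x), Real.enorm_eq_ofReal_abs]
  exact ENNReal.ofReal_le_ofReal (h.abs_Lop_le b a μ t x)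

theorem WBound.lintegral_enorm_Lop_le {φ : Ed d → ℝ} {C : ℝ} (h : WBound φ C) (t : ℝ)
    (μ : Pm d) :
    ∫⁻ x, ‖Lop b a μ t φ x‖ₑ ∂(μ : Measure (Ed d))
      ≤ ENNReal.ofReal (C * (1 + d)) * wMass b a t μ := by
  unfold wMass
  rw [← lintegral_const_mul' _ _ ENNReal.ofReal_ne_top]
  exact lintegral_mono fun x => h.enorm_Lop_le t μ x

theorem WBound.enorm_drift_le {φ : Ed d → ℝ} {C : ℝ} (h : WBound φ C) (t : ℝ) (μ : Pm d) :
    ‖drift b a φ t μ‖ₑ ≤ ENNReal.ofReal (C * (1 + d)) * wMass b a t μ :=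
  (enorm_integral_le_lintegral_enorm _).trans (h.lintegral_enorm_Lop_le t μ)

theorem IsTestPhi.integrable_Lop
    (hb : Measurable fun p : ℝ × Ed d × Pm d => b p.1 p.2.1 p.2.2)
    (ha : Measurable fun p : ℝ × Ed d × Pm d => a p.1 p.2.1 p.2.2)
    {φ : Ed d → ℝ} (hφ : IsTestPhi φ) {t : ℝ} {μ : Pm d} (h : wMass b a t μ < ∞) :
    Integrable (Lop b a μ t φ) (μ : Measure (Ed d)) := by
  obtain ⟨C, _, hC⟩ := hφ.exists_wBound
  refine ⟨?_, (hC.lintegral_enorm_Lop_le t μ).trans_lt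
    (ENNReal.mul_lt_top ENNReal.ofReal_lt_top h)⟩
  exact ((measurable_Lop_right hb ha hφ.1).comp
    (measurable_prodMk_left (x := (t, μ)))).aestronglyMeasurable

theorem cylDrift_eq_sum
    (hb : Measurable fun p : ℝ × Ed d × Pm d => b p.1 p.2.1 p.2.2)
    (ha : Measurable fun p : ℝ × Ed d × Pm d => a p.1 p.2.1 p.2.2)
    {k : ℕ} (Ψ : (Fin k → ℝ) → ℝ) {Φ : Fin k → Ed d → ℝ} (hΦ : ∀ i, IsTestPhi (Φ i))
    {t : ℝ} {μ : Pm d} (h : wMass b a t μ < ∞) :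
    cylDrift b a Ψ Φ t μ =
      ∑ i, fderiv ℝ Ψ (fun j => ∫ y, Φ j y ∂(μ : Measure (Ed d))) (Pi.single i 1) *
        drift b a (Φ i) t μ := by
  unfold cylDrift drift
  rw [integral_finsetSum]
  · simp only [integral_const_mul]
  · exact fun i _ => ((hΦ i).integrable_Lop hb ha h).const_mul _

theorem exists_enorm_cylDrift_le {k : ℕ} {Ψ : (Fin k → ℝ) → ℝ} (hΨ : ContDiff ℝ 1 Ψ)
    {Φ : Fin k → Ed d → ℝ} (hΦ : ∀ i, IsTestPhi (Φ i)) :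
    ∃ C : ℝ, ∀ t μ, ‖cylDrift b a Ψ Φ t μ‖ₑ ≤ ENNReal.ofReal C * wMass b a t μ := by
  choose C hC0 hC using fun i => (hΦ i).exists_wBound
  let R : ℝ := ∑ i, C i
  have hR : ∀ μ : Pm d, (fun j => ∫ y, Φ j y ∂(μ : Measure (Ed d))) ∈
      Metric.closedBall (0 : Fin k → ℝ) R := by
    intro μ
    rw [mem_closedBall_zero_iff, pi_norm_le_iff_of_nonneg (Finset.sum_nonneg fun i _ => (hC0 i).le)]
    intro i
    exact ((hC i).abs_integral_le μ).trans
      (Finset.single_le_sum (f := C) (fun i _ => (hC0 i).le) (Finset.mem_univ i))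
  obtain ⟨D, hD⟩ := (isCompact_closedBall (0 : Fin k → ℝ) R).exists_bound_of_continuousOn
    (hΨ.continuous_fderiv (by simp)).continuousOn
  refine ⟨∑ i, D * (C i * (1 + d)), fun t μ => ?_⟩
  refine (enorm_integral_le_lintegral_enorm _).trans ?_
  unfold wMass
  rw [← lintegral_const_mul' _ _ ENNReal.ofReal_ne_top]
  refine lintegral_mono fun x => ?_
  rw [← ENNReal.ofReal_mul' (wInt_nonneg b a μ t x), Real.enorm_eq_ofReal_abs]
  refine ENNReal.ofReal_le_ofReal ?_
  rw [Finset.sum_mul]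
  refine (Finset.abs_sum_le_sum_abs _ _).trans (Finset.sum_le_sum fun i _ => ?_)
  rw [abs_mul, mul_assoc]
  have h1 : |fderiv ℝ Ψ (fun j => ∫ y, Φ j y ∂(μ : Measure (Ed d))) (Pi.single i 1)| ≤ D := by
    refine (((fderiv ℝ Ψ _).le_opNorm _)).trans ?_
    rw [Pi.norm_single, norm_one, mul_one]
    exact hD _ (hR μ)
  exact mul_le_mul h1 ((hC i).abs_Lop_le b a μ t x) (abs_nonneg _) ((abs_nonneg _).trans h1)

end Coefficients

theorem measurable_uncurry_curve {T : ℝ} (d : ℕ) (hT : 0 ≤ T) :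
    Measurable fun p : ℝ × CurveSp T d => p.2 (projIcc 0 T hT p.1) :=
  (continuous_snd.eval (continuous_projIcc.comp continuous_fst)).measurable

theorem continuous_curve_projIcc {T : ℝ} {d : ℕ} (hT : 0 ≤ T) (c : CurveSp T d) :
    Continuous fun t => c (projIcc 0 T hT t) :=
  c.continuous.comp continuous_projIcc

theorem measurable_curve_projIcc {T : ℝ} (d : ℕ) (hT : 0 ≤ T) (t : ℝ) :
    Measurable fun c : CurveSp T d => c (projIcc 0 T hT t) :=
  (ContinuousEvalConst.continuous_eval_const _).measurable

section Coefficients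

variable {T : ℝ} {d : ℕ} {b : ℝ → Ed d → Pm d → Ed d}
  {a : ℝ → Ed d → Pm d → (Ed d →L[ℝ] Ed d)}

theorem KFPmem.lintegral_wMass_lt_top {hT : 0 ≤ T} {c : CurveSp T d} (h : KFPmem hT b a c) :
    ∫⁻ t in Icc (0:ℝ) T, wMass b a t (c (projIcc 0 T hT t)) < ∞ := h.1

theorem integrable_of_enorm_le_mul {α : Type*} [MeasurableSpace α] {m : Measure α} {f : α → ℝ}
    {w : α → ℝ≥0∞} (hf : Measurable f) {C : ℝ} (h : ∀ x, ‖f x‖ₑ ≤ ENNReal.ofReal C * w x)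
    (hw : ∫⁻ x, w x ∂m < ∞) : Integrable f m := by
  refine ⟨hf.aestronglyMeasurable, ?_⟩
  refine (lintegral_mono h).trans_lt ?_
  rw [lintegral_const_mul' _ _ ENNReal.ofReal_ne_top]
  exact ENNReal.mul_lt_top ENNReal.ofReal_lt_top hw

theorem intervalIntegrable_drift
    (hb : Measurable fun p : ℝ × Ed d × Pm d => b p.1 p.2.1 p.2.2)
    (ha : Measurable fun p : ℝ × Ed d × Pm d => a p.1 p.2.1 p.2.2)
    {hT : 0 ≤ T} {c : CurveSp T d}
    (h : ∫⁻ t in Icc (0:ℝ) T, wMass b a t (c (projIcc 0 T hT t)) < ∞)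
    {φ : Ed d → ℝ} (hφ : IsTestPhi φ) :
    IntervalIntegrable (fun t => drift b a φ t (c (projIcc 0 T hT t))) volume 0 T := by
  rw [intervalIntegrable_iff_integrableOn_Icc_of_le hT]
  obtain ⟨C, _, hC⟩ := hφ.exists_wBound
  refine integrable_of_enorm_le_mul ?_ (fun t => hC.enorm_drift_le t _) h
  exact (measurable_drift hb ha hφ.1).comp
    (measurable_id.prodMk (continuous_curve_projIcc hT c).measurable)

theorem KFPmem.sub_eq_integral
    (hb : Measurable fun p : ℝ × Ed d × Pm d => b p.1 p.2.1 p.2.2)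
    (ha : Measurable fun p : ℝ × Ed d × Pm d => a p.1 p.2.1 p.2.2)
    {hT : 0 ≤ T} {c : CurveSp T d} (h : KFPmem hT b a c)
    {φ : Ed d → ℝ} (hφ : IsTestPhi φ) : ∀ t ∈ Icc 0 T,
    (∫ x, φ x ∂(c (projIcc 0 T hT t) : Measure (Ed d)))
      - ∫ x, φ x ∂(c (projIcc 0 T hT 0) : Measure (Ed d))
      = ∫ r in (0:ℝ)..t, drift b a φ r (c (projIcc 0 T hT r)) :=
  sub_eq_integral_of_weak hT
    (hφ.continuous_integral.comp (continuous_curve_projIcc hT c)).continuousOn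
    (intervalIntegrable_drift hb ha h.1 hφ) fun ξ hξ => h.2 ξ φ hξ hφ

theorem integral_deriv_mul_cylinder
    (hb : Measurable fun p : ℝ × Ed d × Pm d => b p.1 p.2.1 p.2.2)
    (ha : Measurable fun p : ℝ × Ed d × Pm d => a p.1 p.2.1 p.2.2)
    {hT : 0 ≤ T} {c : CurveSp T d} (h : KFPmem hT b a c)
    {k : ℕ} {Ψ : (Fin k → ℝ) → ℝ} (hΨ : ContDiff ℝ 1 Ψ) {Φ : Fin k → Ed d → ℝ}
    (hΦ : ∀ i, IsTestPhi (Φ i)) {ξ : ℝ → ℝ} (hξ : IsTestXi T ξ) :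
    ∫ t in (0:ℝ)..T, deriv ξ t *
        Ψ (fun i => ∫ x, Φ i x ∂(c (projIcc 0 T hT t) : Measure (Ed d)))
      = - ∫ t in (0:ℝ)..T, ξ t * cylDrift b a Ψ Φ t (c (projIcc 0 T hT t)) := by
  rw [integral_deriv_mul_comp hT hΨ
    (A := fun t i => ∫ x, Φ i x ∂(c (projIcc 0 T hT t) : Measure (Ed d)))
    (B := fun t i => drift b a (Φ i) t (c (projIcc 0 T hT t)))
    (fun i => intervalIntegrable_drift hb ha h.1 (hΦ i))
    (fun i => h.sub_eq_integral hb ha (hΦ i)) hξ]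
  congr 1
  apply intervalIntegral.integral_congr_ae
  have hm : Measurable fun t => wMass b a t (c (projIcc 0 T hT t)) :=
    (measurable_wMass hb ha).comp
      (measurable_id.prodMk (continuous_curve_projIcc hT c).measurable)
  have hae := (ae_restrict_iff' measurableSet_Icc).mp
    (ae_lt_top hm h.lintegral_wMass_lt_top.ne)
  filter_upwards [hae] with t ht hmem
  rw [uIoc_of_le hT] at hmem
  rw [cylDrift_eq_sum hb ha Ψ hΦ (ht (Ioc_subset_Icc_self hmem))]

/-- The marginals of a lifting solve the random measure equation. -/
theorem LamSol.rmSol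
    (hb : Measurable fun p : ℝ × Ed d × Pm d => b p.1 p.2.1 p.2.2)
    (ha : Measurable fun p : ℝ × Ed d × Pm d => a p.1 p.2.1 p.2.2)
    {hT : 0 ≤ T} {Λ : Measure (CurveSp T d)} (h : LamSol hT b a Λ) :
    RMsol hT b a fun t => Λ.map fun c => c (projIcc 0 T hT t) := by
  obtain ⟨hp, hK, hI⟩ := h
  have hme := measurable_curve_projIcc d hT
  have hW := measurable_wMass hb ha
  have hWc : Measurable fun p : ℝ × CurveSp T d => wMass b a p.1 (p.2 (projIcc 0 T hT p.1)) :=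
    hW.comp (measurable_fst.prodMk (measurable_uncurry_curve d hT))
  have hWfin : ∫⁻ p, wMass b a p.1 (p.2 (projIcc 0 T hT p.1))
      ∂((volume.restrict (Icc 0 T)).prod Λ) < ∞ := by
    rw [lintegral_prod_symm' _ hWc]
    exact hI
  refine ⟨fun t => Measure.isProbabilityMeasure_map (hme t).aemeasurable, ?_, ?_, ?_⟩
  · intro F
    have e : ∀ t, ∫ μ, F μ ∂(Λ.map fun c => c (projIcc 0 T hT t))
        = ∫ c, F (c (projIcc 0 T hT t)) ∂Λ := fun t =>
      integral_map (hme t).aemeasurable F.continuous.measurable.aestronglyMeasurable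
    simp only [e]
    refine continuousOn_of_dominated (bound := fun _ => ‖F‖) ?_ ?_ (integrable_const _) ?_
    · exact fun t _ => (F.continuous.measurable.comp (hme t)).aestronglyMeasurable
    · exact fun t _ => ae_of_all _ fun c => F.norm_coe_le_norm _
    · exact ae_of_all _ fun c =>
        (F.continuous.comp (continuous_curve_projIcc hT c)).continuousOn
  · have e : ∀ t, ∫⁻ μ, wMass b a t μ ∂(Λ.map fun c => c (projIcc 0 T hT t))
        = ∫⁻ c, wMass b a t (c (projIcc 0 T hT t)) ∂Λ := fun t =>
      lintegral_map (hW.comp measurable_prodMk_left) (hme t)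
    change ∫⁻ t in Icc (0:ℝ) T, ∫⁻ μ, wMass b a t μ ∂(Λ.map fun c => c (projIcc 0 T hT t)) < ∞
    simp only [e]
    rw [lintegral_prod _ hWc.aemeasurable] at hWfin
    exact hWfin
  · intro k Ψ Φ hΨ hΨc hΦ ξ hξ
    have hcont : Continuous fun μ : Pm d => Ψ fun i => ∫ x, Φ i x ∂(μ : Measure (Ed d)) :=
      hΨ.continuous.comp (continuous_pi fun i => (hΦ i).continuous_integral)
    have hDm := measurable_cylDrift hb ha hΨ hΦ
    have e1 : ∀ t, ∫ μ : Pm d, Ψ (fun i => ∫ x, Φ i x ∂(μ : Measure (Ed d)))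
        ∂(Λ.map fun c => c (projIcc 0 T hT t))
        = ∫ c, Ψ (fun i => ∫ x, Φ i x ∂(c (projIcc 0 T hT t) : Measure (Ed d))) ∂Λ := fun t =>
      integral_map (hme t).aemeasurable hcont.measurable.aestronglyMeasurable
    have e2 : ∀ t, ∫ μ, cylDrift b a Ψ Φ t μ ∂(Λ.map fun c => c (projIcc 0 T hT t))
        = ∫ c, cylDrift b a Ψ Φ t (c (projIcc 0 T hT t)) ∂Λ := fun t =>
      integral_map (hme t).aemeasurable
        (hDm.comp measurable_prodMk_left).aestronglyMeasurable
    change ∫ t in (0:ℝ)..T, deriv ξ t * ∫ μ : Pm d, Ψ (fun i => ∫ x, Φ i x ∂(μ : Measure (Ed d)))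
        ∂(Λ.map fun c => c (projIcc 0 T hT t))
      = - ∫ t in (0:ℝ)..T, ξ t *
        ∫ μ, cylDrift b a Ψ Φ t μ ∂(Λ.map fun c => c (projIcc 0 T hT t))
    simp only [e1, e2, ← integral_const_mul]
    have hdξ : Continuous (deriv ξ) := hξ.1.continuous_deriv le_rfl
    have hfin : IsFiniteMeasure ((volume : Measure ℝ).restrict (uIoc 0 T)) := by
      rw [uIoc_of_le hT]
      infer_instance
    have hvol : volume.restrict (uIoc 0 T) ≤ volume.restrict (Icc 0 T) := by
      rw [uIoc_of_le hT]
      exact Measure.restrict_mono Ioc_subset_Icc_self le_rfl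
    have i1 : Integrable (Function.uncurry fun t (c : CurveSp T d) => deriv ξ t *
        Ψ (fun i => ∫ x, Φ i x ∂(c (projIcc 0 T hT t) : Measure (Ed d))))
        ((volume.restrict (uIoc 0 T)).prod Λ) := by
      obtain ⟨C₁, hC₁⟩ := hdξ.bounded_above_of_compact_support hξ.2.1.deriv
      obtain ⟨C₂, hC₂⟩ := hΨ.continuous.bounded_above_of_compact_support hΨc
      refine Integrable.of_bound (C := C₁ * C₂) ?_ (ae_of_all _ fun p => ?_)
      · exact ((hdξ.measurable.comp measurable_fst).mul
          (hcont.measurable.comp (measurable_uncurry_curve d hT))).aestronglyMeasurable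
      · simp only [Function.uncurry, norm_mul]
        exact mul_le_mul (hC₁ _) (hC₂ _) (norm_nonneg _) ((norm_nonneg _).trans (hC₁ 0))
    have i2 : Integrable (Function.uncurry fun t (c : CurveSp T d) => ξ t *
        cylDrift b a Ψ Φ t (c (projIcc 0 T hT t)))
        ((volume.restrict (uIoc 0 T)).prod Λ) := by
      obtain ⟨C₁, hC₁⟩ := hξ.1.continuous.bounded_above_of_compact_support hξ.2.1
      obtain ⟨C₂, hC₂⟩ := exists_enorm_cylDrift_le (b := b) (a := a) hΨ hΦ
      have hmeas : Measurable fun p : ℝ × CurveSp T d =>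
          cylDrift b a Ψ Φ p.1 (p.2 (projIcc 0 T hT p.1)) :=
        hDm.comp (measurable_fst.prodMk (measurable_uncurry_curve d hT))
      have i3 : Integrable (fun p : ℝ × CurveSp T d =>
          cylDrift b a Ψ Φ p.1 (p.2 (projIcc 0 T hT p.1)))
          ((volume.restrict (Icc 0 T)).prod Λ) :=
        integrable_of_enorm_le_mul hmeas (fun p => hC₂ _ _) hWfin
      refine (i3.bdd_mul (c := C₁) (f := fun p : ℝ × CurveSp T d => ξ p.1)
        (hξ.1.continuous.measurable.comp measurable_fst).aestronglyMeasurable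
        (ae_of_all _ fun p => hC₁ _)).mono_measure ?_
      exact Measure.prod_mono hvol le_rfl
    rw [intervalIntegral_integral_swap i1, intervalIntegral_integral_swap i2, ← integral_neg]
    refine integral_congr_ae ?_
    filter_upwards [hK] with c hc
    exact integral_deriv_mul_cylinder hb ha hc hΨ hΦ hξ

end Coefficients

section MarginalUniqueness

variable {Ω X I : Type*} [MeasurableSpace Ω] [MeasurableSpace X]

theorem exists_conditional_density (Λ : Measure Ω) [IsProbabilityMeasure Λ] {e₀ : Ω → X}
    (h₀ : Measurable e₀) (E : Set Ω) :
    ∃ f : X → ℝ≥0∞, Measurable f ∧ (∀ x, f x ≤ 1) ∧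
      ∀ B, MeasurableSet B → ∫⁻ x in B, f x ∂(Λ.map e₀) = Λ (E ∩ e₀ ⁻¹' B) := by
  have hle : (Λ.restrict E).map e₀ ≤ Λ.map e₀ := Measure.map_mono Measure.restrict_le_self h₀
  have hp : IsProbabilityMeasure (Λ.map e₀) := Measure.isProbabilityMeasure_map h₀.aemeasurable
  set g := ((Λ.restrict E).map e₀).rnDeriv (Λ.map e₀) with hg
  have hgm : Measurable g := Measure.measurable_rnDeriv _ _
  refine ⟨fun x => min (g x) 1, hgm.min measurable_const, fun x => min_le_right _ _, ?_⟩
  intro B hB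
  have h1 : (fun x => min (g x) 1) =ᵐ[Λ.map e₀] g := by
    filter_upwards [Measure.rnDeriv_le_one_of_le hle] with x hx
    exact min_eq_left hx
  rw [setLIntegral_congr_fun_ae hB (h1.mono fun x hx _ => hx), ← withDensity_apply _ hB,
    Measure.withDensity_rnDeriv_eq _ _ (Measure.absolutelyContinuous_of_le hle),
    Measure.map_apply h₀ hB, Measure.restrict_apply (h₀ hB), inter_comm]

theorem ae_eq_preimage_of_marginal_unique {P : Measure Ω → Prop}
    (hprob : ∀ Λ, P Λ → IsProbabilityMeasure Λ)
    (hdens : ∀ Λ, P Λ → ∀ h : Ω → ℝ≥0∞, Measurable h → (∃ C ≠ ∞, ∀ ω, h ω ≤ C) →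
      ∫⁻ ω, h ω ∂Λ = 1 → P (Λ.withDensity h))
    {e₀ e₁ : Ω → X} (h₀ : Measurable e₀) (h₁ : Measurable e₁)
    (huniq : ∀ Λ Λ', P Λ → P Λ' → Λ.map e₀ = Λ'.map e₀ → Λ.map e₁ = Λ'.map e₁)
    {Λ Λ' : Measure Ω} (hΛ : P Λ) (hΛ' : P Λ') (h : Λ.map e₀ = Λ'.map e₀)
    {A : Set X} (hA : MeasurableSet A) {f : X → ℝ≥0∞} (hf : Measurable f)
    (hf1 : ∀ x, f x ≤ 1)
    (hfB : ∀ B, MeasurableSet B → ∫⁻ x in B, f x ∂(Λ.map e₀) = Λ (e₁ ⁻¹' A ∩ e₀ ⁻¹' B)) :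
    (e₁ ⁻¹' A : Set Ω) =ᵐ[Λ'] e₀ ⁻¹' (f ⁻¹' {1}) := by
  have hp := hprob Λ hΛ
  have hp' := hprob Λ' hΛ'
  set E := e₁ ⁻¹' A with hEdef
  have hE : MeasurableSet E := h₁ hA
  have hfe : Measurable fun ω => f (e₀ ω) := hf.comp h₀
  have hEE : Λ' E = Λ E := by
    have := congrArg (fun m => m A) (huniq Λ Λ' hΛ hΛ' h)
    simp only [Measure.map_apply h₁ hA] at this
    exact this.symm
  have hfB' : ∀ B, MeasurableSet B →
      ∫⁻ ω in e₀ ⁻¹' B, f (e₀ ω) ∂Λ' = Λ (E ∩ e₀ ⁻¹' B) := by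
    intro B hB
    rw [← setLIntegral_map hB hf h₀, ← h, hfB B hB]
  have htot : ∫⁻ ω, f (e₀ ω) ∂Λ' = Λ E := by
    have := hfB' univ MeasurableSet.univ
    simpa using this
  set Z : ℝ≥0∞ := 1 + Λ E with hZ
  have hZ0 : Z ≠ 0 := by simp [hZ]
  have hZt : Z ≠ ∞ := by simp [hZ]
  let g₁ : Ω → ℝ≥0∞ := fun ω => Z⁻¹ * (1 + E.indicator 1 ω)
  let g₂ : Ω → ℝ≥0∞ := fun ω => Z⁻¹ * (1 + f (e₀ ω))
  have hind : Measurable (E.indicator (1 : Ω → ℝ≥0∞)) := measurable_one.indicator hE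
  have hg₁ : Measurable g₁ := (measurable_const.add hind).const_mul _
  have hg₂ : Measurable g₂ := (measurable_const.add hfe).const_mul _
  have hZi : Z⁻¹ ≠ ∞ := ENNReal.inv_ne_top.mpr hZ0
  have set₁ : ∀ S, MeasurableSet S → Λ.withDensity g₁ S = Z⁻¹ * (Λ S + Λ (E ∩ S)) := by
    intro S hS
    rw [withDensity_apply _ hS, lintegral_const_mul _ (f := fun ω => 1 + E.indicator 1 ω)
      (measurable_const.add hind),
      lintegral_add_left measurable_const, setLIntegral_indicator hE]
    simp
  have set₂ : ∀ S, MeasurableSet S →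
      Λ'.withDensity g₂ S = Z⁻¹ * (Λ' S + ∫⁻ ω in S, f (e₀ ω) ∂Λ') := by
    intro S hS
    rw [withDensity_apply _ hS, lintegral_const_mul _ (f := fun ω => 1 + f (e₀ ω))
      (measurable_const.add hfe),
      lintegral_add_left measurable_const]
    simp
  have P₁ : P (Λ.withDensity g₁) := by
    refine hdens Λ hΛ g₁ hg₁ ⟨Z⁻¹ * (1 + 1), ENNReal.mul_ne_top hZi (by simp), fun ω => ?_⟩ ?_
    · refine mul_le_mul_right (add_le_add_right ?_ 1) _
      exact indicator_le_self' (by simp) ω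
    · have := set₁ univ MeasurableSet.univ
      rw [withDensity_apply _ MeasurableSet.univ, setLIntegral_univ] at this
      rw [this, inter_univ, measure_univ]
      exact ENNReal.inv_mul_cancel hZ0 hZt
  have P₂ : P (Λ'.withDensity g₂) := by
    refine hdens Λ' hΛ' g₂ hg₂ ⟨Z⁻¹ * (1 + 1), ENNReal.mul_ne_top hZi (by simp), fun ω => ?_⟩ ?_
    · exact mul_le_mul_right (add_le_add_right (hf1 _) 1) _
    · have := set₂ univ MeasurableSet.univ
      rw [withDensity_apply _ MeasurableSet.univ, setLIntegral_univ] at this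
      rw [this, setLIntegral_univ, htot, measure_univ]
      exact ENNReal.inv_mul_cancel hZ0 hZt
  have h12 : (Λ.withDensity g₁).map e₀ = (Λ'.withDensity g₂).map e₀ := by
    ext B hB
    rw [Measure.map_apply h₀ hB, Measure.map_apply h₀ hB, set₁ _ (h₀ hB), set₂ _ (h₀ hB),
      hfB' B hB, ← Measure.map_apply h₀ hB, h, Measure.map_apply h₀ hB]
  have key := congrArg (fun m => m A) (huniq _ _ P₁ P₂ h12)
  simp only [Measure.map_apply h₁ hA] at key
  rw [set₁ _ hE, set₂ _ hE, inter_self, ENNReal.mul_right_inj (ENNReal.inv_ne_zero.mpr hZt) hZi,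
    hEE] at key
  have hin : ∫⁻ ω in E, f (e₀ ω) ∂Λ' = Λ' E := by
    rw [hEE]
    exact ((ENNReal.add_right_inj (measure_ne_top Λ E)).mp key).symm
  have hout : ∫⁻ ω in Eᶜ, f (e₀ ω) ∂Λ' = 0 := by
    have := lintegral_add_compl (μ := Λ') (fun ω => f (e₀ ω)) hE
    rw [hin, htot, ← hEE] at this
    have h2 : Λ' E + ∫⁻ ω in Eᶜ, f (e₀ ω) ∂Λ' = Λ' E + 0 := by rw [this, add_zero]
    exact (ENNReal.add_right_inj (measure_ne_top Λ' E)).mp h2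
  have hout' : ∀ᵐ ω ∂Λ', ω ∈ Eᶜ → f (e₀ ω) = 0 :=
    (setLIntegral_eq_zero_iff hE.compl hfe).mp hout
  have hin' : ∀ᵐ ω ∂Λ', ω ∈ E → 1 - f (e₀ ω) = 0 := by
    rw [← setLIntegral_eq_zero_iff hE (f := fun ω => 1 - f (e₀ ω)) (measurable_const.sub hfe),
      lintegral_sub hfe (by rw [hin]; exact measure_ne_top _ _) (ae_of_all _ fun ω => hf1 _), hin]
    simp
  filter_upwards [hout', hin'] with ω ho hi
  refine propext ⟨fun hω => ?_, fun hω => ?_⟩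
  · exact le_antisymm (hf1 _) (tsub_eq_zero_iff_le.mp (hi hω))
  · by_contra hn
    have h1 : f (e₀ ω) = 1 := hω
    rw [ho hn] at h1
    exact zero_ne_one h1

/-- If a class of probability measures is stable under bounded densities and the law at one
time determines the one-dimensional marginals inside the class, then it determines the whole
measure. -/
theorem eq_of_marginal_unique {P : Measure Ω → Prop}
    (hprob : ∀ Λ, P Λ → IsProbabilityMeasure Λ)
    (hdens : ∀ Λ, P Λ → ∀ h : Ω → ℝ≥0∞, Measurable h → (∃ C ≠ ∞, ∀ ω, h ω ≤ C) →
      ∫⁻ ω, h ω ∂Λ = 1 → P (Λ.withDensity h))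
    {e : I → Ω → X} (i₀ : I) (he : ∀ i, Measurable (e i))
    (hgen : ‹MeasurableSpace Ω› ≤ ⨆ i, MeasurableSpace.comap (e i) ‹MeasurableSpace X›)
    (huniq : ∀ Λ Λ', P Λ → P Λ' → Λ.map (e i₀) = Λ'.map (e i₀) →
      ∀ i, Λ.map (e i) = Λ'.map (e i))
    {Λ Λ' : Measure Ω} (hΛ : P Λ) (hΛ' : P Λ') (h : Λ.map (e i₀) = Λ'.map (e i₀)) :
    Λ = Λ' := by
  have hp := hprob Λ hΛ
  have hle : (⨆ i, MeasurableSpace.comap (e i) ‹MeasurableSpace X›) ≤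
      eventuallyMeasurableSpace (MeasurableSpace.comap (e i₀) ‹MeasurableSpace X›)
        (ae (Λ + Λ')) := by
    refine iSup_le fun i => ?_
    rintro _ ⟨A, hA, rfl⟩
    obtain ⟨f, hf, hf1, hfB⟩ := exists_conditional_density Λ (he i₀) (e i ⁻¹' A)
    have hu := fun Λ Λ' hΛ hΛ' h => huniq Λ Λ' hΛ hΛ' h i
    refine ⟨e i₀ ⁻¹' (f ⁻¹' {1}), ⟨_, hf (measurableSet_singleton 1), rfl⟩, ?_⟩
    refine ae_add_measure_iff.mpr ⟨?_, ?_⟩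
    · exact ae_eq_preimage_of_marginal_unique hprob hdens (he i₀) (he i) hu hΛ hΛ rfl hA hf hf1
        hfB
    · exact ae_eq_preimage_of_marginal_unique hprob hdens (he i₀) (he i) hu hΛ hΛ' h hA hf hf1
        hfB
  ext E hE
  obtain ⟨_, ⟨B, hB, rfl⟩, hEB⟩ := (hgen.trans hle) E hE
  obtain ⟨h1, h2⟩ := ae_add_measure_iff.mp hEB
  rw [measure_congr (h1 : E =ᵐ[Λ] _), measure_congr (h2 : E =ᵐ[Λ'] _),
    ← Measure.map_apply (he i₀) hB, h, Measure.map_apply (he i₀) hB]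

end MarginalUniqueness

section Liftings

variable {T : ℝ} {d : ℕ} {b : ℝ → Ed d → Pm d → Ed d}
  {a : ℝ → Ed d → Pm d → (Ed d →L[ℝ] Ed d)}

theorem LamSol.withDensity {hT : 0 ≤ T} {Λ : Measure (CurveSp T d)} (hΛ : LamSol hT b a Λ)
    {h : CurveSp T d → ℝ≥0∞} {C : ℝ≥0∞} (hC : C ≠ ∞) (hh : ∀ c, h c ≤ C)
    (h1 : ∫⁻ c, h c ∂Λ = 1) : LamSol hT b a (Λ.withDensity h) := by
  have hle : Λ.withDensity h ≤ C • Λ := by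
    rw [← withDensity_const]
    exact withDensity_mono (ae_of_all _ hh)
  refine ⟨⟨?_⟩, (withDensity_absolutelyContinuous Λ h).ae_le hΛ.2.1, ?_⟩
  · rw [withDensity_apply _ MeasurableSet.univ, setLIntegral_univ, h1]
  · refine (lintegral_mono' hle le_rfl).trans_lt ?_
    rw [lintegral_smul_measure]
    exact ENNReal.mul_lt_top hC.lt_top hΛ.2.2

theorem LamSol.eq_of_rmSol_unique
    (hb : Measurable fun p : ℝ × Ed d × Pm d => b p.1 p.2.1 p.2.2)
    (ha : Measurable fun p : ℝ × Ed d × Pm d => a p.1 p.2.1 p.2.2) {hT : 0 ≤ T}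
    (hM : ∀ Mbar : Measure (Pm d), IsProbabilityMeasure Mbar →
      ∀ M₁ M₂ : ℝ → Measure (Pm d), RMsol hT b a M₁ → RMsol hT b a M₂ →
        M₁ 0 = Mbar → M₂ 0 = Mbar → ∀ t ∈ Set.Icc (0:ℝ) T, M₁ t = M₂ t)
    {Λ₁ Λ₂ : Measure (CurveSp T d)} (h₁ : LamSol hT b a Λ₁) (h₂ : LamSol hT b a Λ₂)
    (h : Λ₁.map (fun c : CurveSp T d => c ⟨0, Set.left_mem_Icc.mpr hT⟩)
      = Λ₂.map (fun c : CurveSp T d => c ⟨0, Set.left_mem_Icc.mpr hT⟩)) : Λ₁ = Λ₂ := by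
  refine eq_of_marginal_unique (P := LamSol hT b a)
    (e := fun (t : Icc (0:ℝ) T) (c : CurveSp T d) => c t) (fun Λ hΛ => hΛ.1)
    (fun Λ hΛ h _ ⟨C, hC, hh⟩ h1 => hΛ.withDensity hC hh h1) ⟨0, left_mem_Icc.mpr hT⟩
    (fun t => (ContinuousEvalConst.continuous_eval_const t).measurable)
    borel_continuousMap_eq_iSup_comap.le ?_ h₁ h₂ h
  intro Λ Λ' hΛ hΛ' h0 t
  have hp := hΛ.1
  have e0 : projIcc 0 T hT 0 = ⟨0, left_mem_Icc.mpr hT⟩ := projIcc_left hT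
  have := hM (Λ.map fun c => c ⟨0, left_mem_Icc.mpr hT⟩)
    (Measure.isProbabilityMeasure_map
      (ContinuousEvalConst.continuous_eval_const _).measurable.aemeasurable) _ _
    (hΛ.rmSol hb ha) (hΛ'.rmSol hb ha) (by simp only [e0]) (by simp only [e0]; exact h0.symm)
    t t.2
  simpa only [projIcc_val] using this

end Liftings

theorem intervalIntegral_indicator_Icc {T : ℝ} (hT : 0 ≤ T) (f : ℝ → ℝ) (t : ℝ) :
    ∫ r in (0:ℝ)..t, (Icc 0 T).indicator f r = ∫ r in (0:ℝ)..(projIcc 0 T hT t : ℝ), f r := by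
  have h0 : ∀ s, s ∈ Icc 0 T →
      ∫ r in (0:ℝ)..s, (Icc 0 T).indicator f r = ∫ r in (0:ℝ)..s, f r := by
    intro s hs
    refine intervalIntegral.integral_congr fun r hr => ?_
    rw [uIcc_of_le hs.1] at hr
    exact indicator_of_mem (s := Icc 0 T) ⟨hr.1, hr.2.trans hs.2⟩ f
  rcases lt_or_ge t 0 with h | h
  · rw [projIcc_of_le_left hT h.le]
    simp only [intervalIntegral.integral_same]
    refine intervalIntegral.integral_zero_ae ?_
    have : ∀ᵐ r : ℝ, r ≠ 0 := by simp [ae_iff]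
    filter_upwards [this] with r hr hm
    rw [uIoc_of_ge h.le] at hm
    exact indicator_of_notMem (fun hI => hr (le_antisymm hm.2 hI.1)) _
  rcases le_or_gt t T with h' | h'
  · rw [h0 t ⟨h, h'⟩, projIcc_of_mem hT ⟨h, h'⟩]
  · rw [projIcc_of_right_le hT h'.le, intervalIntegral.integral_of_le h,
      intervalIntegral.integral_of_le hT, setIntegral_indicator measurableSet_Icc]
    refine setIntegral_congr_set ?_
    refine Eventually.of_forall fun r => propext ⟨fun hr => ⟨hr.1.1, hr.2.2⟩, fun hr => ?_⟩
    exact ⟨⟨hr.1, hr.2.trans h'.le⟩, hr.1.le, hr.2⟩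

section Coefficients

variable {T : ℝ} {d : ℕ} {b : ℝ → Ed d → Pm d → Ed d}
  {a : ℝ → Ed d → Pm d → (Ed d →L[ℝ] Ed d)} {hT : 0 ≤ T} {M : ℝ → Measure (Pm d)}

/-- A solution of the random measure equation, extended by constants. -/
def RMsol.curve (h : RMsol hT b a M) (t : ℝ) : ProbabilityMeasure (Pm d) :=
  ⟨M (projIcc 0 T hT t), h.1 _⟩

theorem RMsol.continuous_curve (h : RMsol hT b a M) : Continuous h.curve := by
  rw [continuous_iff_continuousAt]
  intro t
  refine ProbabilityMeasure.tendsto_iff_forall_integral_tendsto.mpr fun F => ?_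
  exact ((h.2.1 F).comp_continuous (continuous_subtype_val.comp (continuous_projIcc (h := hT)))
    (fun t => (projIcc 0 T hT t).2)).tendsto t

/-- A solution of the random measure equation, extended by constants, as a Markov kernel. -/
def RMsol.kernel (h : RMsol hT b a M) : Kernel ℝ (Pm d) :=
  continuousCurveKernel h.curve h.continuous_curve

instance (h : RMsol hT b a M) : IsMarkovKernel h.kernel := by
  unfold RMsol.kernel
  infer_instance

theorem RMsol.kernel_apply (h : RMsol hT b a M) (t : ℝ) :
    h.kernel t = M (projIcc 0 T hT t) := rfl

theorem RMsol.kernel_apply_of_mem (h : RMsol hT b a M) {t : ℝ} (ht : t ∈ Icc 0 T) :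
    h.kernel t = M t := by
  rw [h.kernel_apply, projIcc_of_mem hT ht]

theorem RMsol.continuous_integral_kernel (h : RMsol hT b a M)
    (F : BoundedContinuousFunction (Pm d) ℝ) : Continuous fun t => ∫ μ, F μ ∂(h.kernel t) :=
  ProbabilityMeasure.continuous_integral_boundedContinuousFunction F |>.comp h.continuous_curve

theorem RMsol.lintegral_wMass_lt_top (h : RMsol hT b a M) :
    ∫⁻ t in Icc (0:ℝ) T, ∫⁻ μ, wMass b a t μ ∂(h.kernel t) < ∞ := by
  rw [setLIntegral_congr_fun (g := fun t => ∫⁻ μ, wMass b a t μ ∂(M t)) measurableSet_Icc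
    fun t ht => by simp only [h.kernel_apply_of_mem ht]]
  exact h.2.2.1

theorem exists_cutoff_cylinder {k : ℕ} {Ψ : (Fin k → ℝ) → ℝ} (hΨ : ContDiff ℝ 1 Ψ)
    {Φ : Fin k → Ed d → ℝ} (hΦ : ∀ i, IsTestPhi (Φ i)) :
    ∃ Ψ' : (Fin k → ℝ) → ℝ, ContDiff ℝ 1 Ψ' ∧ HasCompactSupport Ψ' ∧
      (∀ μ : Pm d, Ψ' (fun i => ∫ x, Φ i x ∂(μ : Measure (Ed d)))
        = Ψ (fun i => ∫ x, Φ i x ∂(μ : Measure (Ed d)))) ∧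
      ∀ t μ, cylDrift b a Ψ' Φ t μ = cylDrift b a Ψ Φ t μ := by
  choose C hC0 hC using fun i => (hΦ i).exists_wBound
  have hR0 : 0 ≤ ∑ i, C i := Finset.sum_nonneg fun i _ => (hC0 i).le
  let χ : ContDiffBump (0 : Fin k → ℝ) :=
    ⟨∑ i, C i + 1, ∑ i, C i + 2, by linarith, by linarith⟩
  have hev : ∀ μ : Pm d, (fun y => χ y * Ψ y)
      =ᶠ[𝓝 (fun i => ∫ x, Φ i x ∂(μ : Measure (Ed d)))] Ψ := by
    intro μ
    have hmem : (fun i => ∫ x, Φ i x ∂(μ : Measure (Ed d))) ∈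
        Metric.ball (0 : Fin k → ℝ) (∑ i, C i + 1) := by
      rw [mem_ball_zero_iff, pi_norm_lt_iff (by linarith)]
      intro i
      have h1 := (hC i).abs_integral_le μ
      have h2 := Finset.single_le_sum (f := C) (fun i _ => (hC0 i).le) (Finset.mem_univ i)
      rw [Real.norm_eq_abs]
      linarith
    filter_upwards [Metric.isOpen_ball.mem_nhds hmem] with y hy
    rw [χ.one_of_mem_closedBall (Metric.ball_subset_closedBall hy), one_mul]
  refine ⟨fun y => χ y * Ψ y, χ.contDiff.mul hΨ, χ.hasCompactSupport.mul_right,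
    fun μ => (hev μ).eq_of_nhds, fun t μ => ?_⟩
  unfold cylDrift
  rw [(hev μ).fderiv_eq]

theorem RMsol.sub_eq_integral
    (hb : Measurable fun p : ℝ × Ed d × Pm d => b p.1 p.2.1 p.2.2)
    (ha : Measurable fun p : ℝ × Ed d × Pm d => a p.1 p.2.1 p.2.2)
    (h : RMsol hT b a M) {k : ℕ} {Ψ : (Fin k → ℝ) → ℝ}
    (hΨ : ContDiff ℝ 1 Ψ) {Φ : Fin k → Ed d → ℝ} (hΦ : ∀ i, IsTestPhi (Φ i)) :
    IntervalIntegrable (fun t => ∫ μ, cylDrift b a Ψ Φ t μ ∂(h.kernel t)) volume 0 T ∧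
    ∀ t ∈ Icc 0 T,
      ∫ μ : Pm d, Ψ (fun i => ∫ x, Φ i x ∂(μ : Measure (Ed d))) ∂(h.kernel t)
        - ∫ μ : Pm d, Ψ (fun i => ∫ x, Φ i x ∂(μ : Measure (Ed d))) ∂(h.kernel 0)
        = ∫ r in (0:ℝ)..t, ∫ μ, cylDrift b a Ψ Φ r μ ∂(h.kernel r) := by
  obtain ⟨Ψ', hΨ', hΨc, e1, e2⟩ := exists_cutoff_cylinder (b := b) (a := a) hΨ hΦ
  simp only [← e1, ← e2]
  have hDm := measurable_cylDrift hb ha hΨ' hΦ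
  obtain ⟨C, hC⟩ := exists_enorm_cylDrift_le (b := b) (a := a) hΨ' hΦ
  have hI : IntervalIntegrable (fun t => ∫ μ, cylDrift b a Ψ' Φ t μ ∂(h.kernel t))
      volume 0 T := by
    rw [intervalIntegrable_iff_integrableOn_Icc_of_le hT]
    refine integrable_of_enorm_le_mul (C := C)
      (hDm.stronglyMeasurable.integral_kernel_prod_right' (κ := h.kernel)).measurable
      (fun t => ?_) h.lintegral_wMass_lt_top
    refine (enorm_integral_le_lintegral_enorm _).trans ?_
    rw [← lintegral_const_mul' _ _ ENNReal.ofReal_ne_top]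
    exact lintegral_mono fun μ => hC t μ
  refine ⟨hI, sub_eq_integral_of_weak hT ?_ hI fun ξ hξ => ?_⟩
  · obtain ⟨D, hD⟩ := hΨ'.continuous.bounded_above_of_compact_support hΨc
    let F : BoundedContinuousFunction (Pm d) ℝ :=
      BoundedContinuousFunction.ofNormedAddCommGroup
        (fun μ : Pm d => Ψ' fun i => ∫ x, Φ i x ∂(μ : Measure (Ed d)))
        (hΨ'.continuous.comp (continuous_pi fun i => (hΦ i).continuous_integral)) D
        fun μ => hD _
    exact (h.continuous_integral_kernel F).continuousOn
  · have := h.2.2.2 k Ψ' Φ hΨ' hΨc hΦ ξ hξ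
    have hc : ∀ f g : ℝ → ℝ, (∀ t ∈ Icc 0 T, f t = g t) →
        ∫ t in (0:ℝ)..T, f t = ∫ t in (0:ℝ)..T, g t := fun f g hfg =>
      intervalIntegral.integral_congr fun t ht => hfg t (by rwa [uIcc_of_le hT] at ht)
    refine (hc _ _ fun t ht => ?_).trans (this.trans (congrArg Neg.neg (hc _ _ fun t ht => ?_)))
    · rw [h.kernel_apply_of_mem ht]
    · rw [h.kernel_apply_of_mem ht]
      rfl

end Coefficients

section Coefficients

variable {T : ℝ} {d : ℕ} {b : ℝ → Ed d → Pm d → Ed d}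
  {a : ℝ → Ed d → Pm d → (Ed d →L[ℝ] Ed d)} {hT : 0 ≤ T} {M : ℝ → Measure (Pm d)}

/-- The velocity of the moments of a random measure, vanishing for times outside `[0,T]`. -/
def momentVelocity (T : ℝ) (b : ℝ → Ed d → Pm d → Ed d)
    (a : ℝ → Ed d → Pm d → (Ed d →L[ℝ] Ed d)) (φ : ℕ → Ed d → ℝ) (r : HCube → Pm d) (k : ℕ)
    (p : ℝ × HCube) : ℝ :=
  (Icc 0 T).indicator (fun t => drift b a (φ k) t (r p.2)) p.1

theorem momentVelocity_of_mem {φ : ℕ → Ed d → ℝ} {r : HCube → Pm d} {k : ℕ} {t : ℝ}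
    (ht : t ∈ Icc 0 T) (x : HCube) :
    momentVelocity T b a φ r k (t, x) = drift b a (φ k) t (r x) :=
  indicator_of_mem ht _

theorem momentVelocity_of_notMem {φ : ℕ → Ed d → ℝ} {r : HCube → Pm d} {k : ℕ} {t : ℝ}
    (ht : t ∉ Icc 0 T) (x : HCube) : momentVelocity T b a φ r k (t, x) = 0 :=
  indicator_of_notMem ht _

variable {φ : ℕ → Ed d → ℝ} {κ : ℝ} {r : HCube → Pm d}

theorem measurable_momentVelocity
    (hb : Measurable fun p : ℝ × Ed d × Pm d => b p.1 p.2.1 p.2.2)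
    (ha : Measurable fun p : ℝ × Ed d × Pm d => a p.1 p.2.1 p.2.2)
    (hφ : IsTestFamily φ κ) (hr : Measurable r)
    (k : ℕ) : Measurable (momentVelocity T b a φ r k) := by
  have h1 : Measurable fun p : ℝ × HCube => drift b a (φ k) p.1 (r p.2) :=
    (measurable_drift hb ha (hφ.test k).1).comp
      (measurable_fst.prodMk (hr.comp measurable_snd))
  have h2 : MeasurableSet (Icc 0 T ×ˢ (univ : Set HCube)) :=
    measurableSet_Icc.prod MeasurableSet.univ
  have h3 : momentVelocity T b a φ r k = (Icc 0 T ×ˢ (univ : Set HCube)).indicator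
      fun p : ℝ × HCube => drift b a (φ k) p.1 (r p.2) := by
    ext p
    by_cases hp : p.1 ∈ Icc 0 T
    · rw [indicator_of_mem (by exact ⟨hp, mem_univ _⟩)]
      exact momentVelocity_of_mem hp p.2
    · rw [indicator_of_notMem (fun h => hp h.1)]
      exact momentVelocity_of_notMem hp p.2
  exact h3 ▸ h1.indicator h2

/-- The law of the moments of a solution of the random measure equation. -/
def RMsol.momentKernel (h : RMsol hT b a M) (φ : ℕ → Ed d → ℝ) : Kernel ℝ HCube :=
  h.kernel.map (momentMap φ)

theorem RMsol.isMarkovKernel_momentKernel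
    (hφ : IsTestFamily φ κ)
    (h : RMsol hT b a M) :
    IsMarkovKernel (h.momentKernel φ) :=
  Kernel.IsMarkovKernel.map _ hφ.continuous_momentMap.measurable

theorem RMsol.momentKernel_apply
    (hφ : IsTestFamily φ κ)
    (h : RMsol hT b a M) (t : ℝ) :
    h.momentKernel φ t = (h.kernel t).map (momentMap φ) :=
  Kernel.map_apply _ hφ.continuous_momentMap.measurable _

theorem RMsol.ae_wMass_lt_top
    (hb : Measurable fun p : ℝ × Ed d × Pm d => b p.1 p.2.1 p.2.2)
    (ha : Measurable fun p : ℝ × Ed d × Pm d => a p.1 p.2.1 p.2.2)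
    (h : RMsol hT b a M) :
    ∀ᵐ t, t ∈ Icc 0 T → ∀ᵐ μ ∂(h.kernel t), wMass b a t μ < ∞ := by
  have hW := measurable_wMass hb ha
  have hm : Measurable fun t => ∫⁻ μ, wMass b a t μ ∂(h.kernel t) :=
    hW.lintegral_kernel_prod_right' (κ := h.kernel)
  filter_upwards [(ae_restrict_iff' measurableSet_Icc).mp
    (ae_lt_top hm h.lintegral_wMass_lt_top.ne)] with t ht hmem
  exact ae_lt_top (hW.comp measurable_prodMk_left) (ht hmem).ne

theorem RMsol.weakFlow
    (hb : Measurable fun p : ℝ × Ed d × Pm d => b p.1 p.2.1 p.2.2)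
    (ha : Measurable fun p : ℝ × Ed d × Pm d => a p.1 p.2.1 p.2.2)
    (hφ : IsTestFamily φ κ) (hr : Measurable r) (hrφ : ∀ μ, r (momentMap φ μ) = μ)
    (h : RMsol hT b a M) :
    WeakFlow (h.momentKernel φ) (momentVelocity T b a φ r) := by
  have hmk := hφ.continuous_momentMap
  have hMark := h.isMarkovKernel_momentKernel hφ
  have hVm : ∀ k, Measurable (momentVelocity T b a φ r k) :=
    measurable_momentVelocity hb ha hφ hr
  refine ⟨fun F => ?_, hVm, fun k => ?_, fun K Ψ hΨ => ?_⟩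
  · let G : BoundedContinuousFunction (Pm d) ℝ :=
      (BoundedContinuousFunction.mkOfCompact F).compContinuous ⟨momentMap φ, hmk⟩
    refine (h.continuous_integral_kernel G).congr fun t => ?_
    rw [h.momentKernel_apply hφ, integral_map hmk.measurable.aemeasurable
      F.continuous.measurable.aestronglyMeasurable]
    rfl
  · refine ⟨(hVm k).aestronglyMeasurable, ?_⟩
    obtain ⟨C, _, hC⟩ := (hφ.test k).exists_wBound
    change ∫⁻ p, _ ∂_ < ∞
    rw [Measure.lintegral_compProd (hVm k).enorm]
    have hle : ∀ t, ∫⁻ x, ‖momentVelocity T b a φ r k (t, x)‖ₑ ∂(h.momentKernel φ t)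
        ≤ (Icc 0 T).indicator
          (fun t => ENNReal.ofReal (C * (1 + d)) * ∫⁻ μ, wMass b a t μ ∂(h.kernel t)) t := by
      intro t
      rw [h.momentKernel_apply hφ, lintegral_map
        (f := fun x => ‖momentVelocity T b a φ r k (t, x)‖ₑ)
        ((hVm k).comp measurable_prodMk_left).enorm hmk.measurable]
      by_cases ht : t ∈ Icc 0 T
      · rw [indicator_of_mem ht, ← lintegral_const_mul' _ _ ENNReal.ofReal_ne_top]
        refine lintegral_mono fun μ => ?_
        rw [momentVelocity_of_mem ht, hrφ]
        exact hC.enorm_drift_le t μ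
      · simp [momentVelocity_of_notMem ht]
    refine (lintegral_mono hle).trans_lt ?_
    rw [lintegral_indicator measurableSet_Icc, lintegral_const_mul' _ _ ENNReal.ofReal_ne_top]
    exact ENNReal.mul_lt_top ENNReal.ofReal_lt_top h.lintegral_wMass_lt_top
  · have hΦ : ∀ i : Fin K, IsTestPhi (φ i) := fun i => hφ.test i
    have hfc : ∀ μ : Pm d, firstCoords K (momentMap φ μ)
        = fun i : Fin K => ∫ x, φ i x ∂(μ : Measure (Ed d)) := by
      intro μ
      ext i
      exact hφ.coe_momentMap μ i
    obtain ⟨hI, hsub⟩ := h.sub_eq_integral hb ha hΨ hΦ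
    have hA : ∀ t, ∫ x, Ψ (firstCoords K x) ∂(h.momentKernel φ t)
        = ∫ μ : Pm d, Ψ (fun i : Fin K => ∫ x, φ i x ∂(μ : Measure (Ed d)))
          ∂(h.kernel t) := by
      intro t
      rw [h.momentKernel_apply hφ, integral_map
        (f := fun x => Ψ (firstCoords K x)) hmk.measurable.aemeasurable
        (hΨ.continuous.comp (continuous_firstCoords K)).measurable.aestronglyMeasurable]
      simp only [hfc]
    have hfd : ∀ m : Fin K, Continuous fun x : HCube =>
        fderiv ℝ Ψ (firstCoords K x) (Pi.single m 1) := fun m =>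
      ((hΨ.continuous_fderiv (by simp)).comp (continuous_firstCoords K)).clm_apply
        continuous_const
    have hB : ∀ᵐ t, ∫ x, ∑ m : Fin K, fderiv ℝ Ψ (firstCoords K x) (Pi.single m 1) *
          momentVelocity T b a φ r m (t, x) ∂(h.momentKernel φ t)
        = (Icc 0 T).indicator (fun t => ∫ μ, cylDrift b a Ψ (fun i : Fin K => φ i) t μ
          ∂(h.kernel t)) t := by
      filter_upwards [h.ae_wMass_lt_top hb ha] with t ht
      have hmeas : Measurable fun x => ∑ m : Fin K,
          fderiv ℝ Ψ (firstCoords K x) (Pi.single m 1) * momentVelocity T b a φ r m (t, x) :=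
        Finset.measurable_fun_sum _ fun m _ =>
          (hfd m).measurable.mul ((hVm m).comp measurable_prodMk_left)
      rw [h.momentKernel_apply hφ, integral_map hmk.measurable.aemeasurable
        hmeas.aestronglyMeasurable]
      by_cases hmem : t ∈ Icc 0 T
      · rw [indicator_of_mem hmem]
        refine integral_congr_ae ?_
        filter_upwards [ht hmem] with μ hμ
        rw [cylDrift_eq_sum hb ha Ψ hΦ hμ, hfc]
        simp only [momentVelocity_of_mem hmem, hrφ]
      · simp [momentVelocity_of_notMem hmem, indicator_of_notMem hmem]
    have hall : ∀ t, ∫ x, Ψ (firstCoords K x) ∂(h.momentKernel φ t)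
        - ∫ x, Ψ (firstCoords K x) ∂(h.momentKernel φ 0)
        = ∫ s in (0:ℝ)..t, (Icc 0 T).indicator
          (fun t => ∫ μ, cylDrift b a Ψ (fun i : Fin K => φ i) t μ ∂(h.kernel t)) s := by
      intro t
      rw [intervalIntegral_indicator_Icc hT, ← hsub _ (projIcc 0 T hT t).2, hA, hA]
      have : h.kernel (projIcc 0 T hT t) = h.kernel t := by
        rw [h.kernel_apply, h.kernel_apply, projIcc_val]
      rw [this]
    have hInd : Integrable ((Icc 0 T).indicator
        (fun t => ∫ μ, cylDrift b a Ψ (fun i : Fin K => φ i) t μ ∂(h.kernel t))) := by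
      rw [integrable_indicator_iff measurableSet_Icc,
        ← intervalIntegrable_iff_integrableOn_Icc_of_le hT]
      exact hI
    intro s t _
    rw [intervalIntegral.integral_congr_ae (hB.mono fun t ht _ => ht),
      ← intervalIntegral.integral_interval_sub_left (a := 0) hInd.intervalIntegrable
        hInd.intervalIntegrable, ← hall, ← hall]
    ring

end Coefficients

theorem enorm_intervalIntegral_le_lintegral {T t : ℝ} (ht : t ∈ Icc 0 T) (f : ℝ → ℝ) :
    ‖∫ s in (0:ℝ)..t, f s‖ₑ ≤ ∫⁻ s in Icc 0 T, ‖f s‖ₑ := by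
  rw [intervalIntegral.integral_of_le ht.1]
  exact (enorm_integral_le_lintegral_enorm _).trans
    (lintegral_mono_set (Ioc_subset_Icc_self.trans (Icc_subset_Icc_right ht.2)))

section Coefficients

variable {T : ℝ} {d : ℕ} {b : ℝ → Ed d → Pm d → Ed d}
  {a : ℝ → Ed d → Pm d → (Ed d →L[ℝ] Ed d)}
  {φ : ℕ → Ed d → ℝ} {κ : ℝ}

theorem IsTestFamily.enorm_Lop_le
    (hφ : IsTestFamily φ κ)
    (k : ℕ) (t : ℝ) (μ : Pm d) (x : Ed d) :
    ‖Lop b a μ t (φ k) x‖ₑ ≤ ENNReal.ofReal (wInt b a t x μ) := by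
  have h := (hφ.bound k).enorm_Lop_le (b := b) (a := a) t μ x
  have h1 : (1 / (1 + d) * (1 + d) : ℝ) = 1 := by
    have : (0:ℝ) < 1 + d := by positivity
    field_simp
  rwa [h1, ENNReal.ofReal_one, one_mul] at h

theorem IsTestFamily.enorm_drift_le
    (hφ : IsTestFamily φ κ)
    (k : ℕ) (t : ℝ) (μ : Pm d) :
    ‖drift b a (φ k) t μ‖ₑ ≤ wMass b a t μ :=
  (enorm_integral_le_lintegral_enorm _).trans
    (lintegral_mono fun x => hφ.enorm_Lop_le k t μ x)

theorem IsTestFamily.Lop_cutoff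
    (hφ : IsTestFamily φ κ)
    {n : ℕ} {x : Ed d} (hx : ‖x‖ ≤ n) (t : ℝ) (μ : Pm d) :
    Lop b a μ t (φ (2 * n + 1)) x = 0 := by
  have h1 : φ (2 * n + 1) = fun x => cutoff d n x - (1 - κ) * cutoff d n x := by
    ext y
    rw [hφ.cut]
    ring
  rw [h1, Lop_sub_smul μ t (isTestPhi_cutoff d n).1 (isTestPhi_cutoff d n).1,
    Lop_cutoff_eq_zero hx]
  ring

theorem IsTestFamily.tendsto_enorm_drift_cutoff
    (hb : Measurable fun p : ℝ × Ed d × Pm d => b p.1 p.2.1 p.2.2)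
    (ha : Measurable fun p : ℝ × Ed d × Pm d => a p.1 p.2.1 p.2.2)
    (hφ : IsTestFamily φ κ)
    {t : ℝ} {μ : Pm d} (h : wMass b a t μ < ∞) :
    Tendsto (fun n => ‖drift b a (φ (2 * n + 1)) t μ‖ₑ) atTop (𝓝 0) := by
  have h1 : Tendsto (fun n => ∫⁻ x, ‖Lop b a μ t (φ (2 * n + 1)) x‖ₑ ∂(μ : Measure (Ed d)))
      atTop (𝓝 (∫⁻ _, 0 ∂(μ : Measure (Ed d)))) := by
    refine tendsto_lintegral_of_dominated_convergence
      (fun x => ENNReal.ofReal (wInt b a t x μ)) (fun n => ?_)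
      (fun n => ae_of_all _ fun x => hφ.enorm_Lop_le _ t μ x) h.ne
      (ae_of_all _ fun x => ?_)
    · exact ((measurable_Lop_right hb ha (hφ.test _).1).comp
        (measurable_prodMk_left (x := (t, μ)))).enorm
    · obtain ⟨N, hN⟩ := exists_nat_ge ‖x‖
      refine tendsto_const_nhds.congr' ?_
      filter_upwards [eventually_ge_atTop N] with n hn
      rw [hφ.Lop_cutoff (hN.trans (by exact_mod_cast hn)), enorm_zero]
  rw [lintegral_zero] at h1
  exact tendsto_of_tendsto_of_tendsto_of_le_of_le tendsto_const_nhds h1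
    (fun n => zero_le) fun n => enorm_integral_le_lintegral_enorm _

variable {m : ℝ → Pm d}

theorem IsTestFamily.tendsto_lintegral_drift_cutoff
    (hb : Measurable fun p : ℝ × Ed d × Pm d => b p.1 p.2.1 p.2.2)
    (ha : Measurable fun p : ℝ × Ed d × Pm d => a p.1 p.2.1 p.2.2)
    (hφ : IsTestFamily φ κ)
    (hm : Measurable m)
    (h : ∫⁻ t in Icc 0 T, wMass b a t (m t) < ∞) :
    Tendsto (fun n => ∫⁻ t in Icc 0 T, ‖drift b a (φ (2 * n + 1)) t (m t)‖ₑ) atTop (𝓝 0) := by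
  have hW : Measurable fun t => wMass b a t (m t) :=
    (measurable_wMass hb ha).comp (measurable_id.prodMk hm)
  have h1 := tendsto_lintegral_of_dominated_convergence (μ := volume.restrict (Icc 0 T))
    (F := fun n t => ‖drift b a (φ (2 * n + 1)) t (m t)‖ₑ) (f := fun _ => 0)
    (fun t => wMass b a t (m t))
    (fun n => ((measurable_drift hb ha (hφ.test _).1).comp (measurable_id.prodMk hm)).enorm)
    (fun n => ae_of_all _ fun t => hφ.enorm_drift_le _ t _) h.ne
    ((ae_lt_top hW h.ne).mono fun t ht => hφ.tendsto_enorm_drift_cutoff hb ha ht)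
  rwa [lintegral_zero] at h1

/-- A path of moments following the drift cannot lose mass at infinity. -/
theorem IsTestFamily.mem_range_of_path
    (hb : Measurable fun p : ℝ × Ed d × Pm d => b p.1 p.2.1 p.2.2)
    (ha : Measurable fun p : ℝ × Ed d × Pm d => a p.1 p.2.1 p.2.2)
    (hφ : IsTestFamily φ κ)
    (hm : Measurable m)
    (h : ∫⁻ t in Icc 0 T, wMass b a t (m t) < ∞) {z : ℝ → HCube}
    (h0 : z 0 ∈ range (momentMap φ))
    (hcl : ∀ t ∈ Icc 0 T, z t ∈ closure (range (momentMap φ)))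
    (heq : ∀ k, ∀ t ∈ Icc 0 T,
      (z t k : ℝ) - z 0 k = ∫ s in (0:ℝ)..t, drift b a (φ k) s (m s)) :
    ∀ t ∈ Icc 0 T, z t ∈ range (momentMap φ) := by
  intro t ht
  refine hφ.mem_range_momentMap (hcl t ht) fun ε hε => ?_
  obtain ⟨μ, hμ⟩ := h0
  have h1 := (tendsto_integral_cutoff μ).const_mul κ
  rw [mul_one] at h1
  have h2 := hφ.tendsto_lintegral_drift_cutoff hb ha hm h
  obtain ⟨n, hn1, hn2⟩ := ((h1.eventually (lt_mem_nhds (sub_lt_self κ (half_pos hε)))).and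
    (h2.eventually (gt_mem_nhds (ENNReal.ofReal_pos.mpr (half_pos hε))))).exists
  refine ⟨n, ?_⟩
  rw [← hφ.momentMap_cutoff, hμ] at hn1
  have h3 := (enorm_intervalIntegral_le_lintegral ht _).trans_lt hn2
  rw [← heq (2 * n + 1) t ht, Real.enorm_eq_ofReal_abs,
    ENNReal.ofReal_lt_ofReal_iff (half_pos hε)] at h3
  have h4 := neg_lt_of_abs_lt h3
  linarith

theorem drift_sub_smul
    (hb : Measurable fun p : ℝ × Ed d × Pm d => b p.1 p.2.1 p.2.2)
    (ha : Measurable fun p : ℝ × Ed d × Pm d => a p.1 p.2.1 p.2.2)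
    {ψ θ : Ed d → ℝ} (hψ : IsTestPhi ψ) (hθ : IsTestPhi θ) (ρ : ℝ) {t : ℝ}
    {μ : Pm d} (h : wMass b a t μ < ∞) :
    drift b a (fun x => ψ x - ρ * θ x) t μ = drift b a ψ t μ - ρ * drift b a θ t μ := by
  unfold drift
  rw [← integral_const_mul, ← integral_sub (hψ.integrable_Lop hb ha h)
    ((hθ.integrable_Lop hb ha h).const_mul ρ)]
  simp only [Lop_sub_smul μ t hθ.1 hψ.1]

theorem IsTestFamily.sub_eq_integral_drift
    (hb : Measurable fun p : ℝ × Ed d × Pm d => b p.1 p.2.1 p.2.2)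
    (ha : Measurable fun p : ℝ × Ed d × Pm d => a p.1 p.2.1 p.2.2)
    (hφ : IsTestFamily φ κ)
    {hT : 0 ≤ T} (c : CurveSp T d)
    (h : ∫⁻ t in Icc (0:ℝ) T, wMass b a t (c (projIcc 0 T hT t)) < ∞)
    (heq : ∀ k, ∀ t ∈ Icc 0 T,
      (∫ x, φ k x ∂(c (projIcc 0 T hT t) : Measure (Ed d)))
        - ∫ x, φ k x ∂(c (projIcc 0 T hT 0) : Measure (Ed d))
        = ∫ s in (0:ℝ)..t, drift b a (φ k) s (c (projIcc 0 T hT s)))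
    {ψ : Ed d → ℝ} (hψ : IsTestPhi ψ) {t : ℝ} (ht : t ∈ Icc 0 T) :
      (∫ x, ψ x ∂(c (projIcc 0 T hT t) : Measure (Ed d)))
        - ∫ x, ψ x ∂(c (projIcc 0 T hT 0) : Measure (Ed d))
        = ∫ s in (0:ℝ)..t, drift b a ψ s (c (projIcc 0 T hT s)) := by
  set W := ∫⁻ t in Icc (0:ℝ) T, wMass b a t (c (projIcc 0 T hT t)) with hW
  have hWm : Measurable fun t => wMass b a t (c (projIcc 0 T hT t)) :=
    (measurable_wMass hb ha).comp
      (measurable_id.prodMk (continuous_curve_projIcc hT c).measurable)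
  have hII : ∀ {θ : Ed d → ℝ}, IsTestPhi θ →
      IntervalIntegrable (fun s => drift b a θ s (c (projIcc 0 T hT s))) volume 0 t := by
    intro θ hθ
    refine (intervalIntegrable_drift hb ha h hθ).mono_set ?_
    rw [uIcc_of_le ht.1, uIcc_of_le hT]
    exact Icc_subset_Icc_right ht.2
  rw [← sub_eq_zero]
  refine abs_eq_zero.mp (le_antisymm ?_ (abs_nonneg _))
  have hbound : ∀ ε > 0, |(∫ x, ψ x ∂(c (projIcc 0 T hT t) : Measure (Ed d)))
        - ∫ x, ψ x ∂(c (projIcc 0 T hT 0) : Measure (Ed d))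
        - ∫ s in (0:ℝ)..t, drift b a ψ s (c (projIcc 0 T hT s))|
        ≤ ε * (2 + (1 + d) * W.toReal) := by
    intro ε hε
    obtain ⟨k, ρ, hk⟩ := hφ.dense ψ hψ ε hε
    have e1 : ∀ μ : Pm d, ∫ x, (ψ x - ρ * φ k x) ∂(μ : Measure (Ed d))
        = ∫ x, ψ x ∂(μ : Measure (Ed d)) - ρ * ∫ x, φ k x ∂(μ : Measure (Ed d)) := by
      intro μ
      rw [integral_sub (hψ.integrable μ) (((hφ.test k).integrable μ).const_mul ρ),
        integral_const_mul]
    have e2 : ∫ s in (0:ℝ)..t, drift b a (fun x => ψ x - ρ * φ k x) s (c (projIcc 0 T hT s))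
        = (∫ s in (0:ℝ)..t, drift b a ψ s (c (projIcc 0 T hT s)))
          - ρ * ∫ s in (0:ℝ)..t, drift b a (φ k) s (c (projIcc 0 T hT s)) := by
      rw [← intervalIntegral.integral_const_mul,
        ← intervalIntegral.integral_sub (hII hψ) ((hII (hφ.test k)).const_mul ρ)]
      refine intervalIntegral.integral_congr_ae ?_
      filter_upwards [(ae_restrict_iff' measurableSet_Icc).mp (ae_lt_top hWm h.ne)] with s hs hmem
      rw [uIoc_of_le ht.1] at hmem
      exact drift_sub_smul hb ha hψ (hφ.test k) ρ (hs ⟨hmem.1.le, hmem.2.trans ht.2⟩)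
    have e3 : (∫ x, ψ x ∂(c (projIcc 0 T hT t) : Measure (Ed d)))
        - ∫ x, ψ x ∂(c (projIcc 0 T hT 0) : Measure (Ed d))
        - ∫ s in (0:ℝ)..t, drift b a ψ s (c (projIcc 0 T hT s))
        = ∫ x, (ψ x - ρ * φ k x) ∂(c (projIcc 0 T hT t) : Measure (Ed d))
        - ∫ x, (ψ x - ρ * φ k x) ∂(c (projIcc 0 T hT 0) : Measure (Ed d))
        - ∫ s in (0:ℝ)..t, drift b a (fun x => ψ x - ρ * φ k x) s (c (projIcc 0 T hT s)) := by
      rw [e1, e1, e2, ← heq k t ht]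
      ring
    have h1 := hk.abs_integral_le (c (projIcc 0 T hT t))
    have h2 := hk.abs_integral_le (c (projIcc 0 T hT 0))
    have h3 : |∫ s in (0:ℝ)..t,
        drift b a (fun x => ψ x - ρ * φ k x) s (c (projIcc 0 T hT s))|
        ≤ ε * (1 + d) * W.toReal := by
      have h4 : ‖∫ s in (0:ℝ)..t,
          drift b a (fun x => ψ x - ρ * φ k x) s (c (projIcc 0 T hT s))‖ₑ
          ≤ ENNReal.ofReal (ε * (1 + d)) * W := by
        refine (enorm_intervalIntegral_le_lintegral ht _).trans ?_
        rw [hW, ← lintegral_const_mul' _ _ ENNReal.ofReal_ne_top]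
        exact lintegral_mono fun s => hk.enorm_drift_le s _
      have h5 := ENNReal.toReal_mono
        (ENNReal.mul_ne_top ENNReal.ofReal_ne_top h.ne) h4
      rw [ENNReal.toReal_mul, ENNReal.toReal_ofReal (by positivity), toReal_enorm] at h5
      exact h5
    rw [e3]
    refine (abs_sub _ _).trans ?_
    refine (add_le_add ((abs_sub _ _).trans (add_le_add h1 h2)) h3).trans (le_of_eq ?_)
    ring
  have hlim : Tendsto (fun ε : ℝ => ε * (2 + (1 + d) * W.toReal)) (𝓝[>] 0) (𝓝 0) := by
    have : Tendsto (fun ε : ℝ => ε * (2 + (1 + d) * W.toReal)) (𝓝 0)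
        (𝓝 (0 * (2 + (1 + d) * W.toReal))) := tendsto_id.mul_const _
    rw [zero_mul] at this
    exact this.mono_left nhdsWithin_le_nhds
  exact ge_of_tendsto hlim (by filter_upwards [self_mem_nhdsWithin] with ε hε using hbound ε hε)

theorem IsTestFamily.kfpMem
    (hb : Measurable fun p : ℝ × Ed d × Pm d => b p.1 p.2.1 p.2.2)
    (ha : Measurable fun p : ℝ × Ed d × Pm d => a p.1 p.2.1 p.2.2)
    (hφ : IsTestFamily φ κ)
    {hT : 0 ≤ T} (c : CurveSp T d)
    (h : ∫⁻ t in Icc (0:ℝ) T, wMass b a t (c (projIcc 0 T hT t)) < ∞)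
    (heq : ∀ k, ∀ t ∈ Icc 0 T,
      (∫ x, φ k x ∂(c (projIcc 0 T hT t) : Measure (Ed d)))
        - ∫ x, φ k x ∂(c (projIcc 0 T hT 0) : Measure (Ed d))
        = ∫ s in (0:ℝ)..t, drift b a (φ k) s (c (projIcc 0 T hT s))) :
    KFPmem hT b a c := by
  refine ⟨h, fun ξ ψ hξ hψ => ?_⟩
  have h1 := integral_deriv_mul_comp hT (K := 1) (Ψ := fun y => y 0)
    (contDiff_apply ℝ ℝ 0)
    (A := fun t _ => ∫ x, ψ x ∂(c (projIcc 0 T hT t) : Measure (Ed d)))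
    (B := fun t _ => drift b a ψ t (c (projIcc 0 T hT t)))
    (fun _ => intervalIntegrable_drift hb ha h hψ)
    (fun _ t ht => hφ.sub_eq_integral_drift hb ha c h heq hψ ht) hξ
  have h2 : ∀ y : Fin 1 → ℝ, fderiv ℝ (fun y : Fin 1 → ℝ => y 0) y (Pi.single 0 1) = 1 := by
    intro y
    rw [(hasFDerivAt_apply (𝕜 := ℝ) (0 : Fin 1) y).fderiv]
    simp
  simp only [Finset.univ_unique, Fin.default_eq_zero, Finset.sum_singleton, h2, one_mul] at h1
  exact h1

variable {r : HCube → Pm d}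

/-- A path of moments following the drift comes from a solution of the
Kolmogorov-Fokker-Planck equation. -/
theorem IsTestFamily.exists_kfpMem
    (hb : Measurable fun p : ℝ × Ed d × Pm d => b p.1 p.2.1 p.2.2)
    (ha : Measurable fun p : ℝ × Ed d × Pm d => a p.1 p.2.1 p.2.2)
    (hφ : IsTestFamily φ κ) (hr : Measurable r) (hrφ : ∀ μ, r (momentMap φ μ) = μ)
    (hT : 0 ≤ T) {z : ℝ → HCube} (hz : Continuous z)
    (h : ∫⁻ t in Icc 0 T, wMass b a t (r (z t)) < ∞)
    (h0 : z 0 ∈ range (momentMap φ))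
    (hcl : ∀ t ∈ Icc 0 T, z t ∈ closure (range (momentMap φ)))
    (heq : ∀ k, ∀ t ∈ Icc 0 T,
      (z t k : ℝ) - z 0 k = ∫ s in (0:ℝ)..t, drift b a (φ k) s (r (z s))) :
    ∃ c : CurveSp T d, KFPmem hT b a c ∧ ∀ t, c t = r (z t) := by
  have hrange := hφ.mem_range_of_path hb ha (hr.comp hz.measurable) h h0 hcl heq
  have hmr : ∀ t ∈ Icc 0 T, momentMap φ (r (z t)) = z t := by
    intro t ht
    obtain ⟨μ, hμ⟩ := hrange t ht
    rw [← hμ, hrφ]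
  have hcont : Continuous fun t : Icc 0 T => r (z t) := by
    rw [hφ.isEmbedding_momentMap.continuous_iff]
    exact (hz.comp continuous_subtype_val).congr fun t => (hmr t t.2).symm
  have hproj : ∀ t ∈ Icc 0 T, r (z (projIcc 0 T hT t)) = r (z t) := fun t ht => by
    rw [projIcc_of_mem hT ht]
  refine ⟨⟨_, hcont⟩, hφ.kfpMem hb ha _ ?_ fun k t ht => ?_, fun t => rfl⟩
  · change ∫⁻ t in Icc 0 T, wMass b a t (r (z (projIcc 0 T hT t))) < ∞
    rwa [setLIntegral_congr_fun (g := fun t => wMass b a t (r (z t))) measurableSet_Icc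
      fun t ht => congrArg (wMass b a t) (hproj t ht)]
  · have h1 : ∀ t ∈ Icc 0 T,
        ∫ x, φ k x ∂(r (z (projIcc 0 T hT t)) : Measure (Ed d)) = z t k := fun t ht => by
      rw [hproj t ht, ← hφ.coe_momentMap, hmr t ht]
    change ∫ x, φ k x ∂(r (z (projIcc 0 T hT t)) : Measure (Ed d))
      - ∫ x, φ k x ∂(r (z (projIcc 0 T hT 0)) : Measure (Ed d))
      = ∫ s in (0:ℝ)..t, drift b a (φ k) s (r (z (projIcc 0 T hT s)))
    rw [h1 t ht, h1 0 (left_mem_Icc.mpr hT), heq k t ht]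
    refine intervalIntegral.integral_congr fun s hs => ?_
    rw [uIcc_of_le ht.1] at hs
    exact congrArg (drift b a (φ k) s) (hproj s ⟨hs.1, hs.2.trans ht.2⟩).symm

end Coefficients

theorem continuous_primitive_Icc {T : ℝ} (hT : 0 ≤ T) {g : ℝ → ℝ}
    (hg : IntervalIntegrable g volume 0 T) :
    Continuous fun t : Icc (0:ℝ) T => ∫ s in (0:ℝ)..t, g s := by
  rw [intervalIntegrable_iff_integrableOn_Icc_of_le hT, ← uIcc_of_le hT] at hg
  have h := intervalIntegral.continuousOn_primitive_interval hg
  rw [uIcc_of_le hT] at h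
  exact h.comp_continuous continuous_subtype_val fun t => t.2

section Coefficients

variable {T : ℝ} {d : ℕ} {b : ℝ → Ed d → Pm d → Ed d}
  {a : ℝ → Ed d → Pm d → (Ed d →L[ℝ] Ed d)}

theorem ae_map_kfpMem
    (hb : Measurable fun p : ℝ × Ed d × Pm d => b p.1 p.2.1 p.2.2)
    (ha : Measurable fun p : ℝ × Ed d × Pm d => a p.1 p.2.1 p.2.2)
    {hT : 0 ≤ T} {Ω : Type*} [MeasurableSpace Ω] {η : Measure Ω}
    {f : Ω → CurveSp T d} (hf : Measurable f) (h : ∀ᵐ ω ∂η, KFPmem hT b a (f ω)) :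
    ∀ᵐ c ∂(η.map f), KFPmem hT b a c := by
  obtain ⟨φ, κ, hφ⟩ := exists_isTestFamily d
  have hunc := measurable_uncurry_curve d hT
  have hW : Measurable fun c : CurveSp T d =>
      ∫⁻ t in Icc (0:ℝ) T, wMass b a t (c (projIcc 0 T hT t)) := by
    have : Measurable fun p : CurveSp T d × ℝ => wMass b a p.2 (p.1 (projIcc 0 T hT p.2)) :=
      (measurable_wMass hb ha).comp (measurable_snd.prodMk (hunc.comp measurable_swap))
    exact this.lintegral_prod_right'
  have hfin : ∀ᵐ c ∂(η.map f),
      ∫⁻ t in Icc (0:ℝ) T, wMass b a t (c (projIcc 0 T hT t)) < ∞ := by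
    rw [ae_map_iff hf.aemeasurable (measurableSet_lt hW measurable_const)]
    exact h.mono fun ω hω => hω.1
  obtain ⟨D, hDc, hD⟩ := TopologicalSpace.exists_countable_dense (Icc (0:ℝ) T)
  have heq : ∀ᵐ c ∂(η.map f), ∀ k, ∀ t ∈ D,
      (∫ x, φ k x ∂(c (projIcc 0 T hT t) : Measure (Ed d)))
        - ∫ x, φ k x ∂(c (projIcc 0 T hT 0) : Measure (Ed d))
        = ∫ s in (0:ℝ)..t, drift b a (φ k) s (c (projIcc 0 T hT s)) := by
    rw [ae_all_iff]
    intro k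
    rw [ae_ball_iff hDc]
    intro t _
    have hl : ∀ s : ℝ, Measurable fun c : CurveSp T d =>
        ∫ x, φ k x ∂(c (projIcc 0 T hT s) : Measure (Ed d)) := fun s =>
      (hφ.test k).continuous_integral.measurable.comp (measurable_curve_projIcc d hT s)
    have hr : Measurable fun c : CurveSp T d =>
        ∫ s in (0:ℝ)..t, drift b a (φ k) s (c (projIcc 0 T hT s)) := by
      simp only [intervalIntegral.integral_of_le t.2.1]
      have : Measurable fun p : CurveSp T d × ℝ =>
          drift b a (φ k) p.2 (p.1 (projIcc 0 T hT p.2)) :=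
        (measurable_drift hb ha (hφ.test k).1).comp
          (measurable_snd.prodMk (hunc.comp measurable_swap))
      exact this.stronglyMeasurable.integral_prod_right'.measurable
    refine (ae_map_iff hf.aemeasurable
      (measurableSet_eq_fun ((hl _).sub (hl _)) hr)).mpr ?_
    filter_upwards [h] with ω hω
    exact hω.sub_eq_integral hb ha (hφ.test k) t t.2
  filter_upwards [hfin, heq] with c hc1 hc2
  refine hφ.kfpMem hb ha c hc1 fun k t ht => ?_
  have hcl : IsClosed {t : Icc (0:ℝ) T |
      (∫ x, φ k x ∂(c (projIcc 0 T hT t) : Measure (Ed d)))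
        - ∫ x, φ k x ∂(c (projIcc 0 T hT 0) : Measure (Ed d))
        = ∫ s in (0:ℝ)..t, drift b a (φ k) s (c (projIcc 0 T hT s))} := by
    refine isClosed_eq ?_ ?_
    · exact (((hφ.test k).continuous_integral.comp (continuous_curve_projIcc hT c)).comp
        continuous_subtype_val).sub continuous_const
    · exact continuous_primitive_Icc hT
        (intervalIntegrable_drift hb ha hc1 (hφ.test k))
  exact (hcl.closure_subset_iff.mpr (fun t ht => hc2 k t ht)) (hD ⟨t, ht⟩)

variable {hT : 0 ≤ T} {M : ℝ → Measure (Pm d)}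

theorem IsTestFamily.exists_kfpMem_of_dense
    (hb : Measurable fun p : ℝ × Ed d × Pm d => b p.1 p.2.1 p.2.2)
    (ha : Measurable fun p : ℝ × Ed d × Pm d => a p.1 p.2.1 p.2.2)
    {φ : ℕ → Ed d → ℝ} {κ : ℝ}
    (hφ : IsTestFamily φ κ) {r : HCube → Pm d} (hr : Measurable r)
    (hrφ : ∀ μ, r (momentMap φ μ) = μ) (hT : 0 ≤ T) {z : ℝ → HCube} (hz : Continuous z)
    (h : ∫⁻ t in Icc 0 T, wMass b a t (r (z t)) < ∞)
    (h0 : z 0 ∈ range (momentMap φ)) {D : Set (Icc (0:ℝ) T)} (hD : Dense D)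
    (hzD : ∀ t ∈ D, z t ∈ range (momentMap φ))
    (heq : ∀ k, ∀ t ∈ Icc 0 T,
      (z t k : ℝ) - z 0 k = ∫ s in (0:ℝ)..t, momentVelocity T b a φ r k (s, z s)) :
    ∃ c : CurveSp T d, KFPmem hT b a c ∧ ∀ t, c t = r (z t) := by
  refine hφ.exists_kfpMem hb ha hr hrφ hT hz h h0 (fun t ht => ?_) fun k t ht => ?_
  · have hcl : IsClosed {t : Icc (0:ℝ) T | z t ∈ closure (range (momentMap φ))} :=
      isClosed_closure.preimage (hz.comp continuous_subtype_val)
    have hDs : D ⊆ {t : Icc (0:ℝ) T | z t ∈ closure (range (momentMap φ))} :=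
      fun t ht => subset_closure (hzD t ht)
    exact hcl.closure_subset_iff.mpr hDs (hD ⟨t, ht⟩)
  · rw [heq k t ht]
    refine intervalIntegral.integral_congr fun s hs => ?_
    rw [uIcc_of_le ht.1] at hs
    exact momentVelocity_of_mem ⟨hs.1, hs.2.trans ht.2⟩ _

/-- The superposition principle: a solution of the random measure equation is the family of
marginals of a random solution of the Kolmogorov-Fokker-Planck equation. -/
theorem RMsol.exists_lifting
    (hb : Measurable fun p : ℝ × Ed d × Pm d => b p.1 p.2.1 p.2.2)
    (ha : Measurable fun p : ℝ × Ed d × Pm d => a p.1 p.2.1 p.2.2)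
    (h : RMsol hT b a M) :
    ∃ Λ : Measure (CurveSp T d), LamSol hT b a Λ ∧
      ∀ t ∈ Icc 0 T, Λ.map (fun c => c (projIcc 0 T hT t)) = M t := by
  obtain ⟨φ, κ, hφ⟩ := exists_isTestFamily d
  obtain ⟨r, hr, hrφ⟩ := hφ.exists_leftInverse
  have hmk := hφ.continuous_momentMap.measurable
  have hMark := h.isMarkovKernel_momentKernel hφ
  obtain ⟨η, hη, hmarg, hV⟩ :=
    (h.weakFlow hb ha hφ hr hrφ).exists_superposition ⌈T⌉₊
  have hsub : Icc 0 T ⊆ Icc (0:ℝ) ⌈T⌉₊ := Icc_subset_Icc_right (Nat.le_ceil T)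
  have hZc : ∀ ω, Continuous fun t => pathExt ⌈T⌉₊ t ω := continuous_pathExt _
  have hZm : ∀ t, Measurable (pathExt ⌈T⌉₊ t) := measurable_pathExt _
  have hZu : Measurable fun p : ℝ × (ℚ → HCube) => pathExt ⌈T⌉₊ p.1 p.2 :=
    measurable_uncurry_pathExt _
  generalize pathExt ⌈T⌉₊ = Z at hmarg hV hZc hZm hZu
  have hmargZ : ∀ t ∈ Icc 0 T, η.map (Z t) = (M t).map (momentMap φ) := fun t ht => by
    rw [hmarg t (hsub ht), h.momentKernel_apply hφ, h.kernel_apply_of_mem ht]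
  have hmargr : ∀ t ∈ Icc 0 T, η.map (fun ω => r (Z t ω)) = M t := by
    intro t ht
    have h1 : (η.map (Z t)).map r = η.map (fun ω => r (Z t ω)) := Measure.map_map hr (hZm t)
    rw [← h1, hmargZ t ht, Measure.map_map hr hmk]
    have h2 : r ∘ momentMap φ = id := funext hrφ
    rw [h2, Measure.map_id]
  have hW := measurable_wMass hb ha
  have hWZ : Measurable fun p : ℝ × (ℚ → HCube) => wMass b a p.1 (r (Z p.1 p.2)) :=
    hW.comp (measurable_fst.prodMk (hr.comp hZu))
  have hWfin : ∫⁻ ω, ∫⁻ t in Icc 0 T, wMass b a t (r (Z t ω)) ∂volume ∂η < ∞ := by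
    rw [lintegral_lintegral_swap (f := fun ω t => wMass b a t (r (Z t ω)))
      (hWZ.comp measurable_swap).aemeasurable]
    rw [setLIntegral_congr_fun (g := fun t => ∫⁻ μ, wMass b a t μ ∂(M t)) measurableSet_Icc
      fun t ht => ?_]
    · exact h.2.2.1
    · change _ = ∫⁻ μ, wMass b a t μ ∂(M t)
      rw [← hmargr t ht]
      exact (lintegral_map (g := fun ω => r (Z t ω)) (hW.comp measurable_prodMk_left)
        (hr.comp (hZm t))).symm
  have hWm : Measurable fun ω => ∫⁻ t in Icc 0 T, wMass b a t (r (Z t ω)) :=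
    (hWZ.comp measurable_swap).lintegral_prod_right'
  have hran : ∀ t ∈ Icc 0 T, ∀ᵐ ω ∂η, Z t ω ∈ range (momentMap φ) := by
    intro t ht
    refine ae_of_ae_map (hZm t).aemeasurable (p := fun x => x ∈ range (momentMap φ)) ?_
    rw [hmargZ t ht]
    exact (ae_map_iff hmk.aemeasurable hφ.measurableSet_range_momentMap).mpr
      (ae_of_all _ fun μ => mem_range_self μ)
  obtain ⟨D, hDc, hD⟩ := TopologicalSpace.exists_countable_dense (Icc (0:ℝ) T)
  have hgood : ∀ᵐ ω ∂η, ∃ c : CurveSp T d, KFPmem hT b a c ∧ ∀ t, c t = r (Z t ω) := by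
    have hae1 : ∀ᵐ ω ∂η, ∫⁻ t in Icc 0 T, wMass b a t (r (Z t ω)) < ∞ :=
      ae_lt_top hWm hWfin.ne
    have hae2 : ∀ᵐ ω ∂η, ∀ t ∈ D, Z t ω ∈ range (momentMap φ) :=
      (ae_ball_iff hDc).mpr fun t _ => hran t t.2
    have hae3 : ∀ᵐ ω ∂η, ∀ k, ∀ t ∈ Icc 0 T, (Z t ω k : ℝ) - Z 0 ω k
        = ∫ s in (0:ℝ)..t, momentVelocity T b a φ r k (s, Z s ω) :=
      ae_all_iff.mpr fun k => (hV k).mono fun ω hω t ht => hω.2 t (hsub ht)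
    filter_upwards [hae1, hran 0 (left_mem_Icc.mpr hT), hae2, hae3] with ω h1 h2 h3 h4
    exact hφ.exists_kfpMem_of_dense hb ha hr hrφ hT (hZc ω) h1 h2 hD h3 h4
  obtain ⟨G, hGae, hGm, hGsub⟩ := hgood.exists_measurable_mem
  have hG : ∀ᵐ ω ∂η, ω ∈ G := hGae
  have : Nonempty (CurveSp T d) := ⟨ContinuousMap.const _ (nonempty_Pm d).some⟩
  choose! g hg1 hg2 using hGsub
  classical
  let f : (ℚ → HCube) → CurveSp T d := fun ω =>
    if ω ∈ G then g ω else ContinuousMap.const _ (nonempty_Pm d).some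
  have hfG : ∀ ω ∈ G, f ω = g ω := fun ω hω => if_pos hω
  have hfm : Measurable f := by
    refine measurable_curve fun t => ?_
    have : (fun ω => f ω t) = fun ω => if ω ∈ G then r (Z t ω) else (nonempty_Pm d).some := by
      ext1 ω
      by_cases hω : ω ∈ G
      · rw [hfG ω hω, if_pos hω, hg2 ω hω]
      · rw [if_neg hω]
        simp only [f, if_neg hω, ContinuousMap.const_apply]
    rw [this]
    exact Measurable.ite hGm (hr.comp (hZm t)) measurable_const
  have hfZ : ∀ᵐ ω ∂η, ∀ t ∈ Icc 0 T, f ω (projIcc 0 T hT t) = r (Z t ω) := by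
    filter_upwards [hG] with ω hω t ht
    rw [hfG ω hω, hg2 ω hω, projIcc_of_mem hT ht]
  refine ⟨η.map f, ⟨Measure.isProbabilityMeasure_map hfm.aemeasurable,
    ae_map_kfpMem hb ha hfm ?_, ?_⟩, fun t ht => ?_⟩
  · filter_upwards [hG] with ω hω
    rw [hfG ω hω]
    exact hg1 ω hω
  · change ∫⁻ c, ∫⁻ t in Icc (0:ℝ) T, wMass b a t (c (projIcc 0 T hT t)) ∂volume ∂(η.map f) < ∞
    refine (lintegral_map_le _ _).trans_lt ?_
    rw [lintegral_congr_ae (g := fun ω => ∫⁻ t in Icc 0 T, wMass b a t (r (Z t ω)))]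
    · exact hWfin
    · filter_upwards [hfZ] with ω hω
      exact setLIntegral_congr_fun measurableSet_Icc fun t ht =>
        congrArg (wMass b a t) (hω t ht)
  · rw [Measure.map_map (measurable_curve_projIcc d hT t) hfm, ← hmargr t ht]
    exact Measure.map_congr (hfZ.mono fun ω hω => hω t ht)

end Coefficients

end Superposition

/-- Uniqueness for the random-measure equation (for every initial
random measure `M̄`) is equivalent to uniqueness, for every initial datum `M̄`, of the
liftings `Λ ∈ P(C([0,T],P(ℝ^d)))` concentrated on `KFP(b,a)` with `(e_0)_#Λ = M̄`. -/
theorem stmt16 {T : ℝ} {d : ℕ} (hT : 0 ≤ T)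
    (b : ℝ → Ed d → Pm d → Ed d)
    (a : ℝ → Ed d → Pm d → (Ed d →L[ℝ] Ed d))
    (hb : Measurable fun p : ℝ × Ed d × Pm d => b p.1 p.2.1 p.2.2)
    (ha : Measurable fun p : ℝ × Ed d × Pm d => a p.1 p.2.1 p.2.2) :
    (∀ Mbar : Measure (Pm d), IsProbabilityMeasure Mbar →
      ∀ M₁ M₂ : ℝ → Measure (Pm d), RMsol hT b a M₁ → RMsol hT b a M₂ →
        M₁ 0 = Mbar → M₂ 0 = Mbar → ∀ t ∈ Set.Icc (0:ℝ) T, M₁ t = M₂ t) ↔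
    (∀ Mbar : Measure (Pm d), IsProbabilityMeasure Mbar →
      ∀ Λ₁ Λ₂ : Measure (CurveSp T d), LamSol hT b a Λ₁ → LamSol hT b a Λ₂ →
        Λ₁.map (fun c : CurveSp T d => c ⟨0, Set.left_mem_Icc.mpr hT⟩) = Mbar →
        Λ₂.map (fun c : CurveSp T d => c ⟨0, Set.left_mem_Icc.mpr hT⟩) = Mbar →
        Λ₁ = Λ₂) := by
  constructor
  · intro hM Mbar _ Λ₁ Λ₂ h₁ h₂ e₁ e₂
    exact h₁.eq_of_rmSol_unique hb ha hM h₂ (e₁.trans e₂.symm)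
  · intro hΛ Mbar hp M₁ M₂ h₁ h₂ e₁ e₂ t ht
    obtain ⟨Λ₁, hΛ₁, hm₁⟩ := h₁.exists_lifting hb ha
    obtain ⟨Λ₂, hΛ₂, hm₂⟩ := h₂.exists_lifting hb ha
    have h0 : (0:ℝ) ∈ Icc 0 T := left_mem_Icc.mpr hT
    have e : Λ₁ = Λ₂ := by
      refine hΛ Mbar hp Λ₁ Λ₂ hΛ₁ hΛ₂ ?_ ?_
      · rw [← e₁, ← hm₁ 0 h0, projIcc_left]
      · rw [← e₂, ← hm₂ 0 h0, projIcc_left]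
    rw [← hm₁ t ht, ← hm₂ t ht, e]
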